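/- arXiv:hep-th/9403178 — 2 statements merged into one kernel-verified Lean document; each statement's English description precedes it below -/
import Mathlib

section
/- Let V be a finite-dimensional real inner product space, A a finite set of unit vectors in V with −α ∈ A for every α ∈ A and A ∩ ℝα = {α, −α} for every α ∈ A, and k : A → ℝ with k(α) ≠ 0 and k(−α) = k(α) for all α ∈ A. Define U = {x ∈ V : (α,x) ≠ 0 for all α ∈ A}, U₂ = {x ∈ U : s_α(x) ∈ U for all α ∈ A}, and for ξ ∈ V and F smooth on U set (∇_ξ F)(x) = (∂_ξ F)(x) + (1/2) Σ_{α∈A} k(α)(α,ξ)(α,x)⁻¹ F(s_α(x)). If for all ξ, η ∈ V and every smooth F : U → ℝ one has ∇_ξ(∇_η F) = ∇_η(∇_ξ F) at every point of U₂, then s_α(A) = A for every α ∈ A (i.e. A is the root system of a finite reflection (Coxeter) group) and k(s_α(β)) = k(β) for all α, β ∈ A. -/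
/-!
STATEMENT 1: If the generalized Dunkl operators attached to a finite set `A` of
unit normals (with nonzero coefficients `k`, `k(-α) = k(α)`) commute on `U₂`,
then `A` is the root system of a Coxeter group (`s_α(A) = A`, i.e. `A` is closed
under the reflections `s_α`, `α ∈ A`) and `k` is invariant.
-/

open scoped RealInnerProductSpace

/-- The orthogonal reflection `s_α` fixing the hyperplane `α^⊥`. -/
noncomputable def reflectIn {V : Type*} [NormedAddCommGroup V] [InnerProductSpace ℝ V]
    (α x : V) : V :=
  x - (2 * ⟪α, x⟫ / ⟪α, α⟫) • α

/-- The Dunkl-type operator `∇_ξ` attached to the finite set `A` with coefficients `k`: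
`(∇_ξ F)(x) = (∂_ξ F)(x) + (1/2) Σ_{α∈A} k(α)(α,ξ)(α,x)⁻¹ F(s_α x)`. -/
noncomputable def dunklOp {V : Type*} [NormedAddCommGroup V] [InnerProductSpace ℝ V]
    (A : Finset V) (k : V → ℝ) (ξ : V) (F : V → ℝ) (x : V) : ℝ :=
  fderiv ℝ F x ξ + (1 / 2) * ∑ α ∈ A, k α * ⟪α, ξ⟫ * (⟪α, x⟫)⁻¹ * F (reflectIn α x)


open Filter Topology

section aux
variable {V : Type*} [NormedAddCommGroup V] [InnerProductSpace ℝ V]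

lemma rf_eq {a : V} (ha : ‖a‖ = 1) (x : V) : reflectIn a x = x - (2 * ⟪a, x⟫) • a := by
  simp [reflectIn, ha]

lemma rf_neg (a x : V) : reflectIn (-a) x = reflectIn a x := by
  simp [reflectIn, neg_div]

lemma inner_self_one {a : V} (ha : ‖a‖ = 1) : ⟪a, a⟫ = 1 := by
  rw [real_inner_self_eq_norm_sq, ha]; norm_num

lemma rf_invol {a : V} (ha : ‖a‖ = 1) (x : V) : reflectIn a (reflectIn a x) = x := by
  rw [rf_eq ha, rf_eq ha, inner_sub_right, inner_smul_right, inner_self_one ha]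
  module

lemma rf_inner {a : V} (ha : ‖a‖ = 1) (x y : V) : ⟪x, reflectIn a y⟫ = ⟪reflectIn a x, y⟫ := by
  rw [rf_eq ha, rf_eq ha, inner_sub_right, inner_smul_right, inner_sub_left,
    real_inner_smul_left, real_inner_comm a x]
  ring

lemma rf_norm {a : V} (ha : ‖a‖ = 1) (x : V) : ‖reflectIn a x‖ = ‖x‖ := by
  have h : ⟪reflectIn a x, reflectIn a x⟫ = ⟪x, x⟫ := by
    rw [rf_inner ha, rf_invol ha]
  rw [real_inner_self_eq_norm_sq, real_inner_self_eq_norm_sq] at h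
  exact (sq_eq_sq₀ (norm_nonneg _) (norm_nonneg _)).1 h

lemma rf_smul (a x : V) (c : ℝ) : reflectIn a (c • x) = c • reflectIn a x := by
  simp only [reflectIn, inner_smul_right]; module

lemma rf_negr (a x : V) : reflectIn a (-x) = - reflectIn a x := by
  have := rf_smul a x (-1); simpa using this

lemma rf_self {a : V} (ha : ‖a‖ = 1) : reflectIn a a = -a := by
  rw [rf_eq ha, inner_self_one ha]; module

lemma pm_of_smul {a b : V} (ha : ‖a‖ = 1) (hb : ‖b‖ = 1) (c : ℝ) (h : b = c • a) :
    b = a ∨ b = -a := by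
  rw [h, norm_smul, ha, mul_one, Real.norm_eq_abs] at hb
  rcases eq_or_eq_neg_of_abs_eq hb with h1 | h1
  · left; rw [h, h1, one_smul]
  · right; rw [h, h1]; simp

lemma pm_of_rf {a b : V} (ha : ‖a‖ = 1) (hb : ‖b‖ = 1)
    (h : ∀ x, reflectIn a x = reflectIn b x) : b = a ∨ b = -a := by
  apply pm_of_smul ha hb ⟪a, b⟫
  have := h b
  rw [rf_self hb, rf_eq ha] at this
  have h2 : (2:ℝ) • b = (2:ℝ) • (⟪a, b⟫ • a) := by
    calc (2:ℝ) • b = b - (-b) := by module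
      _ = b - (b - (2 * ⟪a, b⟫) • a) := by rw [← this]
      _ = _ := by module
  exact smul_right_injective V (two_ne_zero) h2

/-- reflection conjugation -/
lemma rf_conj {a : V} (ha : ‖a‖ = 1) {b : V} (hb : ‖b‖ = 1) (x : V) :
    reflectIn (reflectIn a b) x = reflectIn a (reflectIn b (reflectIn a x)) := by
  have h1 : ‖reflectIn a b‖ = 1 := by rw [rf_norm ha, hb]
  rw [rf_eq h1, ← rf_inner ha, rf_eq hb (reflectIn a x)]
  have : ∀ u v : V, reflectIn a (u - v) = reflectIn a u - reflectIn a v := by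
    intro u v; simp only [reflectIn, inner_sub_right]; module
  rw [this, rf_invol ha, rf_smul]

noncomputable def rfL (a : V) : V →ₗ[ℝ] V := ((ℝ ∙ a)ᗮ).reflection.toLinearMap

lemma rfL_apply (a x : V) : rfL a x = reflectIn a x := by
  simp only [rfL, reflectIn]
  change ((ℝ ∙ a)ᗮ).reflection x = _
  rw [Submodule.reflection_orthogonal_apply, Submodule.reflection_singleton_apply,
    real_inner_self_eq_norm_sq]
  simp only [RCLike.ofReal_real_eq_id, id_eq]
  module

lemma rf_cont (a : V) : Continuous (reflectIn a) := by
  unfold reflectIn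
  fun_prop

variable [FiniteDimensional ℝ V]

lemma rfL_det {a : V} (ha : ‖a‖ = 1) : LinearMap.det (rfL a) = -1 := by
  rw [rfL, Submodule.det_reflection, Submodule.orthogonal_orthogonal, finrank_span_singleton]
  · simp
  · rintro rfl; simp at ha

lemma res_sub (p : Submodule ℝ V) (hp : p ≠ ⊤) : ∀ᶠ x in residual V, x ∉ p := by
  apply residual_of_dense_open (s := (p : Set V)ᶜ)
  · exact (Submodule.closed_of_finiteDimensional p).isOpen_compl
  · rw [← interior_eq_empty_iff_dense_compl]
    by_contra h
    exact hp (Submodule.eq_top_of_nonempty_interior' p (Set.nonempty_iff_ne_empty.2 h))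

lemma res_inner {a : V} (ha : a ≠ 0) : ∀ᶠ x in residual V, ⟪a, x⟫ ≠ 0 := by
  have := res_sub ((ℝ ∙ a)ᗮ) (by
    intro h
    have : a ∈ (ℝ ∙ a)ᗮ := by rw [h]; trivial
    rw [Submodule.mem_orthogonal_singleton_iff_inner_right] at this
    exact ha (inner_self_eq_zero.1 this))
  filter_upwards [this] with x hx h
  exact hx (Submodule.mem_orthogonal_singleton_iff_inner_right.2 h)

lemma res_ne {L M : V →ₗ[ℝ] V} (h : L ≠ M) : ∀ᶠ x in residual V, L x ≠ M x := by
  have := res_sub (LinearMap.eqLocus L M) (by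
    intro h2
    apply h
    ext x
    have : x ∈ LinearMap.eqLocus L M := by rw [h2]; trivial
    simpa using this)
  filter_upwards [this] with x hx h
  exact hx h

lemma exists_generic {a : V} (ha : ‖a‖ = 1) (S : Finset V) :
    ∃ y : V, ⟪a, y⟫ = 0 ∧ ∀ s ∈ S, ⟪s, y⟫ = 0 → s = ⟪a, s⟫ • a := by
  have h : ∀ᶠ x in residual V, ∀ s ∈ S, s ≠ ⟪a, s⟫ • a → ⟪s - ⟪a, s⟫ • a, x⟫ ≠ 0 := by
    rw [Filter.eventually_all_finset]
    intro s _
    by_cases h : s = ⟪a, s⟫ • a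
    · exact Eventually.of_forall fun x h2 => absurd h h2
    · filter_upwards [res_inner (sub_ne_zero.2 h)] with x hx _ using hx
  obtain ⟨x, hx⟩ := (dense_of_mem_residual h).nonempty
  refine ⟨x - ⟪a, x⟫ • a, ?_, ?_⟩
  · rw [inner_sub_right, inner_smul_right, inner_self_one ha]; ring
  · intro s hs h0
    by_contra h1
    apply hx s hs h1
    rw [inner_sub_right, inner_smul_right] at h0
    rw [inner_sub_left, real_inner_smul_left, real_inner_comm s a]
    rw [real_inner_comm a s] at *
    linarith

lemma dunkl_bump (A : Finset V) (k : V → ℝ) (F : V → ℝ) (x : V)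
    (h1 : F =ᶠ[𝓝 x] 0) (h2 : ∀ γ ∈ A, F =ᶠ[𝓝 (reflectIn γ x)] 0) (ξ η : V) :
    dunklOp A k ξ (dunklOp A k η F) x =
      1 / 4 * ∑ α ∈ A, ∑ β ∈ A, k α * k β * (⟪α, ξ⟫ * ⟪β, η⟫) * (⟪α, x⟫)⁻¹ *
        (⟪β, reflectIn α x⟫)⁻¹ * F (reflectIn β (reflectIn α x)) := by
  have fd : ∀ y : V, F =ᶠ[𝓝 y] 0 → fderiv ℝ F y = 0 := by
    intro y hy
    rw [hy.fderiv_eq]; simp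
  have e1 : dunklOp A k η F =ᶠ[𝓝 x] 0 := by
    have h3 : ∀ᶠ z in 𝓝 x, ∀ γ ∈ A, F (reflectIn γ z) = 0 := by
      rw [Filter.eventually_all_finset]
      intro γ hγ
      exact (rf_cont γ).continuousAt.eventually (h2 γ hγ)
    filter_upwards [h3, eventually_eventually_nhds.2 h1] with z hz hz1
    rw [dunklOp, fd z hz1, Finset.sum_eq_zero]
    · simp
    · intro γ hγ; rw [hz γ hγ, mul_zero]
  rw [dunklOp, e1.fderiv_eq]
  have e2 : ∀ α ∈ A, dunklOp A k η F (reflectIn α x) = (1 / 2) * ∑ β ∈ A, k β * ⟪β, η⟫ *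
      (⟪β, reflectIn α x⟫)⁻¹ * F (reflectIn β (reflectIn α x)) := by
    intro α hα
    rw [dunklOp, fd _ (h2 α hα)]; simp
  rw [Finset.sum_congr rfl (fun α hα => by rw [e2 α hα])]
  simp only [Finset.mul_sum]
  simp only [fderiv_zero, Pi.zero_apply, zero_apply, zero_add]
  refine Finset.sum_congr rfl fun α _ => Finset.sum_congr rfl fun β _ => ?_
  ring

open Classical in
lemma key1 (A : Finset V) (k : V → ℝ)
    (hunit : ∀ α ∈ A, ‖α‖ = 1)
    (hcomm : ∀ ξ η : V, ∀ F : V → ℝ,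
      ContDiffOn ℝ (⊤ : ℕ∞) F {x : V | ∀ α ∈ A, ⟪α, x⟫ ≠ 0} →
      ∀ x ∈ {x : V | (∀ α ∈ A, ⟪α, x⟫ ≠ 0) ∧
          ∀ α ∈ A, ∀ β ∈ A, ⟪β, reflectIn α x⟫ ≠ 0},
        dunklOp A k ξ (dunklOp A k η F) x = dunklOp A k η (dunklOp A k ξ F) x)
    (a b : V) (ha : a ∈ A) (hb : b ∈ A) (hab : ¬ (b = a ∨ b = -a)) (ξ η : V) :
    ∀ᶠ x in residual V, ∑ α ∈ A, ∑ β ∈ A,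
      (if rfL β ∘ₗ rfL α = rfL b ∘ₗ rfL a then k α * k β * (⟪α, ξ⟫ * ⟪β, η⟫ - ⟪α, η⟫ * ⟪β, ξ⟫)
        * (⟪α, x⟫)⁻¹ * (⟪β, reflectIn α x⟫)⁻¹ else 0) = 0 := by
  have nz : ∀ v : V, ‖v‖ = 1 → v ≠ 0 := by rintro v hv rfl; simp at hv
  have c1 : ∀ᶠ x in residual V, ∀ α ∈ A, ⟪α, x⟫ ≠ 0 := by
    rw [Filter.eventually_all_finset]
    exact fun α hα => res_inner (nz _ (hunit α hα))
  have c2 : ∀ᶠ x in residual V, ∀ α ∈ A, ∀ β ∈ A, ⟪β, reflectIn α x⟫ ≠ 0 := by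
    rw [Filter.eventually_all_finset]
    intro α hα
    rw [Filter.eventually_all_finset]
    intro β hβ
    filter_upwards [res_inner (a := reflectIn α β)
      (nz _ (by rw [rf_norm (hunit α hα), hunit β hβ]))] with x hx
    rwa [rf_inner (hunit α hα)]
  have c3 : ∀ᶠ x in residual V, (rfL b ∘ₗ rfL a) x ≠ LinearMap.id (R := ℝ) x := by
    apply res_ne
    intro h
    apply hab
    apply pm_of_rf (hunit a ha) (hunit b hb)
    intro x
    have := LinearMap.congr_fun h x
    simp only [LinearMap.comp_apply, rfL_apply, LinearMap.id_apply] at this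
    rw [← rf_invol (hunit b hb) (reflectIn a x), this]
  have c4 : ∀ᶠ x in residual V, ∀ γ ∈ A, (rfL b ∘ₗ rfL a) x ≠ rfL γ x := by
    rw [Filter.eventually_all_finset]
    intro γ hγ
    apply res_ne
    intro h
    have := congrArg LinearMap.det h
    rw [LinearMap.det_comp, rfL_det (hunit a ha), rfL_det (hunit b hb),
      rfL_det (hunit γ hγ)] at this
    norm_num at this
  have c5 : ∀ᶠ x in residual V, ∀ α ∈ A, ∀ β ∈ A, rfL β ∘ₗ rfL α ≠ rfL b ∘ₗ rfL a →
      (rfL β ∘ₗ rfL α) x ≠ (rfL b ∘ₗ rfL a) x := by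
    rw [Filter.eventually_all_finset]
    intro α hα
    rw [Filter.eventually_all_finset]
    intro β hβ
    by_cases h : rfL β ∘ₗ rfL α = rfL b ∘ₗ rfL a
    · exact Eventually.of_forall fun x h2 => absurd h h2
    · filter_upwards [res_ne h] with x hx _ using hx
  filter_upwards [c1, c2, c3, c4, c5] with x h1 h2 h3 h4 h5
  simp only [LinearMap.comp_apply, rfL_apply, LinearMap.id_apply] at h3 h4 h5
  set p := reflectIn b (reflectIn a x) with hp
  let S : Finset V := (insert x (A.image fun γ => reflectIn γ x) ∪
    (A ×ˢ A).image fun q => reflectIn q.2 (reflectIn q.1 x)).erase p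
  have hS : ((S : Set V)ᶜ) ∈ 𝓝 p :=
    S.finite_toSet.isClosed.isOpen_compl.mem_nhds (by simp [S])
  obtain ⟨F, hF1, -, hF3, -, hF5⟩ := exists_contDiff_tsupport_subset (n := ⊤) hS
  have off : ∀ q ∈ S, F =ᶠ[𝓝 q] 0 := by
    intro q hq
    rw [← notMem_tsupport_iff_eventuallyEq]
    intro h
    exact hF1 h hq
  have o1 : F =ᶠ[𝓝 x] 0 := off _ (by simp [S, Ne.symm h3])
  have o2 : ∀ γ ∈ A, F =ᶠ[𝓝 (reflectIn γ x)] 0 := fun γ hγ => off _ (by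
    simp only [S, Finset.mem_erase]
    refine ⟨(h4 γ hγ).symm, ?_⟩
    apply Finset.mem_union_left
    apply Finset.mem_insert_of_mem
    exact Finset.mem_image_of_mem _ hγ)
  have o3 : ∀ α ∈ A, ∀ β ∈ A, F (reflectIn β (reflectIn α x)) =
      if rfL β ∘ₗ rfL α = rfL b ∘ₗ rfL a then 1 else 0 := by
    intro α hα β hβ
    split_ifs with h
    · have := LinearMap.congr_fun h x
      simp only [LinearMap.comp_apply, rfL_apply] at this
      rw [this, ← hp, hF5]
    · refine (off _ ?_).self_of_nhds
      simp only [S, Finset.mem_erase]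
      refine ⟨h5 α hα β hβ h, ?_⟩
      apply Finset.mem_union_right
      exact Finset.mem_image.2 ⟨(α, β), Finset.mem_product.2 ⟨hα, hβ⟩, rfl⟩
  have := hcomm ξ η F hF3.contDiffOn x ⟨h1, h2⟩
  rw [dunkl_bump A k F x o1 o2, dunkl_bump A k F x o1 o2] at this
  have h6 := mul_left_cancel₀ (by norm_num) this
  rw [← sub_eq_zero, ← Finset.sum_sub_distrib] at h6
  refine Eq.trans ?_ h6
  refine Finset.sum_congr rfl fun α hα => ?_
  rw [← Finset.sum_sub_distrib]
  refine Finset.sum_congr rfl fun β hβ => ?_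
  rw [o3 α hα β hβ]
  split_ifs <;> ring

lemma rfL_congr {a b : V} (h : b = a ∨ b = -a) : rfL b = rfL a := by
  ext x
  rw [rfL_apply, rfL_apply]
  rcases h with rfl | rfl
  · rfl
  · exact rf_neg _ _

open Classical in
/-- Sum of the coefficients over the line of `a`. -/
noncomputable def lineK (A : Finset V) (k : V → ℝ) (a : V) : ℝ :=
  ∑ α ∈ A, if α = a ∨ α = -a then k α else 0

lemma lineK_of_mem (A : Finset V) (hneg : ∀ α ∈ A, -α ∈ A) (k : V → ℝ)
    (hkneg : ∀ α ∈ A, k (-α) = k α) (a : V) (h0 : a ≠ 0) (ha : a ∈ A) :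
    lineK A k a = 2 * k a := by
  classical
  have hne : a ≠ -a := by
    intro h
    have h2 : (2 : ℝ) • a = 0 := by
      rw [two_smul]; nth_rewrite 2 [h]; simp
    exact h0 ((smul_eq_zero.1 h2).resolve_left two_ne_zero)
  unfold lineK
  have : ∀ α ∈ A, (if α = a ∨ α = -a then k α else 0) =
      (if α = a then k α else 0) + (if α = -a then k α else 0) := by
    intro α _
    by_cases h1 : α = a
    · subst h1; simp [hne]
    · simp [h1]
  rw [Finset.sum_congr rfl this, Finset.sum_add_distrib, Finset.sum_ite_eq', Finset.sum_ite_eq',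
    if_pos ha, if_pos (hneg a ha), hkneg a ha]
  ring

lemma mem_of_lineK (A : Finset V) (hneg : ∀ α ∈ A, -α ∈ A) (k : V → ℝ) (a : V)
    (h : lineK A k a ≠ 0) : a ∈ A := by
  classical
  by_contra ha
  apply h
  unfold lineK
  apply Finset.sum_eq_zero
  intro α hα
  rw [if_neg]
  rintro (rfl | rfl)
  · exact ha hα
  · exact ha (by simpa using hneg _ hα)

open Classical in
lemma key2 (A : Finset V)
    (hunit : ∀ α ∈ A, ‖α‖ = 1)
    (hneg : ∀ α ∈ A, -α ∈ A)
    (k : V → ℝ)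
    (hk0 : ∀ α ∈ A, k α ≠ 0)
    (hkneg : ∀ α ∈ A, k (-α) = k α)
    (a b : V) (ha : a ∈ A) (hb : b ∈ A) (hab : ¬ (b = a ∨ b = -a))
    (hkey : ∀ᶠ x in residual V, ∑ α ∈ A, ∑ β ∈ A,
      (if rfL β ∘ₗ rfL α = rfL b ∘ₗ rfL a then k α * k β * (⟪α, a⟫ * ⟪β, b⟫ - ⟪α, b⟫ * ⟪β, a⟫)
        * (⟪α, x⟫)⁻¹ * (⟪β, reflectIn α x⟫)⁻¹ else 0) = 0) :
    reflectIn b a ∈ A ∧ k (reflectIn b a) = k a := by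
  have ua := hunit a ha
  have ub := hunit b hb
  have nz : ∀ v : V, ‖v‖ = 1 → v ≠ 0 := by rintro v hv rfl; simp at hv
  set g := reflectIn b a with hg
  have ug : ‖g‖ = 1 := by rw [hg, rf_norm ub, ua]
  obtain ⟨y, hy0, hy⟩ := exists_generic ua
    (A ∪ (A ×ˢ A).image fun q => reflectIn q.1 q.2)
  have hy1 : ∀ α ∈ A, ⟪α, y⟫ = 0 → α = a ∨ α = -a := fun α hα h =>
    pm_of_smul ua (hunit α hα) _ (hy α (Finset.mem_union_left _ hα) h)
  have hy2 : ∀ α ∈ A, ∀ β ∈ A, ⟪β, reflectIn α y⟫ = 0 →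
      reflectIn α β = a ∨ reflectIn α β = -a := by
    intro α hα β hβ h
    rw [rf_inner (hunit α hα)] at h
    exact pm_of_smul ua (by rw [rf_norm (hunit α hα), hunit β hβ]) _
      (hy _ (Finset.mem_union_right _
        (Finset.mem_image.2 ⟨(α, β), Finset.mem_product.2 ⟨hα, hβ⟩, rfl⟩)) h)
  have hby : ⟪b, y⟫ ≠ 0 := fun h => hab (hy1 b hb h)
  set D : ℝ := 1 - ⟪a, b⟫ ^ 2 with hD
  have hD0 : D ≠ 0 := by
    intro h
    apply hab
    have h1 : ⟪a, b⟫ ^ 2 = 1 := by linarith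
    rcases (by simpa using h1 : ⟪a, b⟫ = 1 ∨ ⟪a, b⟫ = -1) with h2 | h2
    · left; exact ((inner_eq_one_iff_of_norm_eq_one ua ub).1 h2).symm
    · right
      have := (inner_eq_one_iff_of_norm_eq_one (𝕜 := ℝ) ua (by simpa using ub : ‖-b‖ = 1)).1
        (by rw [inner_neg_right, h2]; norm_num)
      rw [this, neg_neg]
  -- the dense set
  set R : Set V := {x | (∑ α ∈ A, ∑ β ∈ A,
      (if rfL β ∘ₗ rfL α = rfL b ∘ₗ rfL a then k α * k β * (⟪α, a⟫ * ⟪β, b⟫ - ⟪α, b⟫ * ⟪β, a⟫)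
        * (⟪α, x⟫)⁻¹ * (⟪β, reflectIn α x⟫)⁻¹ else 0) = 0) ∧ ⟪a, x⟫ ≠ 0} with hR
  have hRd : Dense R := dense_of_mem_residual (hkey.and (res_inner (nz a ua)))
  have : NeBot (𝓝[R] y) := mem_closure_iff_nhdsWithin_neBot.1 (hRd y)
  have hRa : ∀ᶠ x in 𝓝[R] y, ⟪a, x⟫ ≠ 0 := by
    filter_upwards [self_mem_nhdsWithin] with x hx using hx.2
  have ci : ∀ v : V, Tendsto (fun x => ⟪v, x⟫) (𝓝[R] y) (𝓝 ⟪v, y⟫) := fun v =>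
    ((continuous_const.inner continuous_id).tendsto y).mono_left nhdsWithin_le_nhds
  have cr : ∀ v α : V, Tendsto (fun x => ⟪v, reflectIn α x⟫) (𝓝[R] y) (𝓝 ⟪v, reflectIn α y⟫) :=
    fun v α => ((continuous_const.inner (rf_cont α)).tendsto y).mono_left nhdsWithin_le_nhds
  have lim : ∀ α ∈ A, ∀ β ∈ A, Tendsto (fun x => ⟪a, x⟫ *
      (if rfL β ∘ₗ rfL α = rfL b ∘ₗ rfL a then k α * k β * (⟪α, a⟫ * ⟪β, b⟫ - ⟪α, b⟫ * ⟪β, a⟫)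
        * (⟪α, x⟫)⁻¹ * (⟪β, reflectIn α x⟫)⁻¹ else 0)) (𝓝[R] y)
      (𝓝 ((D * ⟪b, y⟫⁻¹) *
        ((if α = a ∨ α = -a then k α else 0) * (if β = b ∨ β = -b then k β else 0)
        - (if α = b ∨ α = -b then k α else 0) * (if β = g ∨ β = -g then k β else 0)))) := by
    intro α hα β hβ
    have uα := hunit α hα
    have uβ := hunit β hβ
    by_cases hw : rfL β ∘ₗ rfL α = rfL b ∘ₗ rfL a
    · have hww : ∀ x, reflectIn β (reflectIn α x) = reflectIn b (reflectIn a x) := by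
        intro x
        simpa [rfL_apply] using LinearMap.congr_fun hw x
      simp only [if_pos hw]
      by_cases h1 : ⟪α, y⟫ = 0
      · have e1 := hy1 α hα h1
        have e2 : β = b ∨ β = -b := by
          apply pm_of_rf ub uβ
          intro x
          have := hww (reflectIn α x)
          rw [rf_invol uα] at this
          rw [this]
          have : reflectIn α x = reflectIn a x := by
            rw [← rfL_apply, ← rfL_apply, rfL_congr e1]
          rw [this, rf_invol ua]
        have e3 : ¬ (α = b ∨ α = -b) := by
          rintro (h | h)
          · exact hab (by rw [← h]; exact e1)
          · rw [h, neg_inj, neg_eq_iff_eq_neg] at e1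
            exact hab e1.symm
        rw [if_pos e1, if_pos e2, if_neg e3]
        have T : Tendsto (fun x => (k α * k β * D) * (⟪b, reflectIn a x⟫)⁻¹) (𝓝[R] y)
            (𝓝 ((k α * k β * D) * (⟪b, y⟫)⁻¹)) := by
          have h3 : reflectIn a y = y := by rw [rf_eq ua, hy0]; simp
          have := cr b a
          rw [h3] at this
          exact (this.inv₀ hby).const_mul _
        have T2 := T.congr' (f₂ := fun x => ⟪a, x⟫ * (k α * k β *
          (⟪α, a⟫ * ⟪β, b⟫ - ⟪α, b⟫ * ⟪β, a⟫) * (⟪α, x⟫)⁻¹ * (⟪β, reflectIn α x⟫)⁻¹)) (by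
            filter_upwards [hRa] with x hx
            have h4 : reflectIn α x = reflectIn a x := by
              rw [← rfL_apply, ← rfL_apply, rfL_congr e1]
            have h5 : ⟪a, x⟫ * ⟪a, x⟫⁻¹ = 1 := mul_inv_cancel₀ hx
            rw [h4, hD]
            have haa := inner_self_one ua
            have hbb := inner_self_one ub
            have hba : ⟪b, a⟫ = ⟪a, b⟫ := real_inner_comm _ _
            generalize k α = kα
            generalize k β = kβ
            rcases e1 with h | h <;> rcases e2 with h9 | h9 <;> rw [h, h9] <;>
              simp only [inner_neg_left, haa, hbb, hba, inv_neg] <;>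
              linear_combination (-(kα * kβ * (1 - ⟪a, b⟫ ^ 2) * ⟪b, reflectIn a x⟫⁻¹)) * h5)
        convert T2 using 2
        ring
      · have e1 : ¬ (α = a ∨ α = -a) := by
          rintro (h | h) <;> apply h1 <;> rw [h]
          · exact hy0
          · rw [inner_neg_left, hy0, neg_zero]
        rw [if_neg e1]
        by_cases h2 : ⟪β, reflectIn α y⟫ = 0
        · have f1 := hy2 α hα β hβ h2
          have e2 : α = b ∨ α = -b := by
            apply pm_of_rf ub uα
            intro x
            -- s_α s_β s_α = s_a
            have h3 : ∀ z, reflectIn α (reflectIn b (reflectIn a z)) = reflectIn a z := by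
              intro z
              rw [← hww, ← rf_conj uα uβ, ← rfL_apply, rfL_congr f1, rfL_apply]
            have h4 := h3 (reflectIn a x)
            rw [rf_invol ua] at h4
            rw [← h4, rf_invol uα, h4]
          have h4 : ∀ x, reflectIn α x = reflectIn b x := by
            intro x
            rw [← rfL_apply, ← rfL_apply, rfL_congr e2]
          have e3 : β = g ∨ β = -g := by
            rw [h4] at f1
            rcases f1 with h | h
            · left; rw [hg, ← h, rf_invol ub]
            · right; rw [hg, ← rf_negr, ← h, rf_invol ub]
          rw [if_pos e2, if_pos e3]
          have T : Tendsto (fun x => (k α * k β * (-D)) * (⟪b, x⟫)⁻¹) (𝓝[R] y)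
              (𝓝 ((k α * k β * (-D)) * (⟪b, y⟫)⁻¹)) := ((ci b).inv₀ hby).const_mul _
          have T2 := T.congr' (f₂ := fun x => ⟪a, x⟫ * (k α * k β *
            (⟪α, a⟫ * ⟪β, b⟫ - ⟪α, b⟫ * ⟪β, a⟫) * (⟪α, x⟫)⁻¹ * (⟪β, reflectIn α x⟫)⁻¹)) (by
              filter_upwards [hRa] with x hx
              have h5 : ⟪a, x⟫ * ⟪a, x⟫⁻¹ = 1 := mul_inv_cancel₀ hx
              rw [h4, hD]
              have haa := inner_self_one ua
              have hbb := inner_self_one ub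
              have hba : ⟪b, a⟫ = ⟪a, b⟫ := real_inner_comm _ _
              have hgx : ⟪g, reflectIn b x⟫ = ⟪a, x⟫ := by
                rw [rf_inner ub, hg, rf_invol ub]
              have hgb : ⟪g, b⟫ = - ⟪a, b⟫ := by
                rw [hg, ← rf_inner ub, rf_self ub, inner_neg_right]
              have hga : ⟪g, a⟫ = 1 - 2 * ⟪a, b⟫ ^ 2 := by
                rw [hg, rf_eq ub, inner_sub_left, real_inner_smul_left, haa, hba]; ring
              generalize k α = kα
              generalize k β = kβ
              rcases e2 with h | h <;> rcases e3 with h9 | h9 <;> rw [h, h9] <;>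
                simp only [inner_neg_left, haa, hbb, hba, hgx, hgb, hga, inv_neg] <;>
                linear_combination ((kα * kβ * (1 - ⟪a, b⟫ ^ 2) * ⟪b, x⟫⁻¹)) * h5)
          convert T2 using 2
          ring
        · have e2 : ¬ ((α = b ∨ α = -b) ∧ (β = g ∨ β = -g)) := by
            rintro ⟨h3, h4⟩
            apply h2
            have h5 : reflectIn α y = reflectIn b y := by
              rw [← rfL_apply, ← rfL_apply, rfL_congr h3]
            have hgx : ⟪g, reflectIn b y⟫ = 0 := by
              rw [rf_inner ub, hg, rf_invol ub, hy0]
            rcases h4 with h | h <;> rw [h5, h]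
            · exact hgx
            · rw [inner_neg_left, hgx, neg_zero]
          have T := (ci a).mul ((((ci α).inv₀ h1).const_mul (k α * k β *
            (⟪α, a⟫ * ⟪β, b⟫ - ⟪α, b⟫ * ⟪β, a⟫))).mul ((cr β α).inv₀ h2))
          rw [hy0, zero_mul] at T
          convert T using 2
          by_cases h3 : (α = b ∨ α = -b)
          · rw [if_neg (fun h => e2 ⟨h3, h⟩)]; ring
          · rw [if_neg h3]; ring
    · simp only [if_neg hw, mul_zero]
      have n1 : ¬ ((α = a ∨ α = -a) ∧ (β = b ∨ β = -b)) := fun h =>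
        hw (by rw [rfL_congr h.1, rfL_congr h.2])
      have n2 : ¬ ((α = b ∨ α = -b) ∧ (β = g ∨ β = -g)) := fun h => hw (by
        rw [rfL_congr h.1, rfL_congr h.2]
        ext x
        simp only [LinearMap.comp_apply, rfL_apply]
        rw [hg, rf_conj ub ua, rf_invol ub])
      have z1 : (if α = a ∨ α = -a then k α else 0) * (if β = b ∨ β = -b then k β else 0) = 0 := by
        by_cases h : (α = a ∨ α = -a)
        · rw [if_neg (fun h2 => n1 ⟨h, h2⟩), mul_zero]
        · rw [if_neg h, zero_mul]
      have z2 : (if α = b ∨ α = -b then k α else 0) * (if β = g ∨ β = -g then k β else 0) = 0 := by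
        by_cases h : (α = b ∨ α = -b)
        · rw [if_neg (fun h2 => n2 ⟨h, h2⟩), mul_zero]
        · rw [if_neg h, zero_mul]
      rw [z1, z2, sub_zero, mul_zero]
      exact tendsto_const_nhds
  have LIM := tendsto_finsetSum A fun α hα => tendsto_finsetSum A fun β hβ => lim α hα β hβ
  have L0 : Tendsto (fun _ : V => (0 : ℝ)) (𝓝[R] y) (𝓝 0) := tendsto_const_nhds
  have E := tendsto_nhds_unique (LIM.congr' (f₂ := fun _ => 0) (by
    filter_upwards [self_mem_nhdsWithin] with x hx
    simp only [← Finset.mul_sum]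
    rw [hx.1, mul_zero])) L0
  simp only [← Finset.mul_sum, Finset.sum_sub_distrib, ← Finset.sum_mul] at E
  have E2 : (D * ⟪b, y⟫⁻¹) * (lineK A k a * lineK A k b - lineK A k b * lineK A k g) = 0 := E
  have E3 := (mul_eq_zero.1 E2).resolve_left (mul_ne_zero hD0 (inv_ne_zero hby))
  have Ka := lineK_of_mem A hneg k hkneg a (nz a ua) ha
  have Kb := lineK_of_mem A hneg k hkneg b (nz b ub) hb
  have hkb : lineK A k b ≠ 0 := by rw [Kb]; exact mul_ne_zero two_ne_zero (hk0 b hb)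
  have hka : lineK A k a ≠ 0 := by rw [Ka]; exact mul_ne_zero two_ne_zero (hk0 a ha)
  have E4 : lineK A k g = lineK A k a := by
    apply mul_left_cancel₀ hkb
    linarith
  have hgA : g ∈ A := mem_of_lineK A hneg k g (by rw [E4]; exact hka)
  refine ⟨hgA, ?_⟩
  have Kg := lineK_of_mem A hneg k hkneg g (nz g ug) hgA
  linarith

end aux

theorem commuting_dunkl_type_implies_coxeter
    {V : Type*} [NormedAddCommGroup V] [InnerProductSpace ℝ V] [FiniteDimensional ℝ V]
    (A : Finset V)
    (hunit : ∀ α ∈ A, ‖α‖ = 1)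
    (hneg : ∀ α ∈ A, -α ∈ A)
    (hline : ∀ α ∈ A, ∀ c : ℝ, c • α ∈ A → c • α = α ∨ c • α = -α)
    (k : V → ℝ)
    (hk0 : ∀ α ∈ A, k α ≠ 0)
    (hkneg : ∀ α ∈ A, k (-α) = k α)
    (hcomm : ∀ ξ η : V, ∀ F : V → ℝ,
      ContDiffOn ℝ (⊤ : ℕ∞) F {x : V | ∀ α ∈ A, ⟪α, x⟫ ≠ 0} →
      ∀ x ∈ {x : V | (∀ α ∈ A, ⟪α, x⟫ ≠ 0) ∧
          ∀ α ∈ A, ∀ β ∈ A, ⟪β, reflectIn α x⟫ ≠ 0},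
        dunklOp A k ξ (dunklOp A k η F) x = dunklOp A k η (dunklOp A k ξ F) x) :
    (∀ α ∈ A, ∀ β ∈ A, reflectIn α β ∈ A) ∧
      (∀ α ∈ A, ∀ β ∈ A, k (reflectIn α β) = k β) := by
  have main : ∀ a ∈ A, ∀ b ∈ A, reflectIn b a ∈ A ∧ k (reflectIn b a) = k a := by
    intro a ha b hb
    by_cases hab : b = a ∨ b = -a
    · have h : reflectIn b a = -a := by
        rcases hab with rfl | rfl
        · exact rf_self (hunit _ hb)
        · rw [rf_neg, rf_self (hunit _ ha)]
      rw [h]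
      exact ⟨hneg a ha, hkneg a ha⟩
    · exact key2 A hunit hneg k hk0 hkneg a b ha hb hab
        (key1 A k hunit hcomm a b ha hb hab a b)
  exact ⟨fun α hα β hβ => (main β hβ α hα).1, fun α hα β hβ => (main β hβ α hα).2⟩
end

section
/- Let V be a finite-dimensional real inner product space with dim V ≥ 2 and let R be a reduced, crystallographic, irreducible root system in V spanning V, such that it is not the case that dim V = 2 and |R| = 8 (i.e. R is the root system of a simple Lie algebra, not of type A₁ or B₂). Let W be the group generated by the reflections s_α, α ∈ R. Let D ⊆ ℂ be an open disc centered at 0 and for each α ∈ R let f_α be meromorphic on D, not identically zero, with f_{−α}(z) = −f_α(−z) and f_{w(α)} = f_α for all w ∈ W, α ∈ R. Suppose the functional equations hold: for every w ∈ W, all ξ, η ∈ V, and every x ∈ V such that for each α ∈ R the number (α,x) lies in D and every f_β is analytic there, one has Σ_{(α,β) ∈ R×R : s_α∘s_β = w} ⟨α,β⟩_{ξ,η} f_α((α,x)) f_β((s_α(β),x)) = 0. Then there exists a W-invariant function k : R → ℂ such that f_α(z) = k(α)/z for all z ∈ D ∖ {0} at which f_α is analytic. -/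
/-!
STATEMENT 4: For the root system of a simple Lie algebra other than `A₁` and
`B₂` (i.e. a reduced crystallographic irreducible root system spanning `V`,
`dim V ≥ 2`, excluding the case `dim V = 2`, `|R| = 8`), all `W`-invariant
solutions of the functional equations are `f_α(z) = k(α)/z` with `k`
`W`-invariant.
-/

open Metric
open scoped RealInnerProductSpace Classical

/-- `⟨α,β⟩_{ξ,η} = (α,ξ)(β,η) − (α,η)(β,ξ)`. -/
noncomputable def bracket {V : Type*} [NormedAddCommGroup V] [InnerProductSpace ℝ V]
    (ξ η α β : V) : ℝ :=
  ⟪α, ξ⟫ * ⟪β, η⟫ - ⟪α, η⟫ * ⟪β, ξ⟫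

section Analytic1

lemma conv_first (x y : ℕ → ℂ) (m : ℕ) (hm : 0 < m) (hx : ∀ j, 0 < j → j < m → x j = 0) :
    ∑ p ∈ Finset.HasAntidiagonal.antidiagonal m, x p.1 * y p.2 = x 0 * y m + x m * y 0 := by
  have h : ∑ p ∈ ({(0, m), (m, 0)} : Finset (ℕ × ℕ)), x p.1 * y p.2
      = ∑ p ∈ Finset.HasAntidiagonal.antidiagonal m, x p.1 * y p.2 := by
    apply Finset.sum_subset
    · intro p hp
      simp only [Finset.mem_insert, Finset.mem_singleton] at hp
      rcases hp with rfl | rfl <;> simp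
    · rintro ⟨i, j⟩ hp hn
      simp only [Finset.HasAntidiagonal.mem_antidiagonal, Finset.mem_insert, Finset.mem_singleton, Prod.mk.injEq,
        not_or] at hp hn
      rw [hx i (by omega) (by omega), zero_mul]
  rw [← h, Finset.sum_pair (by simp; omega)]

lemma conv_second (x y : ℕ → ℂ) (m : ℕ) (hm : 0 < m) (hx : ∀ j, 0 < j → j < m → x j = 0)
    (hy : ∀ j, 0 < j → j < m → y j = 0) :
    ∑ p ∈ Finset.HasAntidiagonal.antidiagonal (2 * m), x p.1 * y p.2
      = x 0 * y (2 * m) + x m * y m + x (2 * m) * y 0 := by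
  have h : ∑ p ∈ ({(0, 2 * m), (m, m), (2 * m, 0)} : Finset (ℕ × ℕ)), x p.1 * y p.2
      = ∑ p ∈ Finset.HasAntidiagonal.antidiagonal (2 * m), x p.1 * y p.2 := by
    apply Finset.sum_subset
    · intro p hp
      simp only [Finset.mem_insert, Finset.mem_singleton] at hp
      rcases hp with rfl | rfl | rfl <;> simp
      omega
    · rintro ⟨i, j⟩ hp hn
      simp only [Finset.HasAntidiagonal.mem_antidiagonal, Finset.mem_insert, Finset.mem_singleton, Prod.mk.injEq,
        not_or] at hp hn
      rcases lt_trichotomy i m with h | h | h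
      · rw [hx i (by omega) (by omega), zero_mul]
      · omega
      · rw [hy j (by omega) (by omega), mul_zero]
  rw [← h, Finset.sum_insert (by simp; omega), Finset.sum_pair (by simp; omega)]
  ring

lemma conv_zero (x y : ℕ → ℂ)
    (h : ∀ k, ∑ p ∈ Finset.HasAntidiagonal.antidiagonal k, x p.1 * y p.2 = 0) :
    (∀ k, x k = 0) ∨ (∀ k, y k = 0) := by
  have : PowerSeries.mk x * PowerSeries.mk y = 0 := by
    ext k
    rw [PowerSeries.coeff_mul]
    simpa using h k
  rcases mul_eq_zero.1 this with h | h
  · left; intro k; simpa using congrArg (PowerSeries.coeff k) h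
  · right; intro k; simpa using congrArg (PowerSeries.coeff k) h

lemma g2_growth (l : ℕ) (hl : 4 ≤ l) : 3 * 3 ^ l < 4 ^ l := by
  induction l, hl using Nat.le_induction with
  | base => norm_num
  | succ n hn ih => rw [pow_succ, pow_succ]; omega

lemma g2_sign (c C a b t : ℂ) (hc : c ≠ 0) (hC : C ≠ 0) (hb : b ≠ 0) (ht : t ≠ 0)
    (q1 : C * a + t * (c * b) = 0) (q2 : c * a + t * (C * b) = 0) :
    (C = c ∨ C = -c) ∧ ((C = c ∧ a = -t * b) ∨ (C = -c ∧ a = t * b)) := by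
  have h1 : t * b * ((C - c) * (C + c)) = 0 := by linear_combination C * q2 - c * q1
  have h2 := (mul_eq_zero.1 h1).resolve_left (mul_ne_zero ht hb)
  rcases mul_eq_zero.1 h2 with h | h
  · have e : C = c := by linear_combination h
    refine ⟨Or.inl e, Or.inl ⟨e, ?_⟩⟩
    subst e
    have : C * (a + t * b) = 0 := by linear_combination q1
    linear_combination (mul_eq_zero.1 this).resolve_left hc
  · have e : C = -c := by linear_combination h
    refine ⟨Or.inr e, Or.inr ⟨e, ?_⟩⟩
    subst e
    have : c * (a - t * b) = 0 := by linear_combination -q1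
    linear_combination (mul_eq_zero.1 this).resolve_left hc

/-- The power series core of the `G₂` case. -/
lemma g2_coeffs (a b : ℕ → ℂ) (ha : ∃ k, a k ≠ 0) (hb : ∃ k, b k ≠ 0)
    (hoa : ∀ k, Odd k → a k = 0) (hob : ∀ k, Odd k → b k = 0)
    (h1 : ∀ k : ℕ, b 0 * (((k : ℂ) - 1) * a k) + (2 / 3) *
      ∑ p ∈ Finset.HasAntidiagonal.antidiagonal k, (3 ^ p.1 * b p.1) * ((1 + 2 ^ p.2 / 2) * a p.2) = 0)
    (h2 : ∀ k : ℕ, 3 * a 0 * (((k : ℂ) - 1) * b k) + 2 *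
      ∑ p ∈ Finset.HasAntidiagonal.antidiagonal k, a p.1 * ((1 + 2 ^ p.2 / 2) * b p.2) = 0)
    (h3 : ∀ k : ℕ, a 0 * (((k : ℂ) - 1) * a k) + ∑ p ∈ Finset.HasAntidiagonal.antidiagonal k, a p.1 * a p.2
      - 3 * ∑ p ∈ Finset.HasAntidiagonal.antidiagonal k, b p.1 * b p.2
      + 3 * ∑ p ∈ Finset.HasAntidiagonal.antidiagonal k, b p.1 * (2 ^ p.2 * b p.2) = 0) :
    (∀ k, 0 < k → a k = 0) ∧ (∀ k, 0 < k → b k = 0) := by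
  have hpos : ∀ k : ℕ, (1 + 2 ^ k / 2 : ℂ) ≠ 0 := by
    intro k
    have : (1 + 2 ^ k / 2 : ℂ) = ((1 + 2 ^ k / 2 : ℝ) : ℂ) := by push_cast; rfl
    rw [this]
    exact_mod_cast (by positivity : (1 + 2 ^ k / 2 : ℝ) ≠ 0)
  have hC : b 0 ≠ 0 := by
    intro hC
    have : ∀ k, ∑ p ∈ Finset.HasAntidiagonal.antidiagonal k,
        (3 ^ p.1 * b p.1) * ((1 + 2 ^ p.2 / 2) * a p.2) = 0 := by
      intro k
      have := h1 k
      rw [hC] at this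
      simpa using this
    rcases conv_zero (fun i => 3 ^ i * b i) (fun j => (1 + 2 ^ j / 2) * a j) this with h | h
    · obtain ⟨k, hk⟩ := hb
      exact hk (by simpa using h k)
    · obtain ⟨k, hk⟩ := ha
      exact hk ((mul_eq_zero.1 (h k)).resolve_left (hpos k))
  have hc : a 0 ≠ 0 := by
    intro hC
    have : ∀ k, ∑ p ∈ Finset.HasAntidiagonal.antidiagonal k, a p.1 * ((1 + 2 ^ p.2 / 2) * b p.2) = 0 := by
      intro k
      have := h2 k
      rw [hC] at this
      simpa using this
    rcases conv_zero a (fun j => (1 + 2 ^ j / 2) * b j) this with h | h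
    · obtain ⟨k, hk⟩ := ha
      exact hk (h k)
    · obtain ⟨k, hk⟩ := hb
      exact hk ((mul_eq_zero.1 (h k)).resolve_left (hpos k))
  by_contra hcon
  have hex : ∃ k, 0 < k ∧ (a k ≠ 0 ∨ b k ≠ 0) := by
    by_contra hno
    push Not at hno
    exact hcon ⟨fun k hk => (hno k hk).1, fun k hk => (hno k hk).2⟩
  classical
  obtain ⟨m, ⟨hm, hab⟩, hmin⟩ : ∃ m, (0 < m ∧ (a m ≠ 0 ∨ b m ≠ 0)) ∧
      ∀ j, j < m → ¬ (0 < j ∧ (a j ≠ 0 ∨ b j ≠ 0)) :=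
    ⟨Nat.find hex, Nat.find_spec hex, fun j hj => Nat.find_min hex hj⟩
  have za : ∀ j, 0 < j → j < m → a j = 0 := by
    intro j h0 hj
    by_contra h
    exact hmin j hj ⟨h0, Or.inl h⟩
  have zb : ∀ j, 0 < j → j < m → b j = 0 := by
    intro j h0 hj
    by_contra h
    exact hmin j hj ⟨h0, Or.inr h⟩
  have hev : Even m := by
    by_contra h
    rw [Nat.not_even_iff_odd] at h
    rcases hab with h' | h'
    · exact h' (hoa m h)
    · exact h' (hob m h)
  have A1 := h1 m
  have A2 := h2 m
  have A3 := h3 m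
  have B1 := h1 (2 * m)
  have B2 := h2 (2 * m)
  have B3 := h3 (2 * m)
  rw [conv_first (fun i => 3 ^ i * b i) (fun j => (1 + 2 ^ j / 2) * a j) m hm
    (fun j h h' => by simp [zb j h h'])] at A1
  rw [conv_first a (fun j => (1 + 2 ^ j / 2) * b j) m hm za] at A2
  rw [conv_first a a m hm za, conv_first b b m hm zb,
    conv_first b (fun j => 2 ^ j * b j) m hm zb] at A3
  rw [conv_second (fun i => 3 ^ i * b i) (fun j => (1 + 2 ^ j / 2) * a j) m hm
    (fun j h h' => by simp [zb j h h']) (fun j h h' => by simp [za j h h'])] at B1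
  rw [conv_second a (fun j => (1 + 2 ^ j / 2) * b j) m hm za
    (fun j h h' => by simp [zb j h h'])] at B2
  rw [conv_second a a m hm za za, conv_second b b m hm zb zb,
    conv_second b (fun j => 2 ^ j * b j) m hm zb (fun j h h' => by simp [zb j h h'])] at B3
  obtain ⟨l, rfl⟩ := hev
  have e1 : b 0 * a (l + l) * (3 * ((l + l : ℕ) : ℂ) - 1 + 2 ^ (l + l))
      + 3 * 3 ^ (l + l) * (a 0 * b (l + l)) = 0 := by
    linear_combination 3 * A1
  have e2 : a 0 * b (l + l) * (3 * ((l + l : ℕ) : ℂ) - 1 + 2 ^ (l + l))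
      + 3 * (b 0 * a (l + l)) = 0 := by
    linear_combination A2
  have bne : b (l + l) ≠ 0 := by
    intro hb0
    rw [hb0] at e2
    have : b 0 * a (l + l) = 0 := by linear_combination e2 / 3
    rcases hab with h | h
    · exact (mul_ne_zero hC h) this
    · exact h hb0
  have hD : (3 * ((l + l : ℕ) : ℂ) - 1 + 2 ^ (l + l)) ^ 2 = (3 * 3 ^ l) ^ 2 := by
    have : a 0 * b (l + l) * ((3 * ((l + l : ℕ) : ℂ) - 1 + 2 ^ (l + l)) ^ 2 - (3 * 3 ^ l) ^ 2)
        = 0 := by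
      linear_combination (3 * ((l + l : ℕ) : ℂ) - 1 + 2 ^ (l + l)) * e2 - 3 * e1
    have := (mul_eq_zero.1 this).resolve_left (mul_ne_zero hc bne)
    linear_combination this
  have hDR : (3 * ((l + l : ℕ) : ℝ) - 1 + 2 ^ (l + l)) ^ 2 = (3 * 3 ^ l) ^ 2 := by
    exact_mod_cast hD
  have hl3 : l < 4 := by
    by_contra hl
    push Not at hl
    have h4 := g2_growth l hl
    have h4' : (3 * 3 ^ l : ℝ) < 4 ^ l := by exact_mod_cast h4
    have h5 : (2 : ℝ) ^ (l + l) = 4 ^ l := by rw [← two_mul, pow_mul]; norm_num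
    have h6 : (0 : ℝ) < 3 * 3 ^ l := by positivity
    have h7 : (4 : ℝ) ≤ l := by exact_mod_cast hl
    rw [h5] at hDR
    push_cast at hDR
    nlinarith
  have l0 : 0 < l := by omega
  clear hcon hex hmin za zb h1 h2 h3 hoa hob ha hb hD hDR
  interval_cases l
  · norm_num at A1 A2 A3 B1 B2 B3 bne
    obtain ⟨h, h'⟩ := g2_sign (a 0) (b 0) (a 2) (b 2) 3 hc hC bne (by norm_num)
      (by linear_combination A2 / 3) (by linear_combination A3 / 3)
    have key : 48 * b 2 ^ 2 = 0 := by
      rcases h with h | h <;> rcases h' with ⟨e, h'⟩ | ⟨e, h'⟩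
      · rw [h, h'] at B1 B2 B3
        linear_combination 3 * 0 * B1 + (-5/3) * B2 + B3
      · exact absurd (h.symm.trans e) (by
          intro h; exact hc (by linear_combination h / 2))
      · exact absurd (h.symm.trans e) (by
          intro h; exact hc (by linear_combination -h / 2))
      · rw [h, h'] at B1 B2 B3
        linear_combination -3 * 0 * B1 - (-5/3) * B2 + B3
    exact bne (by simpa using key)
  · norm_num at A1 A2 A3 B1 B2 B3 bne
    obtain ⟨h, h'⟩ := g2_sign (a 0) (b 0) (a 4) (b 4) 9 hc hC bne (by norm_num)
      (by linear_combination A2 / 3) (by linear_combination A3 / 5)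
    have key : (17100/29) * b 4 ^ 2 = 0 := by
      rcases h with h | h <;> rcases h' with ⟨e, h'⟩ | ⟨e, h'⟩
      · rw [h, h'] at B1 B2 B3
        linear_combination 3 * (-1/87) * B1 + (-56/29) * B2 + B3
      · exact absurd (h.symm.trans e) (by
          intro h; exact hc (by linear_combination h / 2))
      · exact absurd (h.symm.trans e) (by
          intro h; exact hc (by linear_combination -h / 2))
      · rw [h, h'] at B1 B2 B3
        linear_combination -3 * (-1/87) * B1 - (-56/29) * B2 + B3
    exact bne (by simpa using key)
  · norm_num at A1 A2 A3 B1 B2 B3 bne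
    obtain ⟨h, h'⟩ := g2_sign (a 0) (b 0) (a 6) (b 6) 27 hc hC bne (by norm_num)
      (by linear_combination A2 / 3) (by linear_combination A3 / 7)
    have key : 7056 * b 6 ^ 2 = 0 := by
      rcases h with h | h <;> rcases h' with ⟨e, h'⟩ | ⟨e, h'⟩
      · rw [h, h'] at B1 B2 B3
        linear_combination 3 * (-1/729) * B1 + (-22/9) * B2 + B3
      · exact absurd (h.symm.trans e) (by
          intro h; exact hc (by linear_combination h / 2))
      · exact absurd (h.symm.trans e) (by
          intro h; exact hc (by linear_combination -h / 2))
      · rw [h, h'] at B1 B2 B3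
        linear_combination -3 * (-1/729) * B1 - (-22/9) * B2 + B3
    exact bne (by simpa using key)

end Analytic1

section Analytic2
open Filter Topology

/-- Taylor coefficients at the origin. -/
noncomputable def tay (p : ℂ → ℂ) (k : ℕ) : ℂ := iteratedDeriv k p 0 / (k.factorial : ℂ)

lemma tay_congr {p q : ℂ → ℂ} (h : p =ᶠ[𝓝 0] q) (k : ℕ) : tay p k = tay q k := by
  unfold tay; rw [h.iteratedDeriv_eq]

lemma tay_zero (p : ℂ → ℂ) : tay p 0 = p 0 := by simp [tay]

lemma tay_add {p q : ℂ → ℂ} (hp : AnalyticAt ℂ p 0) (hq : AnalyticAt ℂ q 0) (k : ℕ) :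
    tay (fun z => p z + q z) k = tay p k + tay q k := by
  unfold tay
  rw [iteratedDeriv_fun_add hp.contDiffAt hq.contDiffAt]
  ring

lemma tay_cmul (c : ℂ) (p : ℂ → ℂ) (k : ℕ) :
    tay (fun z => c * p z) k = c * tay p k := by
  unfold tay
  rw [iteratedDeriv_const_mul_field]
  ring

lemma tay_dil (c : ℂ) (p : ℂ → ℂ) (k : ℕ) :
    tay (fun z => p (c * z)) k = c ^ k * tay p k := by
  have : ∀ k, iteratedDeriv k (fun z => p (c * z)) = fun z => c ^ k * iteratedDeriv k p (c * z) := by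
    intro k
    induction k with
    | zero => simp
    | succ n ih =>
      funext z
      rw [iteratedDeriv_succ, ih, iteratedDeriv_succ]
      have := deriv_comp_mul_left c (iteratedDeriv n p) z
      rw [deriv_const_mul_field, this, smul_eq_mul]
      ring
  unfold tay
  rw [this]
  simp only [mul_zero]
  ring

lemma tay_mul {p q : ℂ → ℂ} (hp : AnalyticAt ℂ p 0) (hq : AnalyticAt ℂ q 0) (k : ℕ) :
    tay (fun z => p z * q z) k
      = ∑ i ∈ Finset.HasAntidiagonal.antidiagonal k, tay p i.1 * tay q i.2 := by
  unfold tay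
  rw [iteratedDeriv_fun_mul hp.contDiffAt hq.contDiffAt,
    Finset.Nat.sum_antidiagonal_eq_sum_range_succ
      (fun i j => iteratedDeriv i p 0 / (i.factorial : ℂ) * (iteratedDeriv j q 0 / (j.factorial : ℂ))),
    Finset.sum_div]
  apply Finset.sum_congr rfl
  intro i hi
  have hik : i ≤ k := by simpa [Nat.lt_succ_iff] using hi
  rw [Nat.cast_choose ℂ hik]
  have h1 : (k.factorial : ℂ) ≠ 0 := by exact_mod_cast k.factorial_ne_zero
  have h2 : (i.factorial : ℂ) ≠ 0 := by exact_mod_cast i.factorial_ne_zero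
  have h3 : ((k - i).factorial : ℂ) ≠ 0 := by exact_mod_cast (k - i).factorial_ne_zero
  field_simp

lemma tay_deriv (p : ℂ → ℂ) (k : ℕ) : tay (deriv p) k = (k + 1) * tay p (k + 1) := by
  unfold tay
  rw [iteratedDeriv_succ']
  have h1 : (k.factorial : ℂ) ≠ 0 := by exact_mod_cast k.factorial_ne_zero
  have h2 : (k + 1 : ℂ) ≠ 0 := by exact_mod_cast k.succ_ne_zero
  rw [Nat.factorial_succ]
  push_cast
  field_simp

lemma tay_id (k : ℕ) : tay (fun z => z) k = if k = 1 then 1 else 0 := by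
  unfold tay
  rw [iteratedDeriv_fun_id_zero]
  split_ifs with h
  · subst h; simp
  · simp

lemma tay_zderiv {p : ℂ → ℂ} (hp : AnalyticAt ℂ p 0) (k : ℕ) :
    tay (fun z => z * deriv p z) k = k * tay p k := by
  rw [tay_mul (p := fun z => z) analyticAt_id hp.deriv]
  simp only [tay_id, tay_deriv]
  cases k with
  | zero => simp
  | succ n =>
    rw [Finset.sum_eq_single (1, n)]
    · simp
    · rintro ⟨i, j⟩ hij hne
      simp only [Finset.HasAntidiagonal.mem_antidiagonal] at hij
      by_cases h : i = 1
      · subst h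
        exact absurd (by ext <;> simp; omega) hne
      · simp [h]
    · intro h
      simp at h
      omega

lemma eventually_const_of_tay {p : ℂ → ℂ} (hp : AnalyticAt ℂ p 0) (h : ∀ k, 0 < k → tay p k = 0) :
    ∀ᶠ z in 𝓝 0, p z = p 0 := by
  have h1 := hp.hasFPowerSeriesAt
  obtain ⟨r, hr⟩ := h1
  have h2 := hr.eventually_hasSum
  simp only [zero_add] at h2
  filter_upwards [h2] with z hz
  refine hz.unique ?_
  have := hasSum_single (f := fun n : ℕ => ((FormalMultilinearSeries.ofScalars ℂ
    fun n ↦ iteratedDeriv n p 0 / ↑n.factorial) n) fun _ => z) 0 ?_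
  · simpa using this
  · intro n hn
    have := h n (Nat.pos_of_ne_zero hn)
    unfold tay at this
    simp [FormalMultilinearSeries.ofScalars, this]

lemma ofReal_tendsto : Tendsto (fun t : ℝ => (t : ℂ)) (𝓝[>] 0) (𝓝[≠] 0) := by
  apply tendsto_nhdsWithin_of_tendsto_nhds_of_eventually_within
  · have := (Complex.continuous_ofReal.tendsto 0)
    simp only [Complex.ofReal_zero] at this
    exact this.mono_left nhdsWithin_le_nhds
  · filter_upwards [self_mem_nhdsWithin] with t ht
    have : t ≠ 0 := ne_of_gt ht
    simpa using this

lemma ext_real {g : ℂ → ℂ} (hg : MeromorphicAt g 0) (h : ∀ᶠ t : ℝ in 𝓝[>] 0, g t = 0) :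
    ∀ᶠ z in 𝓝[≠] 0, g z = 0 := by
  rcases hg.eventually_eq_zero_or_eventually_ne_zero with h1 | h1
  · exact h1
  · have := ofReal_tendsto.eventually h1
    obtain ⟨t, ht⟩ := (h.and this).exists
    exact absurd ht.1 ht.2

lemma simple_pole {f : ℂ → ℂ} (hf : MeromorphicAt f 0) {c : ℂ}
    (h : Tendsto (fun t : ℝ => (t : ℂ) * f t) (𝓝[>] 0) (𝓝 c)) :
    ∃ p : ℂ → ℂ, AnalyticAt ℂ p 0 ∧ p 0 = c ∧ ∀ᶠ z in 𝓝[≠] 0, f z = p z / z := by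
  set g : ℂ → ℂ := fun z => z * f z with hgdef
  have hg : MeromorphicAt g 0 := (MeromorphicAt.id 0).mul hf
  have h0 : 0 ≤ meromorphicOrderAt g 0 := by
    by_contra hlt
    push Not at hlt
    have h1 := (tendsto_cobounded_of_meromorphicOrderAt_neg hlt).comp ofReal_tendsto
    have h2 : Tendsto (fun t : ℝ => ‖g t‖) (𝓝[>] 0) atTop :=
      tendsto_norm_atTop_iff_cobounded.2 h1
    exact not_tendsto_atTop_of_tendsto_nhds h.norm h2
  obtain ⟨c', hc'⟩ := tendsto_nhds_of_meromorphicOrderAt_nonneg hg h0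
  have hcc : c' = c := tendsto_nhds_unique (hc'.comp ofReal_tendsto) h
  subst hcc
  refine ⟨Function.update g 0 c', ?_, by simp, ?_⟩
  · apply MeromorphicAt.analyticAt
    · refine hg.congr ?_
      filter_upwards [self_mem_nhdsWithin] with z hz
      rw [Function.update_of_ne hz]
    · exact continuousAt_update_same.2 hc'
  · filter_upwards [self_mem_nhdsWithin] with z hz
    rw [Function.update_of_ne hz, hgdef]
    have : z ≠ 0 := hz
    field_simp

lemma tay_zero_of_real {g : ℂ → ℂ} (hg : AnalyticAt ℂ g 0) (h : ∀ᶠ t : ℝ in 𝓝[>] 0, g t = 0)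
    (k : ℕ) : tay g k = 0 := by
  have h1 : ∀ᶠ z in 𝓝 (0 : ℂ), g z = 0 := by
    rcases hg.eventually_eq_zero_or_eventually_ne_zero with h1 | h1
    · exact h1
    · have := ofReal_tendsto.eventually h1
      obtain ⟨t, ht⟩ := (h.and this).exists
      exact absurd ht.1 ht.2
  have : g =ᶠ[𝓝 0] fun _ => 0 := h1
  rw [tay_congr this]
  simp [tay]

/-- `f` is of the form `c / z` near the origin. -/
def GoodFn (f : ℂ → ℂ) : Prop := ∃ c : ℂ, ∀ᶠ z in 𝓝[≠] (0 : ℂ), f z = c / z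

lemma good_of_real {f : ℂ → ℂ} (hf : MeromorphicAt f 0) {c : ℂ}
    (h : ∀ᶠ t : ℝ in 𝓝[>] 0, f t = c / t) : GoodFn f := by
  refine ⟨c, ?_⟩
  have h1 : MeromorphicAt (fun z => f z - c / z) 0 :=
    hf.sub ((MeromorphicAt.const c 0).div (MeromorphicAt.id 0))
  have h2 := ext_real h1 (by
    filter_upwards [h] with t ht
    rw [ht]; ring)
  filter_upwards [h2] with z hz
  exact sub_eq_zero.1 hz

lemma pball {P : ℂ → Prop} (h : ∀ᶠ z in 𝓝[≠] (0 : ℂ), P z) :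
    ∃ ε : ℝ, 0 < ε ∧ ∀ z : ℂ, z ≠ 0 → ‖z‖ < ε → P z := by
  rw [eventually_nhdsWithin_iff, Metric.eventually_nhds_iff] at h
  obtain ⟨ε, he, h⟩ := h
  exact ⟨ε, he, fun z hz hn => h (by simpa using hn) hz⟩

lemma slope_lim {f : ℂ → ℂ} {x : ℂ} (hf : AnalyticAt ℂ f x) (a : ℂ) :
    Tendsto (fun t : ℝ => (f (x + a * t) - f x) / t) (𝓝[>] 0) (𝓝 (a * deriv f x)) := by
  have h1 : HasDerivAt (fun z : ℂ => x + a * z) a ((0 : ℝ) : ℂ) := by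
    simpa using ((hasDerivAt_id ((0 : ℝ) : ℂ)).const_mul a).const_add x
  have h2 : HasDerivAt f (deriv f x) ((fun z : ℂ => x + a * z) ((0 : ℝ) : ℂ)) := by
    simpa using hf.differentiableAt.hasDerivAt
  have h3 := (HasDerivAt.comp (h₂ := f) (h := fun z : ℂ => x + a * z) ((0 : ℝ) : ℂ) h2 h1).comp_ofReal
  rw [hasDerivAt_iff_tendsto_slope_zero] at h3
  have h4 := h3.mono_left (nhdsWithin_mono (0 : ℝ) (fun t (ht : t ∈ Set.Ioi 0) => (ne_of_gt ht)))
  rw [mul_comm]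
  refine h4.congr ?_
  intro t
  simp [Function.comp, div_eq_inv_mul]

lemma val_lim {f : ℂ → ℂ} {x : ℂ} (hf : AnalyticAt ℂ f x) (a : ℂ) :
    Tendsto (fun t : ℝ => f (x + a * t)) (𝓝[>] 0) (𝓝 (f x)) := by
  have h1 : Tendsto (fun t : ℝ => x + a * (t : ℂ)) (𝓝[>] 0) (𝓝 x) := by
    have : Continuous (fun t : ℝ => x + a * (t : ℂ)) := by fun_prop
    have := this.tendsto 0
    simp only [Complex.ofReal_zero, mul_zero, add_zero] at this
    exact this.mono_left nhdsWithin_le_nhds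
  exact hf.continuousAt.tendsto.comp h1

lemma small_pos {ε : ℝ} (he : 0 < ε) : ∀ᶠ t : ℝ in 𝓝[>] 0, 0 < t ∧ t < ε := by
  filter_upwards [Ioo_mem_nhdsGT he] with t ht using ht

/-- The `A₂` case. -/
lemma a2_good {f : ℂ → ℂ} (hf : MeromorphicAt f 0) (hne : ∀ᶠ z in 𝓝[≠] 0, f z ≠ 0)
    (heq : ∃ ε : ℝ, 0 < ε ∧ ∀ u v : ℝ, 0 < u → 0 < v → u < ε → v < ε →
      f v * f (u + v) + f (u + v) * f u - f u * f v = 0) : GoodFn f := by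
  obtain ⟨ε, he, heq⟩ := heq
  obtain ⟨δ, hd, hb⟩ := pball (hne.and hf.eventually_analyticAt)
  set ρ := min ε δ / 2 with hρ
  have hρ0 : 0 < ρ := by positivity
  have hρ1 : 2 * ρ ≤ ε := by rw [hρ]; linarith [min_le_left ε δ]
  have hρ2 : 2 * ρ ≤ δ := by rw [hρ]; linarith [min_le_right ε δ]
  have hb' : ∀ t : ℝ, 0 < t → t < 2 * ρ → f t ≠ 0 ∧ AnalyticAt ℂ f t := by
    intro t h0 h1
    exact hb t (by exact_mod_cast h0.ne') (by
      rw [Complex.norm_real, Real.norm_eq_abs, abs_of_pos h0]; linarith)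
  set h : ℂ → ℂ := fun z => (f z)⁻¹ with hh
  have hadd : ∀ u v : ℝ, 0 < u → 0 < v → u < ρ → v < ρ → h (u + v) = h u + h v := by
    intro u v h1 h2 h3 h4
    have e := heq u v h1 h2 (by linarith) (by linarith)
    have n1 := (hb' u h1 (by linarith)).1
    have n2 := (hb' v h2 (by linarith)).1
    have n3 := (hb' (u + v) (by linarith) (by linarith)).1
    push_cast at n3
    simp only [hh]
    field_simp
    linear_combination -e
  have hu0 : AnalyticAt ℂ h ((ρ / 2 : ℝ) : ℂ) :=
    ((hb' (ρ / 2) (by positivity) (by linarith)).2).inv (hb' (ρ / 2) (by positivity) (by linarith)).1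
  have hlim := slope_lim hu0 1
  set k := 1 * deriv h ((ρ / 2 : ℝ) : ℂ) with hk
  have hlim2 : Tendsto (fun t : ℝ => h t / t) (𝓝[>] 0) (𝓝 k) := by
    refine hlim.congr' ?_
    filter_upwards [small_pos hρ0] with t ht
    rw [one_mul, hadd (ρ / 2) t (by positivity) ht.1 (by linarith) ht.2]
    ring
  have hlin : ∀ u : ℝ, 0 < u → u < ρ → h u / u = k := by
    intro u hu0 hu1
    have e1 : ∀ n : ℕ, h ((u / 2 ^ n : ℝ) : ℂ) / ((u / 2 ^ n : ℝ) : ℂ) = h u / u := by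
      intro n
      induction n with
      | zero => simp
      | succ n ih =>
        rw [← ih]
        have hp : 0 < u / 2 ^ (n + 1) := by positivity
        have hle : u / 2 ^ (n + 1) ≤ u := div_le_self hu0.le (one_le_pow₀ (by norm_num))
        have e := hadd (u / 2 ^ (n + 1)) (u / 2 ^ (n + 1)) hp hp (by linarith) (by linarith)
        have e2 : ((u / 2 ^ n : ℝ) : ℂ) = ((u / 2 ^ (n + 1) : ℝ) : ℂ) + ((u / 2 ^ (n + 1) : ℝ) : ℂ) := by
          rw [← Complex.ofReal_add]
          congr 1
          rw [pow_succ]; field_simp; norm_num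
        rw [e2, e]
        have hne : ((u / 2 ^ (n + 1) : ℝ) : ℂ) ≠ 0 := by exact_mod_cast hp.ne'
        field_simp
    have e2 : Tendsto (fun n : ℕ => u / 2 ^ n) atTop (𝓝[>] 0) := by
      apply tendsto_nhdsWithin_of_tendsto_nhds_of_eventually_within
      · have := (tendsto_pow_atTop_nhds_zero_of_lt_one (r := (1 / 2 : ℝ)) (by norm_num)
          (by norm_num)).const_mul u
        simpa [div_eq_mul_inv] using this
      · exact Eventually.of_forall (fun n => by simp only [Set.mem_Ioi]; positivity)
    have e3 := hlim2.comp e2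
    refine tendsto_nhds_unique ?_ e3
    refine tendsto_const_nhds.congr ?_
    intro n
    exact (e1 n).symm
  refine good_of_real hf (c := k⁻¹) ?_
  filter_upwards [small_pos hρ0] with t ht
  have h1 := hlin t ht.1 ht.2
  have h2 : (t : ℂ) ≠ 0 := by exact_mod_cast ht.1.ne'
  have h3 := (hb' t ht.1 (by linarith [ht.2])).1
  rw [← h1]
  simp only [hh]
  field_simp

/-- If `t f(t)` is constant for small positive `t`, `f` is good. -/
lemma good_of_const {f : ℂ → ℂ} (hf : MeromorphicAt f 0) {ε : ℝ} (he : 0 < ε)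
    (h : ∀ s t : ℝ, 0 < s → s < t → t < ε → (s : ℂ) * f s = t * f t) : GoodFn f := by
  refine good_of_real hf (c := ((ε / 2 : ℝ) : ℂ) * f ((ε / 2 : ℝ) : ℂ)) ?_
  filter_upwards [small_pos (half_pos he)] with t ht
  have h2 : (t : ℂ) ≠ 0 := by exact_mod_cast ht.1.ne'
  rw [← h t (ε / 2) ht.1 ht.2 (by linarith)]
  field_simp

lemma good_ball {f : ℂ → ℂ} (hg : GoodFn f) (hne : ∀ᶠ z in 𝓝[≠] 0, f z ≠ 0) :
    ∃ c : ℂ, c ≠ 0 ∧ ∃ ε : ℝ, 0 < ε ∧ ∀ t : ℝ, 0 < t → t < ε → f t = c / t := by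
  obtain ⟨c, hc⟩ := hg
  obtain ⟨ε, he, hb⟩ := pball (hc.and hne)
  have hb' : ∀ t : ℝ, 0 < t → t < ε → f t = c / t ∧ f t ≠ 0 := by
    intro t h0 h1
    exact hb t (by exact_mod_cast h0.ne') (by
      rw [Complex.norm_real, Real.norm_eq_abs, abs_of_pos h0]; linarith)
  refine ⟨c, ?_, ε, he, fun t h0 h1 => (hb' t h0 h1).1⟩
  rintro rfl
  have := hb' (ε / 2) (by linarith) (by linarith)
  exact this.2 (by rw [this.1]; simp)

/-- The `B₂` case, short from long. -/
lemma b2_short {f F : ℂ → ℂ} (hf : MeromorphicAt f 0) (hF : GoodFn F)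
    (hne : ∀ᶠ z in 𝓝[≠] 0, F z ≠ 0)
    (heq : ∃ ε : ℝ, 0 < ε ∧ ∀ x y : ℝ, 0 < x → x < y → y < ε →
      F (y - x) * (f y - f x) + F (x + y) * (f x + f y) = 0) : GoodFn f := by
  obtain ⟨ε, he, heq⟩ := heq
  obtain ⟨c, hc, δ, hd, hb⟩ := good_ball hF hne
  refine good_of_const hf (ε := min ε (δ / 2)) (by positivity) ?_
  intro x y hx hxy hy
  have hy1 := lt_of_lt_of_le hy (min_le_left _ _)
  have hy2 := lt_of_lt_of_le hy (min_le_right _ _)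
  have e := heq x y hx hxy hy1
  have e1 := hb (y - x) (by linarith) (by linarith)
  have e2 := hb (x + y) (by linarith) (by linarith)
  push_cast at e1 e2
  rw [e1, e2] at e
  have n1 : (y : ℂ) - x ≠ 0 := by exact_mod_cast (by linarith : (0 : ℝ) < y - x).ne'
  have n2 : (x : ℂ) + y ≠ 0 := by exact_mod_cast (by linarith : (0 : ℝ) < x + y).ne'
  field_simp at e
  have e' : c * (2 * (y * f y - x * f x)) = 0 := by linear_combination e
  have := (mul_eq_zero.1 e').resolve_left hc
  linear_combination -this / 2

/-- The `B₂` case, long from short. -/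
lemma b2_long {f F : ℂ → ℂ} (hf : GoodFn f) (hF : MeromorphicAt F 0)
    (hne : ∀ᶠ z in 𝓝[≠] 0, f z ≠ 0)
    (heq : ∃ ε : ℝ, 0 < ε ∧ ∀ x y : ℝ, 0 < x → x < y → y < ε →
      F (y - x) * (f y - f x) + F (x + y) * (f x + f y) = 0) : GoodFn F := by
  obtain ⟨ε, he, heq⟩ := heq
  obtain ⟨c, hc, δ, hd, hb⟩ := good_ball hf hne
  refine good_of_const hF (ε := min ε δ) (by positivity) ?_
  intro s t hs hst ht
  have hy1 := lt_of_lt_of_le ht (min_le_left _ _)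
  have hy2 := lt_of_lt_of_le ht (min_le_right _ _)
  have e := heq ((t - s) / 2) ((t + s) / 2) (by linarith) (by linarith) (by linarith)
  have e1 := hb ((t - s) / 2) (by linarith) (by linarith)
  have e2 := hb ((t + s) / 2) (by linarith) (by linarith)
  rw [e1, e2] at e
  push_cast at e
  have n1 : (t : ℂ) - s ≠ 0 := by exact_mod_cast (by linarith : (0 : ℝ) < t - s).ne'
  have n2 : (t : ℂ) + s ≠ 0 := by exact_mod_cast (by linarith : (0 : ℝ) < t + s).ne'
  rw [show ((t : ℂ) + s) / 2 - (t - s) / 2 = s by ring,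
    show ((t : ℂ) - s) / 2 + (t + s) / 2 = t by ring] at e
  field_simp at e
  have e' : c * (t * F t - s * F s) = 0 := by
    linear_combination e / 4
  have := (mul_eq_zero.1 e').resolve_left hc
  linear_combination -this

end Analytic2

section Analytic3
open Filter Topology

lemma deriv_of_div {f p : ℂ → ℂ} (hp : AnalyticAt ℂ p 0) (h : ∀ᶠ z in 𝓝[≠] 0, f z = p z / z) :
    ∀ᶠ z in 𝓝[≠] 0, z ^ 2 * deriv f z = z * deriv p z - p z := by
  have h1 := eventually_eventually_nhdsWithin.2 h
  have h2 := (hp.eventually_analyticAt).filter_mono (nhdsWithin_le_nhds (s := {0}ᶜ))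
  filter_upwards [h1, h2, self_mem_nhdsWithin] with z hz hz2 hz3
  have hz0 : z ≠ 0 := hz3
  rw [isOpen_compl_singleton.nhdsWithin_eq hz3] at hz
  have e : f =ᶠ[𝓝 z] fun z => p z / z := hz
  rw [e.deriv_eq]
  have h4 := (hz2.differentiableAt.hasDerivAt.div (hasDerivAt_id z) hz0).deriv
  have h5 : deriv (fun z => p z / z) z = (deriv p z * id z - p z * 1) / id z ^ 2 := h4
  rw [h5]
  simp only [id]
  field_simp

lemma even_tay {f p : ℂ → ℂ} (h : ∀ᶠ z in 𝓝[≠] 0, f z = p z / z)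
    (hodd : ∀ᶠ z in 𝓝[≠] (0 : ℂ), f (-z) = - f z) (k : ℕ) (hk : Odd k) : tay p k = 0 := by
  obtain ⟨ε, he, hb⟩ := pball (h.and hodd)
  have h1 : (fun z => p ((-1) * z)) =ᶠ[𝓝 0] p := by
    filter_upwards [Metric.ball_mem_nhds (0 : ℂ) he] with z hz
    by_cases hz0 : z = 0
    · simp [hz0]
    have hz1 : ‖z‖ < ε := by simpa using hz
    have e1 := hb z hz0 hz1
    have e2 := hb (-z) (neg_ne_zero.2 hz0) (by simpa using hz1)
    have e3 := e1.2
    rw [e2.1, e1.1] at e3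
    field_simp at e3
    rw [neg_one_mul]
    linear_combination -e3
  have h2 := tay_congr h1 k
  rw [tay_dil, hk.neg_one_pow] at h2
  linear_combination -h2 / 2

lemma ne_tay {f p : ℂ → ℂ} (hp : AnalyticAt ℂ p 0) (h : ∀ᶠ z in 𝓝[≠] 0, f z = p z / z)
    (hne : ∀ᶠ z in 𝓝[≠] (0 : ℂ), f z ≠ 0) : ∃ k, tay p k ≠ 0 := by
  by_contra hc
  push Not at hc
  have h1 := eventually_const_of_tay hp (fun k _ => hc k)
  have h0 := hc 0
  rw [tay_zero] at h0
  have h2 := h1.filter_mono (nhdsWithin_le_nhds (s := {0}ᶜ))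
  obtain ⟨z, hz⟩ := (h2.and (h.and hne)).exists
  apply hz.2.2
  rw [hz.2.1, hz.1, h0]; simp

lemma good_of_tay {f p : ℂ → ℂ} (hp : AnalyticAt ℂ p 0) (h : ∀ᶠ z in 𝓝[≠] 0, f z = p z / z)
    (ht : ∀ k, 0 < k → tay p k = 0) : GoodFn f := by
  refine ⟨p 0, ?_⟩
  have h2 := (eventually_const_of_tay hp ht).filter_mono (nhdsWithin_le_nhds (s := {0}ᶜ))
  filter_upwards [h, h2] with z h1 h2
  rw [h1, h2]

lemma exists_deriv_ne {f : ℂ → ℂ} (hf : MeromorphicAt f 0) (hne : ∀ᶠ z in 𝓝[≠] (0 : ℂ), f z ≠ 0)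
    (hodd : ∀ᶠ z in 𝓝[≠] (0 : ℂ), f (-z) = - f z) {δ : ℝ} (hd : 0 < δ)
    (han : ∀ t : ℝ, 0 < t → t < δ → AnalyticAt ℂ f t) :
    ∃ x : ℝ, 0 < x ∧ x < δ ∧ deriv f x ≠ 0 := by
  by_contra hc
  push Not at hc
  have hD : ∀ t ∈ Set.Ioo 0 δ, HasDerivAt (fun t : ℝ => f t) 0 t := by
    intro t ht
    have := (han t ht.1 ht.2).differentiableAt.hasDerivAt.comp_ofReal
    rwa [hc t ht.1 ht.2] at this
  have hconst : ∀ t : ℝ, 0 < t → t < δ → f t = f ((δ / 2 : ℝ) : ℂ) := by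
    intro t h1 h2
    exact isOpen_Ioo.is_const_of_deriv_eq_zero (f := fun t : ℝ => f t) isPreconnected_Ioo
      (fun t ht => (hD t ht).differentiableAt.differentiableWithinAt)
      (fun t ht => (hD t ht).deriv) (x := t) (y := δ / 2) ⟨h1, h2⟩ ⟨by linarith, by linarith⟩
  set C := f ((δ / 2 : ℝ) : ℂ)
  have h2 := ext_real (hf.sub (MeromorphicAt.const C 0)) (by
    filter_upwards [small_pos hd] with t ht
    simp [hconst t ht.1 ht.2])
  obtain ⟨ε, he, hb⟩ := pball (h2.and (hodd.and hne))
  have hz : ((ε / 2 : ℝ) : ℂ) ≠ 0 := by exact_mod_cast (half_pos he).ne'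
  have hn : ‖((ε / 2 : ℝ) : ℂ)‖ < ε := by
    rw [Complex.norm_real, Real.norm_eq_abs, abs_of_pos (half_pos he)]; linarith
  have e1 := hb _ hz hn
  have e2 := hb _ (neg_ne_zero.2 hz) (by rwa [norm_neg])
  have a1 := sub_eq_zero.1 e1.1
  have a2 := sub_eq_zero.1 e2.1
  have a3 := e1.2.1
  simp only at a1 a2
  rw [a1, a2] at a3
  apply e1.2.2
  rw [a1]
  linear_combination a3 / 2

/-- The `G₂` case. -/
lemma g2_good {f F : ℂ → ℂ} (hf : MeromorphicAt f 0) (hF : MeromorphicAt F 0)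
    (hnf : ∀ᶠ z in 𝓝[≠] (0 : ℂ), f z ≠ 0) (hnF : ∀ᶠ z in 𝓝[≠] (0 : ℂ), F z ≠ 0)
    (hof : ∀ᶠ z in 𝓝[≠] (0 : ℂ), f (-z) = - f z) (hoF : ∀ᶠ z in 𝓝[≠] (0 : ℂ), F (-z) = - F z)
    (heq : ∃ ε : ℝ, 0 < ε ∧ ∀ x y : ℝ, 0 < y → y < x → x < ε →
      F (x - y) * (f x - f y) + F (2 * x + y) * (f x + f (x + y))
        + F (x + 2 * y) * (f (x + y) + f y) = 0 ∧
      f x * f y - f (x + y) * (f x + f y) + 3 * (F (x - y) * F (x + 2 * y)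
        - F (2 * x + y) * (F (x - y) + F (x + 2 * y))) = 0) : GoodFn f ∧ GoodFn F := by
  obtain ⟨ε, he, heq⟩ := heq
  obtain ⟨δ, hd, hb⟩ := pball (hf.eventually_analyticAt.and hF.eventually_analyticAt)
  have hb' : ∀ t : ℝ, 0 < t → t < δ → AnalyticAt ℂ f t ∧ AnalyticAt ℂ F t := by
    intro t h0 h1
    exact hb t (by exact_mod_cast h0.ne') (by
      rw [Complex.norm_real, Real.norm_eq_abs, abs_of_pos h0]; linarith)
  set ρ := min ε δ / 4 with hρ
  have hρ0 : 0 < ρ := by positivity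
  have hρ1 : 4 * ρ ≤ ε := by rw [hρ]; linarith [min_le_left ε δ]
  have hρ2 : 4 * ρ ≤ δ := by rw [hρ]; linarith [min_le_right ε δ]
  -- basic limits
  have L1 : ∀ x : ℝ, 0 < x → x < ρ → Tendsto
      (fun t : ℝ => ((t : ℂ) * f t) * ((f (x + 1 * t) - f x) / t)) (𝓝[>] 0)
      (𝓝 (- f x ^ 2 + 3 * (F x ^ 2 - 2 * F (2 * x) * F x))) := by
    intro x h0 h1
    have a1 := hb' x h0 (by linarith)
    have a2 := hb' (2 * x) (by linarith) (by linarith)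
    push_cast at a2
    have T := (((val_lim a1.1 1).mul_const (f x)).neg).add
      ((((val_lim a1.2 (-1)).mul (val_lim a1.2 2)).sub ((val_lim a2.2 1).mul
        ((val_lim a1.2 (-1)).add (val_lim a1.2 2)))).const_mul 3)
    have e0 : -(f x * f x) + 3 * (F x * F x - F (2 * x) * (F x + F x))
      = - f x ^ 2 + 3 * (F x ^ 2 - 2 * F (2 * x) * F x) := by ring
    rw [e0] at T
    refine T.congr' ?_
    filter_upwards [small_pos h0] with t ht
    have e := (heq x t ht.1 ht.2 (by linarith)).2
    have ht0 : (t : ℂ) ≠ 0 := by exact_mod_cast ht.1.ne'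
    rw [show (t : ℂ) * f t * ((f (x + 1 * t) - f x) / t) = f t * (f (x + 1 * t) - f x) by
      field_simp]
    simp only [one_mul, neg_mul, ← sub_eq_add_neg]
    linear_combination e
  have L2 : ∀ x : ℝ, 0 < x → x < ρ → Tendsto
      (fun t : ℝ => ((t : ℂ) * f t) * ((F (x + 2 * t) - F x) / t - (F (x + (-1) * t) - F x) / t))
      (𝓝[>] 0) (𝓝 (- 2 * f x * (F x + F (2 * x)))) := by
    intro x h0 h1
    have a1 := hb' x h0 (by linarith)
    have a2 := hb' (2 * x) (by linarith) (by linarith)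
    push_cast at a2
    have T := ((((val_lim a1.2 (-1)).mul_const (f x)).add ((val_lim a2.2 1).mul
      ((val_lim a1.1 1).const_add (f x)))).add ((val_lim a1.2 2).mul (val_lim a1.1 1))).neg
    have e0 : -(F x * f x + F (2 * x) * (f x + f x) + F x * f x)
      = - 2 * f x * (F x + F (2 * x)) := by ring
    rw [e0] at T
    refine T.congr' ?_
    filter_upwards [small_pos h0] with t ht
    have e := (heq x t ht.1 ht.2 (by linarith)).1
    have ht0 : (t : ℂ) ≠ 0 := by exact_mod_cast ht.1.ne'
    rw [show (t : ℂ) * f t * ((F (x + 2 * t) - F x) / t - (F (x + (-1) * t) - F x) / t)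
      = f t * (F (x + 2 * t) - F (x + (-1) * t)) by field_simp; ring]
    simp only [one_mul, neg_mul, ← sub_eq_add_neg]
    linear_combination -e
  have L3 : ∀ u : ℝ, 0 < u → u < ρ → Tendsto
      (fun t : ℝ => ((t : ℂ) * F t) * ((f (u + 1 * t) - f u) / t)) (𝓝[>] 0)
      (𝓝 (- 2 * F (3 * u) * (f u + f (2 * u)))) := by
    intro u h0 h1
    have a1 := hb' u h0 (by linarith)
    have a2 := hb' (2 * u) (by linarith) (by linarith)
    have a3 := hb' (3 * u) (by linarith) (by linarith)
    push_cast at a2 a3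
    have T := (((val_lim a3.2 2).mul ((val_lim a1.1 1).add (val_lim a2.1 1))).add
      ((val_lim a3.2 1).mul ((val_lim a2.1 1).add_const (f u)))).neg
    have e0 : -(F (3 * u) * (f u + f (2 * u)) + F (3 * u) * (f (2 * u) + f u))
      = - 2 * F (3 * u) * (f u + f (2 * u)) := by ring
    rw [e0] at T
    refine T.congr' ?_
    filter_upwards [small_pos h0] with t ht
    have e := (heq (u + t) u h0 (by linarith [ht.1]) (by linarith [ht.2])).1
    have ht0 : (t : ℂ) ≠ 0 := by exact_mod_cast ht.1.ne'
    push_cast at e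
    rw [show ((u : ℂ) + t - u) = t by ring, show 2 * ((u : ℂ) + t) + u = 3 * u + 2 * t by ring,
      show (u : ℂ) + t + u = 2 * u + t by ring, show (u : ℂ) + t + 2 * u = 3 * u + t by ring] at e
    rw [show (t : ℂ) * F t * ((f (u + 1 * t) - f u) / t) = F t * (f (u + 1 * t) - f u) by
      field_simp]
    simp only [one_mul]
    linear_combination -e
  obtain ⟨x0, hx0, hx1, hx2⟩ := exists_deriv_ne hf hnf hof hρ0
    (fun t h0 h1 => (hb' t h0 (by linarith)).1)
  have S0 := slope_lim (hb' x0 hx0 (by linarith)).1 1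
  have hS0 : (1 : ℂ) * deriv f x0 ≠ 0 := by simpa using hx2
  have hSne := S0.eventually_ne hS0
  have C1 : ∃ c, Tendsto (fun t : ℝ => (t : ℂ) * f t) (𝓝[>] 0) (𝓝 c) := by
    refine ⟨_, ((L1 x0 hx0 hx1).div S0 hS0).congr' ?_⟩
    filter_upwards [hSne] with t ht
    simp only [Pi.div_apply]
    rw [mul_div_assoc, div_self ht, mul_one]
  have C2 : ∃ c, Tendsto (fun t : ℝ => (t : ℂ) * F t) (𝓝[>] 0) (𝓝 c) := by
    refine ⟨_, ((L3 x0 hx0 hx1).div S0 hS0).congr' ?_⟩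
    filter_upwards [hSne] with t ht
    simp only [Pi.div_apply]
    rw [mul_div_assoc, div_self ht, mul_one]
  obtain ⟨c, hc⟩ := C1
  obtain ⟨C, hC⟩ := C2
  obtain ⟨p, hp, hp0, hfp⟩ := simple_pole hf hc
  obtain ⟨q, hq, hq0, hFq⟩ := simple_pole hF hC
  have E1 : ∀ x : ℝ, 0 < x → x < ρ →
      c * deriv f x = - f x ^ 2 + 3 * (F x ^ 2 - 2 * F (2 * x) * F x) := by
    intro x h0 h1
    have := tendsto_nhds_unique (hc.mul (slope_lim (hb' x h0 (by linarith)).1 1)) (L1 x h0 h1)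
    rwa [one_mul] at this
  have E2 : ∀ x : ℝ, 0 < x → x < ρ →
      c * (3 * deriv F x) = - 2 * f x * (F x + F (2 * x)) := by
    intro x h0 h1
    have a := (hb' x h0 (by linarith)).2
    have := tendsto_nhds_unique (hc.mul ((slope_lim a 2).sub (slope_lim a (-1)))) (L2 x h0 h1)
    rw [← this]; ring
  have E3 : ∀ x : ℝ, 0 < x → x < ρ →
      C * deriv f x = - 2 * F (3 * x) * (f x + f (2 * x)) := by
    intro x h0 h1
    have := tendsto_nhds_unique (hC.mul (slope_lim (hb' x h0 (by linarith)).1 1)) (L3 x h0 h1)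
    rwa [one_mul] at this
  obtain ⟨κ, hκ, hk⟩ := pball ((hfp.and hFq).and ((deriv_of_div hp hfp).and (deriv_of_div hq hFq)))
  have hk' : ∀ t : ℝ, 0 < t → t < κ → (f t = p t / t ∧ F t = q t / t) ∧
      ((t : ℂ) ^ 2 * deriv f t = t * deriv p t - p t ∧
        (t : ℂ) ^ 2 * deriv F t = t * deriv q t - q t) := by
    intro t h0 h1
    exact hk t (by exact_mod_cast h0.ne') (by
      rw [Complex.norm_real, Real.norm_eq_abs, abs_of_pos h0]; linarith)
  have hsm : 0 < min ρ (κ / 4) := by positivity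
  have dil : ∀ (g : ℂ → ℂ) (m : ℂ), AnalyticAt ℂ g 0 → AnalyticAt ℂ (fun z => g (m * z)) 0 := by
    intro g m hg
    have : AnalyticAt ℂ (fun z : ℂ => m * z) 0 := analyticAt_const.mul analyticAt_id
    exact AnalyticAt.fun_comp (by simpa using hg) this
  have zd : ∀ (g : ℂ → ℂ), AnalyticAt ℂ g 0 → AnalyticAt ℂ (fun z => z * deriv g z) 0 :=
    fun g hg => analyticAt_id.mul hg.deriv
  have cm : ∀ (m : ℂ) (g : ℂ → ℂ), AnalyticAt ℂ g 0 → AnalyticAt ℂ (fun z => m * g z) 0 :=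
    fun m g hg => analyticAt_const.mul hg
  have key := g2_coeffs (tay p) (tay q) (ne_tay hp hfp hnf) (ne_tay hq hFq hnF)
    (even_tay hfp hof) (even_tay hFq hoF) ?_ ?_ ?_
  · exact ⟨good_of_tay hp hfp key.1, good_of_tay hq hFq key.2⟩
  · intro k
    have A1 : AnalyticAt ℂ (fun z => z * deriv p z + (-1) * p z) 0 := (zd p hp).add (cm _ p hp)
    have A2 : AnalyticAt ℂ (fun z => p z + (1/2) * p (2 * z)) 0 := hp.add (cm _ _ (dil p 2 hp))
    have A3 : AnalyticAt ℂ (fun z => q (3 * z) * (p z + (1/2) * p (2 * z))) 0 := (dil q 3 hq).mul A2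
    have h := tay_zero_of_real (g := fun z => C * (z * deriv p z + (-1) * p z)
      + (2/3) * (q (3 * z) * (p z + (1/2) * p (2 * z)))) ((cm _ _ A1).add (cm _ _ A3)) (by
        filter_upwards [small_pos hsm] with t ht
        have l1 := lt_of_lt_of_le ht.2 (min_le_left _ _)
        have l2 := lt_of_lt_of_le ht.2 (min_le_right _ _)
        have e := E3 t ht.1 l1
        have b1 := hk' t ht.1 (by linarith)
        have b2 := hk' (2 * t) (by linarith) (by linarith)
        have b3 := hk' (3 * t) (by linarith) (by linarith)
        push_cast at b2 b3
        have ht0 : (t : ℂ) ≠ 0 := by exact_mod_cast ht.1.ne'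
        rw [b1.1.1, b2.1.1, b3.1.2] at e
        have e2 := b1.2.1
        have e3 : (t : ℂ) ^ 2 * (C * deriv f t)
          = -(2/3) * (q (3 * t) * (p t + (1/2) * p (2 * t))) := by
          rw [e]; field_simp
        linear_combination e3 - C * e2) k
    rw [tay_add (cm _ _ A1) (cm _ _ A3), tay_cmul, tay_cmul,
      tay_add (zd p hp) (cm _ p hp), tay_cmul, tay_zderiv hp,
      tay_mul (dil q 3 hq) A2] at h
    simp only [tay_add hp (cm _ _ (dil p 2 hp)), tay_cmul, tay_dil] at h
    rw [tay_zero, hq0, ← h]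
    congr 1
    · ring
    · congr 1
      refine Finset.sum_congr rfl fun i _ => ?_
      ring
  · intro k
    have A1 : AnalyticAt ℂ (fun z => z * deriv q z + (-1) * q z) 0 := (zd q hq).add (cm _ q hq)
    have A2 : AnalyticAt ℂ (fun z => q z + (1/2) * q (2 * z)) 0 := hq.add (cm _ _ (dil q 2 hq))
    have A3 : AnalyticAt ℂ (fun z => p z * (q z + (1/2) * q (2 * z))) 0 := hp.mul A2
    have h := tay_zero_of_real (g := fun z => 3 * c * (z * deriv q z + (-1) * q z)
      + 2 * (p z * (q z + (1/2) * q (2 * z)))) ((cm _ _ A1).add (cm _ _ A3)) (by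
        filter_upwards [small_pos hsm] with t ht
        have l1 := lt_of_lt_of_le ht.2 (min_le_left _ _)
        have l2 := lt_of_lt_of_le ht.2 (min_le_right _ _)
        have e := E2 t ht.1 l1
        have b1 := hk' t ht.1 (by linarith)
        have b2 := hk' (2 * t) (by linarith) (by linarith)
        push_cast at b2
        have ht0 : (t : ℂ) ≠ 0 := by exact_mod_cast ht.1.ne'
        rw [b1.1.1, b1.1.2, b2.1.2] at e
        have e2 := b1.2.2
        have e3 : (t : ℂ) ^ 2 * (c * (3 * deriv F t))
          = -2 * (p t * (q t + (1/2) * q (2 * t))) := by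
          rw [e]; field_simp
        linear_combination e3 - 3 * c * e2) k
    rw [tay_add (cm _ _ A1) (cm _ _ A3), tay_cmul, tay_cmul,
      tay_add (zd q hq) (cm _ q hq), tay_cmul, tay_zderiv hq,
      tay_mul hp A2] at h
    simp only [tay_add hq (cm _ _ (dil q 2 hq)), tay_cmul, tay_dil] at h
    rw [tay_zero, hp0, ← h]
    congr 1
    · ring
    · congr 1
      refine Finset.sum_congr rfl fun i _ => ?_
      ring
  · intro k
    have A1 : AnalyticAt ℂ (fun z => z * deriv p z + (-1) * p z) 0 := (zd p hp).add (cm _ p hp)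
    have A2 : AnalyticAt ℂ (fun z => p z * p z) 0 := hp.mul hp
    have A3 : AnalyticAt ℂ (fun z => q z * q z) 0 := hq.mul hq
    have A4 : AnalyticAt ℂ (fun z => q z * q (2 * z)) 0 := hq.mul (dil q 2 hq)
    have A5 : AnalyticAt ℂ (fun z => c * (z * deriv p z + (-1) * p z) + p z * p z) 0 :=
      (cm _ _ A1).add A2
    have A6 : AnalyticAt ℂ (fun z => (c * (z * deriv p z + (-1) * p z) + p z * p z)
      + (-3) * (q z * q z)) 0 := A5.add (cm _ _ A3)
    have h := tay_zero_of_real (g := fun z => ((c * (z * deriv p z + (-1) * p z)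
      + p z * p z) + (-3) * (q z * q z)) + 3 * (q z * q (2 * z)))
      (A6.add (cm _ _ A4)) (by
        filter_upwards [small_pos hsm] with t ht
        have l1 := lt_of_lt_of_le ht.2 (min_le_left _ _)
        have l2 := lt_of_lt_of_le ht.2 (min_le_right _ _)
        have e := E1 t ht.1 l1
        have b1 := hk' t ht.1 (by linarith)
        have b2 := hk' (2 * t) (by linarith) (by linarith)
        push_cast at b2
        have ht0 : (t : ℂ) ≠ 0 := by exact_mod_cast ht.1.ne'
        rw [b1.1.1, b1.1.2, b2.1.2] at e
        have e2 := b1.2.1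
        have e3 : (t : ℂ) ^ 2 * (c * deriv f t)
          = - (p t * p t) + 3 * (q t * q t) - 3 * (q t * q (2 * t)) := by
          rw [e]; field_simp; ring
        linear_combination e3 - c * e2) k
    rw [tay_add A6 (cm _ _ A4),
      tay_add A5 (cm _ _ A3), tay_add (cm _ _ A1) A2,
      tay_cmul, tay_cmul, tay_cmul,
      tay_add (zd p hp) (cm _ p hp), tay_cmul, tay_zderiv hp,
      tay_mul hp hp, tay_mul hq hq, tay_mul hq (dil q 2 hq)] at h
    simp only [tay_dil] at h
    rw [tay_zero, hp0, ← h]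
    ring

end Analytic3

section Roots
set_option linter.unusedSectionVars false
open Filter Topology

variable {V : Type*} [NormedAddCommGroup V] [InnerProductSpace ℝ V]

lemma reflectIn_of {γ δ : V} {c : ℝ} (hγ : γ ≠ 0) (h : 2 * ⟪γ, δ⟫ = c * ⟪γ, γ⟫) :
    reflectIn γ δ = δ - c • γ := by
  have : ⟪γ, γ⟫ ≠ 0 := inner_self_ne_zero.2 hγ
  unfold reflectIn
  rw [h, mul_div_assoc, div_self this, mul_one]

lemma reflectIn_neg_left (γ x : V) : reflectIn (-γ) x = reflectIn γ x := by
  unfold reflectIn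
  simp only [inner_neg_left, inner_neg_right, neg_neg, smul_neg]
  rw [mul_neg, neg_div, neg_smul, neg_neg]

lemma reflectIn_neg_right (γ x : V) : reflectIn γ (-x) = - reflectIn γ x := by
  unfold reflectIn
  simp only [inner_neg_right, mul_neg, neg_div, neg_smul]
  abel

lemma reflectIn_self (γ : V) : reflectIn γ γ = -γ := by
  by_cases h : γ = 0
  · simp [h, reflectIn]
  · rw [reflectIn_of (c := 2) h rfl, two_smul]; abel

lemma inner_reflectIn (γ x y : V) : ⟪reflectIn γ x, reflectIn γ y⟫ = ⟪x, y⟫ := by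
  by_cases h : γ = 0
  · simp [h, reflectIn]
  have : ⟪γ, γ⟫ ≠ 0 := inner_self_ne_zero.2 h
  unfold reflectIn
  simp only [inner_sub_left, inner_sub_right, real_inner_smul_left, real_inner_smul_right]
  rw [real_inner_comm x γ]
  field_simp
  ring

lemma reflectIn_invol (γ x : V) : reflectIn γ (reflectIn γ x) = x := by
  by_cases h : γ = 0
  · simp [h, reflectIn]
  have : ⟪γ, γ⟫ ≠ 0 := inner_self_ne_zero.2 h
  have e : ⟪γ, reflectIn γ x⟫ = - ⟪γ, x⟫ := by
    unfold reflectIn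
    simp only [inner_sub_right, real_inner_smul_right]
    field_simp
    ring
  have e2 : reflectIn γ (reflectIn γ x)
    = reflectIn γ x - (2 * ⟪γ, reflectIn γ x⟫ / ⟪γ, γ⟫) • γ := rfl
  rw [e2, e]
  unfold reflectIn
  rw [mul_neg, neg_div, neg_smul]
  abel

lemma reflectIn_chain (γ δ y : V) :
    reflectIn (reflectIn γ δ) (reflectIn γ y) = reflectIn γ (reflectIn δ y) := by
  have lin : ∀ (c : ℝ) (a b : V), reflectIn γ (a - c • b) = reflectIn γ a - c • reflectIn γ b := by
    intro c a b
    unfold reflectIn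
    simp only [inner_sub_right, real_inner_smul_right]
    module
  conv_lhs => rw [reflectIn]
  rw [inner_reflectIn, inner_reflectIn, ← lin]
  rfl

/-- The reflection as a linear isometry. -/
noncomputable def reflIso (γ : V) : V ≃ₗᵢ[ℝ] V where
  toFun := reflectIn γ
  invFun := reflectIn γ
  left_inv := reflectIn_invol γ
  right_inv := reflectIn_invol γ
  map_add' a b := by
    unfold reflectIn
    simp only [inner_add_right]
    module
  map_smul' c a := by
    unfold reflectIn
    simp only [real_inner_smul_right, RingHom.id_apply]
    module
  norm_map' a := by
    have := inner_reflectIn γ a a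
    rw [real_inner_self_eq_norm_sq, real_inner_self_eq_norm_sq] at this
    exact (sq_eq_sq₀ (norm_nonneg _) (norm_nonneg _)).1 this

lemma reflIso_apply (γ x : V) : reflIso γ x = reflectIn γ x := rfl

lemma smul_of_reflectIn_eq {γ δ : V} (h : ∀ y, reflectIn γ y = reflectIn δ y) :
    ∃ c : ℝ, δ = c • γ := by
  have h1 := h δ
  rw [reflectIn_self] at h1
  unfold reflectIn at h1
  refine ⟨(2 * ⟪γ, δ⟫ / ⟪γ, γ⟫) / 2, ?_⟩
  have : (2 : ℝ) • δ = (2 * ⟪γ, δ⟫ / ⟪γ, γ⟫) • γ := by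
    rw [two_smul]
    have := sub_eq_iff_eq_add.1 h1
    nth_rewrite 1 [this]
    abel
  rw [div_eq_inv_mul, mul_smul, ← this, smul_smul]
  norm_num

variable [FiniteDimensional ℝ V]

lemma mem_plane {α β γ δ : V} (hli : ∀ c : ℝ, β ≠ c • α) (hγ : γ ≠ 0)
    (h : ∀ y, reflectIn γ (reflectIn δ y) = reflectIn β (reflectIn α y)) :
    ∃ i j : ℝ, γ = i • α + j • β := by
  have key : ∀ y, ⟪α, y⟫ = 0 → ⟪β, y⟫ = 0 → ⟪γ, y⟫ = 0 := by
    intro y h1 h2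
    by_contra hne
    have e1 : reflectIn α y = y := by simp [reflectIn, h1]
    have e2 : reflectIn β y = y := by simp [reflectIn, h2]
    have e3 := h y
    rw [e1, e2] at e3
    have e4 : reflectIn δ y = reflectIn γ y := by
      rw [← e3, reflectIn_invol, e3]
    unfold reflectIn at e4
    have e5 : (2 * ⟪δ, y⟫ / ⟪δ, δ⟫) • δ = (2 * ⟪γ, y⟫ / ⟪γ, γ⟫) • γ := sub_right_injective e4
    have hc : 2 * ⟪γ, y⟫ / ⟪γ, γ⟫ ≠ 0 :=
      div_ne_zero (mul_ne_zero two_ne_zero hne) (inner_self_ne_zero.2 hγ)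
    -- then `γ` and `δ` are proportional
    have e6 : γ = ((2 * ⟪γ, y⟫ / ⟪γ, γ⟫)⁻¹ * (2 * ⟪δ, y⟫ / ⟪δ, δ⟫)) • δ := by
      rw [mul_smul, e5, smul_smul, inv_mul_cancel₀ hc, one_smul]
    set k := (2 * ⟪γ, y⟫ / ⟪γ, γ⟫)⁻¹ * (2 * ⟪δ, y⟫ / ⟪δ, δ⟫)
    have hk : k ≠ 0 := by
      rintro hk
      rw [hk, zero_smul] at e6
      exact hγ e6
    have e7 : ∀ z, reflectIn γ z = reflectIn δ z := by
      intro z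
      unfold reflectIn
      rw [e6]
      simp only [real_inner_smul_left, real_inner_smul_right, smul_smul]
      congr 2
      by_cases hd : ⟪δ, δ⟫ = 0
      · rw [hd]; simp
      field_simp
    have e8 : ∀ z, reflectIn α z = reflectIn β z := by
      intro z
      have := h z
      rw [e7, reflectIn_invol] at this
      conv_rhs => rw [this]
      rw [reflectIn_invol]
    obtain ⟨c, hc⟩ := smul_of_reflectIn_eq e8
    exact hli c hc
  have hm : γ ∈ Submodule.span ℝ {α, β} := by
    rw [← Submodule.orthogonal_orthogonal (Submodule.span ℝ {α, β}), Submodule.mem_orthogonal]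
    intro y hy
    rw [Submodule.mem_orthogonal] at hy
    rw [real_inner_comm]
    exact key y (hy α (Submodule.subset_span (by simp))) (hy β (Submodule.subset_span (by simp)))
  obtain ⟨i, j, h⟩ := Submodule.mem_span_pair.1 hm
  exact ⟨i, j, h.symm⟩

/-- The standing hypotheses. -/
structure Sys (R : Finset V) (r : ℝ) (f : V → ℂ → ℂ) : Prop where
  h0 : (0 : V) ∉ R
  hline : ∀ α ∈ R, ∀ c : ℝ, c • α ∈ R → c • α = α ∨ c • α = -α
  hneg : ∀ α ∈ R, -α ∈ R
  hrefl : ∀ α ∈ R, ∀ β ∈ R, reflectIn α β ∈ R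
  hcrys : ∀ α ∈ R, ∀ β ∈ R, ∃ n : ℤ, 2 * ⟪α, β⟫ / ⟪α, α⟫ = (n : ℝ)
  hr : 0 < r
  hmer : ∀ α ∈ R, MeromorphicOn (f α) (ball (0 : ℂ) r)
  hne : ∀ α ∈ R, ∃ z ∈ ball (0 : ℂ) r, AnalyticAt ℂ (f α) z ∧ f α z ≠ 0
  hodd : ∀ α ∈ R, ∀ z ∈ ball (0 : ℂ) r,
      AnalyticAt ℂ (f (-α)) z → AnalyticAt ℂ (f α) (-z) → f (-α) z = -(f α (-z))
  hinv : ∀ α ∈ R, ∀ β ∈ R, f (reflectIn α β) = f β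
  hfe : ∀ w : V ≃ₗᵢ[ℝ] V, ∀ ξ η : V, ∀ x : V,
      (∀ α ∈ R, ((⟪α, x⟫ : ℝ) : ℂ) ∈ ball (0 : ℂ) r ∧
        ∀ β ∈ R, AnalyticAt ℂ (f β) ((⟪α, x⟫ : ℝ) : ℂ)) →
      ∑ p ∈ R ×ˢ R,
        (if (∀ y : V, reflectIn p.1 (reflectIn p.2 y) = w y) then
          (bracket ξ η p.1 p.2 : ℂ) * f p.1 ((⟪p.1, x⟫ : ℝ) : ℂ)
            * f p.2 ((⟪reflectIn p.1 p.2, x⟫ : ℝ) : ℂ)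
        else 0) = 0

/-- Regular points. -/
def Reg (R : Finset V) (r : ℝ) (f : V → ℂ → ℂ) (x : V) : Prop :=
  ∀ α ∈ R, ((⟪α, x⟫ : ℝ) : ℂ) ∈ ball (0 : ℂ) r ∧
        ∀ β ∈ R, AnalyticAt ℂ (f β) ((⟪α, x⟫ : ℝ) : ℂ)

namespace Sys

variable {R : Finset V} {r : ℝ} {f : V → ℂ → ℂ}

lemma ne0 (H : Sys R r f) {α : V} (h : α ∈ R) : α ≠ 0 := by
  rintro rfl; exact H.h0 h

lemma f_neg (H : Sys R r f) {α : V} (h : α ∈ R) : f (-α) = f α := by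
  have := H.hinv α h α h
  rwa [reflectIn_self] at this

lemma odd_at (H : Sys R r f) {β : V} (hβ : β ∈ R) {z : ℂ} (hz : z ∈ ball (0 : ℂ) r)
    (h1 : AnalyticAt ℂ (f β) z) (h2 : AnalyticAt ℂ (f β) (-z)) : f β (-z) = - f β z := by
  have := H.hodd β hβ z hz (by rwa [H.f_neg hβ]) h2
  rw [H.f_neg hβ] at this
  rw [this, neg_neg]

lemma odd_reg (H : Sys R r f) {β γ x : V} (hβ : β ∈ R) (hγ : γ ∈ R) (hx : Reg R r f x) :
    f β ((-⟪γ, x⟫ : ℝ) : ℂ) = - f β ((⟪γ, x⟫ : ℝ) : ℂ) := by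
  have h1 := hx γ hγ
  have h2 := hx (-γ) (H.hneg γ hγ)
  rw [Complex.ofReal_neg]
  refine H.odd_at hβ h1.1 (h1.2 β hβ) ?_
  have := h2.2 β hβ
  rwa [inner_neg_left, Complex.ofReal_neg] at this

lemma mer (H : Sys R r f) {α : V} (h : α ∈ R) : MeromorphicAt (f α) 0 :=
  H.hmer α h 0 (mem_ball_self H.hr)

lemma ev_ne (H : Sys R r f) {α : V} (h : α ∈ R) : ∀ᶠ z in 𝓝[≠] (0 : ℂ), f α z ≠ 0 := by
  obtain ⟨z, hz, han, hne⟩ := H.hne α h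
  have h1 : meromorphicOrderAt (f α) z ≠ ⊤ := by
    rw [Ne, meromorphicOrderAt_eq_top_iff]
    intro h2
    have h3 := (han.continuousAt.eventually_ne hne).filter_mono (nhdsWithin_le_nhds (s := {z}ᶜ))
    obtain ⟨y, hy⟩ := (h2.and h3).exists
    exact hy.2 hy.1
  have h2 := (H.hmer α h).meromorphicOrderAt_ne_top_of_isPreconnected
    (convex_ball (0 : ℂ) r).isPreconnected hz (mem_ball_self H.hr) h1
  rcases (H.mer h).eventually_eq_zero_or_eventually_ne_zero with h3 | h3
  · exact absurd (meromorphicOrderAt_eq_top_iff.2 h3) h2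
  · exact h3

lemma ev_odd (H : Sys R r f) {α : V} (h : α ∈ R) : ∀ᶠ z in 𝓝[≠] (0 : ℂ), f α (-z) = - f α z := by
  obtain ⟨ε, he, hb⟩ := pball (H.mer h).eventually_analyticAt
  rw [eventually_nhdsWithin_iff]
  filter_upwards [ball_mem_nhds (0 : ℂ) he, ball_mem_nhds (0 : ℂ) H.hr] with z hz1 hz2 hz3
  have hz0 : z ≠ 0 := hz3
  have hzn : ‖z‖ < ε := by simpa using hz1
  exact H.odd_at h hz2 (hb z hz0 hzn) (hb (-z) (neg_ne_zero.2 hz0) (by rwa [norm_neg]))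

/-- Evaluation of the functional equation. -/
lemma eqn (H : Sys R r f) {m : ℕ} (g d : Fin m → V) (hg : ∀ i, g i ∈ R) (hd : ∀ i, d i ∈ R)
    (w : V ≃ₗᵢ[ℝ] V) (hw : ∀ i y, reflectIn (g i) (reflectIn (d i) y) = w y)
    (hinj : ∀ i j, i ≠ j → g i ≠ g j ∧ g i ≠ -g j)
    (hall : ∀ γ ∈ R, ∀ δ ∈ R, (∀ y, reflectIn γ (reflectIn δ y) = w y) →
      ∃ i, γ = g i ∨ γ = -g i) (ξ η x : V) (hx : Reg R r f x) :
    ∑ i, (bracket ξ η (g i) (d i) : ℂ) * f (g i) ((⟪g i, x⟫ : ℝ) : ℂ)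
      * f (d i) ((⟪reflectIn (g i) (d i), x⟫ : ℝ) : ℂ) = 0 := by
  have h := H.hfe w ξ η x hx
  rw [← Finset.sum_filter] at h
  set T : V × V → ℂ := fun p => (bracket ξ η p.1 p.2 : ℂ) * f p.1 ((⟪p.1, x⟫ : ℝ) : ℂ)
            * f p.2 ((⟪reflectIn p.1 p.2, x⟫ : ℝ) : ℂ) with hT
  set φ : Fin m × Bool × Bool → V × V :=
    fun q => (if q.2.1 then g q.1 else - g q.1, if q.2.2 then d q.1 else - d q.1) with hφ
  have nn : ∀ v ∈ R, v ≠ -v := by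
    intro v hv hc
    have h2 : (2 : ℝ) • v = 0 := by
      rw [two_smul]; nth_rewrite 1 [hc]; simp
    exact H.ne0 hv ((smul_eq_zero.1 h2).resolve_left two_ne_zero)
  have hinjφ : Function.Injective φ := by
    rintro ⟨i, a, b⟩ ⟨j, a', b'⟩ hq
    simp only [hφ, Prod.mk.injEq] at hq
    obtain ⟨q1, q2⟩ := hq
    have hij : i = j := by
      by_contra hij
      have h1 := hinj i j hij
      cases a <;> cases a' <;> simp at q1
      · exact h1.1 q1
      · exact h1.2 (neg_eq_iff_eq_neg.1 q1)
      · exact h1.2 q1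
      · exact h1.1 q1
    subst hij
    have n1 := nn _ (hg i)
    have n2 := nn _ (hd i)
    have ha : a = a' := by
      cases a <;> cases a' <;> simp at q1
      · rfl
      · exact absurd q1.symm n1
      · exact absurd q1 n1
      · rfl
    have hb : b = b' := by
      cases b <;> cases b' <;> simp at q2
      · rfl
      · exact absurd q2.symm n2
      · exact absurd q2 n2
      · rfl
    rw [ha, hb]
  have hS : (R ×ˢ R).filter (fun p => ∀ y : V, reflectIn p.1 (reflectIn p.2 y) = w y)
      = Finset.univ.image φ := by
    ext ⟨γ, δ⟩
    simp only [Finset.mem_filter, Finset.mem_product, Finset.mem_image, Finset.mem_univ, true_and]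
    constructor
    · rintro ⟨⟨h1, h2⟩, h3⟩
      obtain ⟨i, hi⟩ := hall γ h1 δ h2 h3
      have hγ : ∀ y, reflectIn γ y = reflectIn (g i) y := by
        intro y
        rcases hi with rfl | rfl
        · rfl
        · rw [reflectIn_neg_left]
      have hδ : ∀ y, reflectIn (d i) y = reflectIn δ y := by
        intro y
        have e1 := h3 y
        rw [← hw i y, hγ] at e1
        have e2 := congrArg (reflectIn (g i)) e1
        rwa [reflectIn_invol, reflectIn_invol, eq_comm] at e2
      obtain ⟨c, hc⟩ := smul_of_reflectIn_eq hδ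
      have hδ2 : δ = d i ∨ δ = - d i := by
        rw [hc]
        exact H.hline (d i) (hd i) c (hc ▸ h2)
      rcases hi with h5 | h5 <;> rcases hδ2 with h6 | h6
      · exact ⟨(i, true, true), by simp [hφ, h5, h6]⟩
      · exact ⟨(i, true, false), by simp [hφ, h5, h6]⟩
      · exact ⟨(i, false, true), by simp [hφ, h5, h6]⟩
      · exact ⟨(i, false, false), by simp [hφ, h5, h6]⟩
    · rintro ⟨⟨i, a, b⟩, hq⟩
      simp only [hφ, Prod.mk.injEq] at hq
      obtain ⟨rfl, rfl⟩ := hq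
      have m1 := hg i
      have m2 := hd i
      have m3 := H.hneg _ m1
      have m4 := H.hneg _ m2
      have e := hw i
      have l1 : ∀ y, reflectIn (- g i) y = reflectIn (g i) y := reflectIn_neg_left _
      have l2 : ∀ y, reflectIn (- d i) y = reflectIn (d i) y := reflectIn_neg_left _
      cases a <;> cases b <;> simp [m1, m2, m3, m4, e, l1, l2]
  have t1 : ∀ i, T (- g i, d i) = T (g i, d i) := by
    intro i
    simp only [hT]
    rw [reflectIn_neg_left, H.f_neg (hg i), inner_neg_left, H.odd_reg (hg i) (hg i) hx]
    have : bracket ξ η (-g i) (d i) = - bracket ξ η (g i) (d i) := by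
      simp only [bracket, inner_neg_left]; ring
    rw [this]; push_cast; ring
  have t2 : ∀ v i, v = g i ∨ v = - g i → T (v, - d i) = T (v, d i) := by
    intro v i hv
    have hvR : v ∈ R := by
      rcases hv with rfl | rfl
      · exact hg i
      · exact H.hneg _ (hg i)
    simp only [hT]
    rw [reflectIn_neg_right, H.f_neg (hd i), inner_neg_left,
      H.odd_reg (hd i) (H.hrefl v hvR (d i) (hd i)) hx]
    have : bracket ξ η v (-d i) = - bracket ξ η v (d i) := by
      simp only [bracket, inner_neg_left]; ring
    rw [this]; push_cast; ring
  change ∑ p ∈ (R ×ˢ R).filter _, T p = 0 at h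
  rw [hS, Finset.sum_image (fun a _ b _ hab => hinjφ hab), Fintype.sum_prod_type] at h
  have h4 : ∀ i, ∑ y, T (φ (i, y)) = 4 * T (g i, d i) := by
    intro i
    rw [Fintype.sum_prod_type]
    simp only [Fintype.sum_bool, hφ, if_true, Bool.false_eq_true, if_false]
    rw [t2 _ i (Or.inl rfl), t2 _ i (Or.inr rfl), t1]
    ring
  rw [Finset.sum_congr rfl (fun i _ => h4 i), ← Finset.mul_sum] at h
  exact (mul_eq_zero.1 h).resolve_left (by norm_num)

end Sys
end Roots

section Select
set_option linter.unusedSectionVars false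
open Filter Topology

variable {V : Type*} [NormedAddCommGroup V] [InnerProductSpace ℝ V] [FiniteDimensional ℝ V]

lemma exists_generic_s4 (R : Finset V) (α β : V) : ∃ y : V, ⟪α, y⟫ = 0 ∧ ⟪β, y⟫ = 0 ∧
    ∀ γ ∈ R, (¬ ∃ i j : ℝ, γ = i • α + j • β) → ⟪γ, y⟫ ≠ 0 := by
  set P := Submodule.span ℝ ({α, β} : Set V) with hP
  have hmem : ∀ γ, (¬ ∃ i j : ℝ, γ = i • α + j • β) → γ ∉ P := by
    intro γ h hγ
    obtain ⟨i, j, e⟩ := Submodule.mem_span_pair.1 hγ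
    exact h ⟨i, j, e.symm⟩
  set R' := R.filter (fun γ => ¬ ∃ i j : ℝ, γ = i • α + j • β) with hR'
  have := Module.Dual.exists_forall_mem_ne_zero_of_forall_exists (K := ℝ) (M := V)
    (p := Pᗮ) (f := fun γ : R' => (innerSL ℝ (γ : V)).toLinearMap) (by
      rintro ⟨γ, hγ⟩
      rw [hR', Finset.mem_filter] at hγ
      by_contra hc
      push Not at hc
      apply hmem γ hγ.2
      rw [← Submodule.orthogonal_orthogonal P, Submodule.mem_orthogonal]
      intro y hy
      rw [real_inner_comm]
      exact hc y hy)
  obtain ⟨y, hy, h⟩ := this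
  rw [Submodule.mem_orthogonal] at hy
  refine ⟨y, hy α (Submodule.subset_span (by simp)), hy β (Submodule.subset_span (by simp)), ?_⟩
  intro γ hγ hn
  exact h ⟨γ, by rw [hR', Finset.mem_filter]; exact ⟨hγ, hn⟩⟩

namespace Sys
variable {R : Finset V} {r : ℝ} {f : V → ℂ → ℂ}

lemma select (H : Sys R r f) {α β : V}
    (hD : ⟪α, α⟫ * ⟪β, β⟫ - ⟪α, β⟫ ^ 2 ≠ 0)
    (hpos : ∀ γ ∈ R, ∀ i j : ℝ, γ = i • α + j • β → (0 ≤ i ∧ 0 ≤ j) ∨ (i ≤ 0 ∧ j ≤ 0)) :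
    ∃ ε : ℝ, 0 < ε ∧ ∀ u v : ℝ, 0 < u → 0 < v → u < ε → v < ε →
      ∃ x, ⟪α, x⟫ = u ∧ ⟪β, x⟫ = v ∧ Reg R r f x := by
  -- common radius
  have h1 : ∀ᶠ z in 𝓝[≠] (0 : ℂ), ∀ δ ∈ R, AnalyticAt ℂ (f δ) z := by
    rw [Filter.eventually_all_finset]
    intro δ hδ
    exact (H.mer hδ).eventually_analyticAt
  obtain ⟨ε₀, he₀, hb⟩ := pball h1
  set ρ := min ε₀ r with hρ
  have hρ0 : 0 < ρ := lt_min he₀ H.hr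
  obtain ⟨y, hyα, hyβ, hy⟩ := exists_generic_s4 R α β
  set D := ⟪α, α⟫ * ⟪β, β⟫ - ⟪α, β⟫ ^ 2 with hDdef
  set X : ℝ × ℝ → V := fun p => ((p.1 * ⟪β, β⟫ - p.2 * ⟪α, β⟫) / D) • α
    + ((p.2 * ⟪α, α⟫ - p.1 * ⟪α, β⟫) / D) • β with hX
  have hXc : Continuous X := by
    rw [hX]; fun_prop
  have hXα : ∀ u v, ⟪α, X (u, v)⟫ = u := by
    intro u v
    simp only [hX, inner_add_right, real_inner_smul_right]
    field_simp
    rw [hDdef]; ring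
  have hXβ : ∀ u v, ⟪β, X (u, v)⟫ = v := by
    intro u v
    simp only [hX, inner_add_right, real_inner_smul_right]
    rw [real_inner_comm α β]
    field_simp
    rw [hDdef, real_inner_comm β α]; ring
  have h2 : ∀ᶠ p in 𝓝 ((0, 0) : ℝ × ℝ), ∀ γ ∈ R, |⟪γ, X p⟫| < ρ := by
    rw [Filter.eventually_all_finset]
    intro γ hγ
    have hc : Continuous (fun p => |⟪γ, X p⟫|) := by fun_prop
    have := hc.tendsto (0, 0)
    have e0 : |⟪γ, X (0, 0)⟫| = 0 := by simp [hX]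
    rw [e0] at this
    exact this.eventually_lt_const hρ0
  rw [Metric.eventually_nhds_iff] at h2
  obtain ⟨ε, he, h2⟩ := h2
  refine ⟨ε, he, fun u v hu hv hu1 hv1 => ?_⟩
  have h3 := h2 (y := (u, v)) (by
    rw [Prod.dist_eq, max_lt_iff]
    simp only [dist_zero_right, Real.norm_eq_abs, abs_of_pos hu, abs_of_pos hv]
    exact ⟨hu1, hv1⟩)
  have h4 : ∀ᶠ t in 𝓝[≠] (0 : ℝ), ∀ γ ∈ R,
      |⟪γ, X (u, v) + t • y⟫| < ρ ∧ ⟪γ, X (u, v) + t • y⟫ ≠ 0 := by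
    rw [Filter.eventually_all_finset]
    intro γ hγ
    have hc : Continuous (fun t : ℝ => ⟪γ, X (u, v) + t • y⟫) := by fun_prop
    have ht := hc.tendsto 0
    simp only [zero_smul, add_zero] at ht
    refine Filter.Eventually.and ?_ ?_
    · exact (ht.abs.eventually_lt_const (h3 γ hγ)).filter_mono nhdsWithin_le_nhds
    · by_cases h5 : ⟪γ, X (u, v)⟫ = 0
      · filter_upwards [self_mem_nhdsWithin] with t ht0
        rw [inner_add_right, h5, zero_add, real_inner_smul_right]
        refine mul_ne_zero ht0 (hy γ hγ ?_)
        rintro ⟨i, j, e⟩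
        have e1 : i * u + j * v = 0 := by
          rw [← h5]
          conv_rhs => rw [e]
          rw [inner_add_left, real_inner_smul_left, real_inner_smul_left, hXα, hXβ]
        apply H.ne0 hγ
        rw [e]
        rcases hpos γ hγ i j e with ⟨p1, p2⟩ | ⟨p1, p2⟩
        · have q1 := mul_nonneg p1 hu.le
          have q2 := mul_nonneg p2 hv.le
          have r1 : i * u = 0 := by linarith
          have r2 : j * v = 0 := by linarith
          rw [(mul_eq_zero.1 r1).resolve_right hu.ne', (mul_eq_zero.1 r2).resolve_right hv.ne']
          simp
        · have q1 := mul_nonpos_of_nonpos_of_nonneg p1 hu.le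
          have q2 := mul_nonpos_of_nonpos_of_nonneg p2 hv.le
          have r1 : i * u = 0 := by linarith
          have r2 : j * v = 0 := by linarith
          rw [(mul_eq_zero.1 r1).resolve_right hu.ne', (mul_eq_zero.1 r2).resolve_right hv.ne']
          simp
      · exact (ht.eventually_ne h5).filter_mono nhdsWithin_le_nhds
  obtain ⟨t, ht⟩ := h4.exists
  refine ⟨X (u, v) + t • y, ?_, ?_, ?_⟩
  · rw [inner_add_right, real_inner_smul_right, hyα, hXα]; ring
  · rw [inner_add_right, real_inner_smul_right, hyβ, hXβ]; ring
  · intro γ hγ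
    obtain ⟨q1, q2⟩ := ht γ hγ
    have q3 : ‖((⟪γ, X (u, v) + t • y⟫ : ℝ) : ℂ)‖ < ρ := by
      rwa [Complex.norm_real, Real.norm_eq_abs]
    refine ⟨?_, fun β hβ => hb _ (by exact_mod_cast q2) (lt_of_lt_of_le q3 (min_le_left _ _)) β hβ⟩
    simpa using lt_of_lt_of_le q3 (min_le_right _ _)

end Sys
end Select

section Enum

lemma int_bound {n Q c m : ℤ} (hc0 : 0 < c) (hQ : 0 < Q) (h : n * Q = c * m) (hm : c * m ^ 2 ≤ 4 * Q) :
    -4 ≤ m ∧ m ≤ 4 ∧ True := by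
  have h1 : m ≠ 0 → Q ≤ c * |m| := by
    intro hm0
    have : Q ∣ c * m := ⟨n, by linarith⟩
    have h2 := Int.le_of_dvd (by positivity) ((dvd_abs Q (c * m)).2 this)
    rwa [abs_mul, abs_of_pos hc0] at h2
  by_cases hm0 : m = 0
  · subst hm0; simp
  have h2 := h1 hm0
  have h3 : c * |m| ^ 2 ≤ c * (4 * |m|) := by rw [sq_abs]; linarith
  have h4 : |m| ^ 2 ≤ 4 * |m| := le_of_mul_le_mul_left h3 hc0
  have h5 : 0 < |m| := abs_pos.2 hm0
  have h6 : |m| ≤ 4 := by nlinarith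
  have := abs_le.1 h6
  exact ⟨this.1, this.2, trivial⟩

lemma a2_enum {m1 m2 n1 n2 : ℤ} (hQ : 0 < m1 ^ 2 + m1 * m2 + m2 ^ 2)
    (h1 : n1 * (m1 ^ 2 + m1 * m2 + m2 ^ 2) = 3 * m1)
    (h2 : n2 * (m1 ^ 2 + m1 * m2 + m2 ^ 2) = 3 * m2) :
    m1 * n1 = 3 ∨ m2 * n2 = 3 ∨ 2 * m1 + m2 = 0 ∨ m1 + 2 * m2 = 0 ∨ m1 = m2 := by
  obtain ⟨b1, b2, -⟩ := int_bound (by norm_num) hQ h1 (by nlinarith [sq_nonneg (m1 + 2 * m2)])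
  obtain ⟨b3, b4, -⟩ := int_bound (by norm_num) hQ h2 (by nlinarith [sq_nonneg (2 * m1 + m2)])
  interval_cases m1 <;> interval_cases m2 <;> omega

lemma b2_enum {m1 m2 n1 n2 : ℤ} (hQ : 0 < m1 ^ 2 + 2 * m1 * m2 + 2 * m2 ^ 2)
    (h1 : n1 * (m1 ^ 2 + 2 * m1 * m2 + 2 * m2 ^ 2) = 2 * m1)
    (h2 : n2 * (m1 ^ 2 + 2 * m1 * m2 + 2 * m2 ^ 2) = 4 * m2) :
    m1 + m2 = 0 ∨ m1 + 2 * m2 = 0 ∨ m1 = 0 ∨ m2 = 0 := by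
  obtain ⟨b1, b2, -⟩ := int_bound (by norm_num) hQ h1 (by nlinarith [sq_nonneg (m1 + 2 * m2)])
  obtain ⟨b3, b4, -⟩ := int_bound (by norm_num) hQ h2 (by nlinarith [sq_nonneg (m1 + m2)])
  interval_cases m1 <;> interval_cases m2 <;> omega

lemma g2_enum {m1 m2 n1 n2 : ℤ} (hQ : 0 < m1 ^ 2 + 3 * m1 * m2 + 3 * m2 ^ 2)
    (h1 : n1 * (m1 ^ 2 + 3 * m1 * m2 + 3 * m2 ^ 2) = 1 * m1)
    (h2 : n2 * (m1 ^ 2 + 3 * m1 * m2 + 3 * m2 ^ 2) = 3 * m2) :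
    2 * m1 + 3 * m2 = 0 ∨ m1 + 2 * m2 = 0 ∨ m1 + m2 = 0 ∨ m2 = 0 ∨ m1 + 3 * m2 = 0 ∨ m1 = 0 := by
  obtain ⟨b1, b2, -⟩ := int_bound (by norm_num) hQ h1 (by nlinarith [sq_nonneg (m1 + 2 * m2)])
  obtain ⟨b3, b4, -⟩ := int_bound (by norm_num) hQ h2 (by nlinarith [sq_nonneg (2 * m1 + 3 * m2)])
  interval_cases m1 <;> interval_cases m2 <;> omega

end Enum

section Planes
set_option linter.unusedSectionVars false
open Filter Topology

variable {V : Type*} [NormedAddCommGroup V] [InnerProductSpace ℝ V] [FiniteDimensional ℝ V]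

/-- The vector `p α + q β`. -/
def rho (α β : V) (p q : ℝ) : V := p • α + q • β

lemma rho_left (α β : V) : rho α β 1 0 = α := by simp [rho]
lemma rho_right (α β : V) : rho α β 0 1 = β := by simp [rho]
lemma rho_neg (α β : V) (p q : ℝ) : - rho α β p q = rho α β (-p) (-q) := by
  simp only [rho]; module
lemma rho_smul (α β : V) (c p q : ℝ) : c • rho α β p q = rho α β (c * p) (c * q) := by
  simp only [rho]; module

lemma inner_rho (α β : V) (p q p' q' : ℝ) : ⟪rho α β p q, rho α β p' q'⟫
    = p * p' * ⟪α, α⟫ + (p * q' + q * p') * ⟪α, β⟫ + q * q' * ⟪β, β⟫ := by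
  simp only [rho, inner_add_left, inner_add_right, real_inner_smul_left, real_inner_smul_right]
  rw [real_inner_comm α β]; ring

lemma inner_rho_left (α β x : V) (p q : ℝ) : ⟪rho α β p q, x⟫ = p * ⟪α, x⟫ + q * ⟪β, x⟫ := by
  simp only [rho, inner_add_left, real_inner_smul_left]

lemma bracket_rho (ξ η α β : V) (p q p' q' : ℝ) :
    bracket ξ η (rho α β p q) (rho α β p' q') = (p * q' - q * p') * bracket ξ η α β := by
  simp only [bracket, inner_rho_left]; ring

lemma refl_rho {α β : V} {p q p' q' p'' q'' : ℝ} (c : ℝ) (h0 : rho α β p q ≠ 0)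
    (h : 2 * (p * p' * ⟪α, α⟫ + (p * q' + q * p') * ⟪α, β⟫ + q * q' * ⟪β, β⟫)
      = c * (p * p * ⟪α, α⟫ + (p * q + q * p) * ⟪α, β⟫ + q * q * ⟪β, β⟫))
    (h1 : p' - c * p = p'') (h2 : q' - c * q = q'') :
    reflectIn (rho α β p q) (rho α β p' q') = rho α β p'' q'' := by
  rw [reflectIn_of (c := c) h0 (by rw [inner_rho, inner_rho]; exact h), ← h1, ← h2]
  simp only [rho]; module

lemma rho_inj {α β : V} (hD : ⟪α, α⟫ * ⟪β, β⟫ - ⟪α, β⟫ ^ 2 ≠ 0) {p q p' q' : ℝ}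
    (h : rho α β p q = rho α β p' q') : p = p' ∧ q = q' := by
  have e1 : (p - p') * ⟪α, α⟫ + (q - q') * ⟪α, β⟫ = 0 := by
    have := congrArg (fun z => ⟪z, α⟫) h
    simp only [inner_rho_left] at this
    rw [real_inner_comm α β] at this
    linarith
  have e2 : (p - p') * ⟪α, β⟫ + (q - q') * ⟪β, β⟫ = 0 := by
    have := congrArg (fun z => ⟪z, β⟫) h
    simp only [inner_rho_left] at this
    linarith
  constructor
  · have : (p - p') * (⟪α, α⟫ * ⟪β, β⟫ - ⟪α, β⟫ ^ 2) = 0 := by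
      linear_combination ⟪β, β⟫ * e1 - ⟪α, β⟫ * e2
    linarith [(mul_eq_zero.1 this).resolve_right hD]
  · have : (q - q') * (⟪α, α⟫ * ⟪β, β⟫ - ⟪α, β⟫ ^ 2) = 0 := by
      linear_combination ⟪α, α⟫ * e2 - ⟪α, β⟫ * e1
    linarith [(mul_eq_zero.1 this).resolve_right hD]

lemma rho_indep {α β : V} (hD : ⟪α, α⟫ * ⟪β, β⟫ - ⟪α, β⟫ ^ 2 ≠ 0) (c : ℝ) : β ≠ c • α := by
  rintro rfl
  apply hD
  simp only [real_inner_smul_left, real_inner_smul_right]; ring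

lemma chain_pos {γ δ ε : V} (h : reflectIn γ δ = ε) (y : V) :
    reflectIn ε (reflectIn γ y) = reflectIn γ (reflectIn δ y) := by
  rw [← h, reflectIn_chain]

lemma chain_neg {γ δ ε : V} (h : reflectIn γ δ = - ε) (y : V) :
    reflectIn ε (reflectIn γ y) = reflectIn γ (reflectIn δ y) := by
  rw [← reflectIn_neg_left ε, ← h, reflectIn_chain]

namespace Sys
variable {R : Finset V} {r : ℝ} {f : V → ℂ → ℂ}

lemma plane_eqn (H : Sys R r f) {α β : V}
    (hD : ⟪α, α⟫ * ⟪β, β⟫ - ⟪α, β⟫ ^ 2 ≠ 0) {m : ℕ} (p q p' q' p'' q'' : Fin m → ℝ)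
    (hg : ∀ i, rho α β (p i) (q i) ∈ R) (hd : ∀ i, rho α β (p' i) (q' i) ∈ R)
    (hs : ∀ i, reflectIn (rho α β (p i) (q i)) (rho α β (p' i) (q' i)) = rho α β (p'' i) (q'' i))
    (w : V ≃ₗᵢ[ℝ] V)
    (hw : ∀ i y, reflectIn (rho α β (p i) (q i)) (reflectIn (rho α β (p' i) (q' i)) y) = w y)
    (hinj : ∀ i j, i ≠ j → ¬ (p i = p j ∧ q i = q j) ∧ ¬ (p i = - p j ∧ q i = - q j))
    (hall : ∀ γ ∈ R, ∀ δ ∈ R, (∀ y, reflectIn γ (reflectIn δ y) = w y) →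
      ∃ i, γ = rho α β (p i) (q i) ∨ γ = - rho α β (p i) (q i))
    {x : V} (hx : Reg R r f x) {u v : ℝ} (hu : ⟪α, x⟫ = u) (hv : ⟪β, x⟫ = v) :
    ∑ i, ((p i * q' i - q i * p' i : ℝ) : ℂ) * f (rho α β (p i) (q i)) ((p i * u + q i * v : ℝ) : ℂ)
      * f (rho α β (p' i) (q' i)) ((p'' i * u + q'' i * v : ℝ) : ℂ) = 0 := by
  have h := H.eqn _ _ hg hd w hw (fun i j hij => ⟨fun e => (hinj i j hij).1 (rho_inj hD e),
    fun e => (hinj i j hij).2 (by rw [rho_neg] at e; exact rho_inj hD e)⟩) hall α β x hx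
  simp only [hs, bracket_rho, inner_rho_left, hu, hv] at h
  have hB : bracket α β α β = ⟪α, α⟫ * ⟪β, β⟫ - ⟪α, β⟫ ^ 2 := by
    simp only [bracket]; rw [real_inner_comm α β]; ring
  have hB0 : ((bracket α β α β : ℝ) : ℂ) ≠ 0 := by rw [hB]; exact_mod_cast hD
  refine ((mul_eq_zero (a := ((bracket α β α β : ℝ) : ℂ))).1 ?_).resolve_left hB0
  rw [← h, Finset.mul_sum]
  refine Finset.sum_congr rfl fun i _ => ?_
  push_cast
  ring

lemma cart (H : Sys R r f) {α γ : V} (hα : α ∈ R) (hγ : γ ∈ R) :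
    ∃ m n : ℤ, 2 * ⟪α, γ⟫ = m * ⟪α, α⟫ ∧ 2 * ⟪α, γ⟫ = n * ⟪γ, γ⟫ := by
  obtain ⟨m, hm⟩ := H.hcrys α hα γ hγ
  obtain ⟨n, hn⟩ := H.hcrys γ hγ α hα
  have h1 : ⟪α, α⟫ ≠ 0 := inner_self_ne_zero.2 (H.ne0 hα)
  have h2 : ⟪γ, γ⟫ ≠ 0 := inner_self_ne_zero.2 (H.ne0 hγ)
  refine ⟨m, n, ?_, ?_⟩
  · rw [← hm]; field_simp
  · rw [← hn, real_inner_comm]; field_simp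

lemma pm_of_smul (H : Sys R r f) {α γ : V} (hα : α ∈ R) (hγ : γ ∈ R) (c : ℝ) (h : γ = c • α) :
    γ = α ∨ γ = -α := by
  rw [h]; exact H.hline α hα c (h ▸ hγ)

lemma npos (H : Sys R r f) {α : V} (hα : α ∈ R) : 0 < ⟪α, α⟫ :=
  real_inner_self_pos.2 (H.ne0 hα)

end Sys
end Planes

section Cases
set_option linter.unusedSectionVars false
open Filter Topology

variable {V : Type*} [NormedAddCommGroup V] [InnerProductSpace ℝ V] [FiniteDimensional ℝ V]

namespace Sys
variable {R : Finset V} {r : ℝ} {f : V → ℂ → ℂ}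

lemma b2_list (H : Sys R r f) {α β : V} (hα : α ∈ R) (hβ : β ∈ R)
    (hb : ⟪β, β⟫ = 2 * ⟪α, α⟫) (hc : ⟪α, β⟫ = - ⟪α, α⟫) {γ : V} (hγ : γ ∈ R) {i j : ℝ}
    (h : γ = i • α + j • β) : i = 0 ∨ j = 0 ∨ i = j ∨ i = 2 * j := by
  obtain ⟨m1, n1, h1, h2⟩ := H.cart hα hγ
  obtain ⟨m2, n2, h3, h4⟩ := H.cart hβ hγ
  have ha := H.npos hα
  have hg := H.npos hγ
  have e1 : ⟪α, γ⟫ = (i - j) * ⟪α, α⟫ := by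
    rw [h, inner_add_right, real_inner_smul_right, real_inner_smul_right, hc]; ring
  have e2 : ⟪β, γ⟫ = (-i + 2 * j) * ⟪α, α⟫ := by
    rw [h, inner_add_right, real_inner_smul_right, real_inner_smul_right, hb,
      real_inner_comm, hc]; ring
  have e3 : ⟪γ, γ⟫ = (i ^ 2 - 2 * i * j + 2 * j ^ 2) * ⟪α, α⟫ := by
    conv_lhs => rw [h]
    have := inner_rho α β i j i j
    simp only [rho] at this
    rw [this, hb, hc]; ring
  rw [e1] at h1 h2
  rw [e2] at h3 h4
  rw [hb] at h3
  rw [e3] at h2 h4 hg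
  have k1 : (m1 : ℝ) = 2 * (i - j) := by
    apply mul_right_cancel₀ ha.ne'; linarith
  have k2 : (m2 : ℝ) = -i + 2 * j := by
    apply mul_right_cancel₀ ha.ne'; linarith
  have k3 : (n1 : ℝ) * (i ^ 2 - 2 * i * j + 2 * j ^ 2) = 2 * (i - j) := by
    apply mul_right_cancel₀ ha.ne'; linarith
  have k4 : (n2 : ℝ) * (i ^ 2 - 2 * i * j + 2 * j ^ 2) = 2 * (-i + 2 * j) := by
    apply mul_right_cancel₀ ha.ne'; linarith
  have k5 : 0 < i ^ 2 - 2 * i * j + 2 * j ^ 2 := pos_of_mul_pos_left hg ha.le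
  have k6 : ((m1 : ℝ) ^ 2 + 2 * m1 * m2 + 2 * m2 ^ 2) = 2 * (i ^ 2 - 2 * i * j + 2 * j ^ 2) := by
    rw [k1, k2]; ring
  have := b2_enum (m1 := m1) (m2 := m2) (n1 := n1) (n2 := n2)
    (by
      have : (0 : ℝ) < ((m1 : ℝ) ^ 2 + 2 * m1 * m2 + 2 * m2 ^ 2) := by rw [k6]; linarith
      exact_mod_cast this)
    (by
      have : (n1 : ℝ) * ((m1 : ℝ) ^ 2 + 2 * m1 * m2 + 2 * m2 ^ 2) = 2 * m1 := by
        rw [k6, k1]; linarith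
      exact_mod_cast this)
    (by
      have : (n2 : ℝ) * ((m1 : ℝ) ^ 2 + 2 * m1 * m2 + 2 * m2 ^ 2) = 4 * m2 := by
        rw [k6, k2]; linarith
      exact_mod_cast this)
  rcases this with t | t | t | t
  · left
    have : (m1 : ℝ) + m2 = 0 := by exact_mod_cast t
    linarith
  · right; left
    have : (m1 : ℝ) + 2 * m2 = 0 := by exact_mod_cast t
    linarith
  · right; right; left
    have : (m1 : ℝ) = 0 := by exact_mod_cast t
    linarith
  · right; right; right
    have : (m2 : ℝ) = 0 := by exact_mod_cast t
    linarith

lemma a2_list (H : Sys R r f) {α β : V} (hα : α ∈ R) (hβ : β ∈ R)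
    (hb : ⟪β, β⟫ = ⟪α, α⟫) (hc : 2 * ⟪α, β⟫ = - ⟪α, α⟫)
    (h3α : ∀ γ ∈ R, 4 * ⟪α, γ⟫ ^ 2 ≠ 3 * (⟪α, α⟫ * ⟪γ, γ⟫))
    (h3β : ∀ γ ∈ R, 4 * ⟪β, γ⟫ ^ 2 ≠ 3 * (⟪β, β⟫ * ⟪γ, γ⟫)) {γ : V} (hγ : γ ∈ R) {i j : ℝ}
    (h : γ = i • α + j • β) : i = 0 ∨ j = 0 ∨ i = j := by
  obtain ⟨m1, n1, h1, h2⟩ := H.cart hα hγ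
  obtain ⟨m2, n2, h3, h4⟩ := H.cart hβ hγ
  have ha := H.npos hα
  have hg := H.npos hγ
  have hc' : ⟪α, β⟫ = - ⟪α, α⟫ / 2 := by linarith
  have q1 : m1 * n1 ≠ 3 := by
    intro hh
    apply h3α γ hγ
    have : (m1 : ℝ) * n1 = 3 := by exact_mod_cast hh
    rw [← this]
    linear_combination 2 * ⟪α, γ⟫ * h1 + m1 * ⟪α, α⟫ * h2
  have q2 : m2 * n2 ≠ 3 := by
    intro hh
    apply h3β γ hγ
    have : (m2 : ℝ) * n2 = 3 := by exact_mod_cast hh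
    rw [← this]
    linear_combination 2 * ⟪β, γ⟫ * h3 + m2 * ⟪β, β⟫ * h4
  have e1 : ⟪α, γ⟫ = (i - j / 2) * ⟪α, α⟫ := by
    rw [h, inner_add_right, real_inner_smul_right, real_inner_smul_right, hc']; ring
  have e2 : ⟪β, γ⟫ = (-i / 2 + j) * ⟪α, α⟫ := by
    rw [h, inner_add_right, real_inner_smul_right, real_inner_smul_right, hb,
      real_inner_comm, hc']; ring
  have e3 : ⟪γ, γ⟫ = (i ^ 2 - i * j + j ^ 2) * ⟪α, α⟫ := by
    conv_lhs => rw [h]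
    have := inner_rho α β i j i j
    simp only [rho] at this
    rw [this, hb, hc']; ring
  rw [e1] at h1 h2
  rw [e2] at h3 h4
  rw [hb] at h3
  rw [e3] at h2 h4 hg
  have k1 : (m1 : ℝ) = 2 * i - j := by
    apply mul_right_cancel₀ ha.ne'; linarith
  have k2 : (m2 : ℝ) = -i + 2 * j := by
    apply mul_right_cancel₀ ha.ne'; linarith
  have k3 : (n1 : ℝ) * (i ^ 2 - i * j + j ^ 2) = 2 * i - j := by
    apply mul_right_cancel₀ ha.ne'; linarith
  have k4 : (n2 : ℝ) * (i ^ 2 - i * j + j ^ 2) = -i + 2 * j := by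
    apply mul_right_cancel₀ ha.ne'; linarith
  have k5 : 0 < i ^ 2 - i * j + j ^ 2 := pos_of_mul_pos_left hg ha.le
  have k6 : ((m1 : ℝ) ^ 2 + m1 * m2 + m2 ^ 2) = 3 * (i ^ 2 - i * j + j ^ 2) := by
    rw [k1, k2]; ring
  have := a2_enum (m1 := m1) (m2 := m2) (n1 := n1) (n2 := n2)
    (by
      have : (0 : ℝ) < ((m1 : ℝ) ^ 2 + m1 * m2 + m2 ^ 2) := by rw [k6]; linarith
      exact_mod_cast this)
    (by
      have : (n1 : ℝ) * ((m1 : ℝ) ^ 2 + m1 * m2 + m2 ^ 2) = 3 * m1 := by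
        rw [k6, k1]; linarith
      exact_mod_cast this)
    (by
      have : (n2 : ℝ) * ((m1 : ℝ) ^ 2 + m1 * m2 + m2 ^ 2) = 3 * m2 := by
        rw [k6, k2]; linarith
      exact_mod_cast this)
  rcases this with t | t | t | t | t
  · exact absurd t q1
  · exact absurd t q2
  · left
    have : 2 * (m1 : ℝ) + m2 = 0 := by exact_mod_cast t
    linarith
  · right; left
    have : (m1 : ℝ) + 2 * m2 = 0 := by exact_mod_cast t
    linarith
  · right; right
    have : (m1 : ℝ) = m2 := by exact_mod_cast t
    linarith

lemma g2_list (H : Sys R r f) {α β : V} (hα : α ∈ R) (hβ : β ∈ R)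
    (hb : ⟪β, β⟫ = 3 * ⟪α, α⟫) (hc : 2 * ⟪α, β⟫ = - 3 * ⟪α, α⟫) {γ : V} (hγ : γ ∈ R) {i j : ℝ}
    (h : γ = i • α + j • β) :
    i = 0 ∨ j = 0 ∨ i = j ∨ i = 2 * j ∨ i = 3 * j ∨ 2 * i = 3 * j := by
  obtain ⟨m1, n1, h1, h2⟩ := H.cart hα hγ
  obtain ⟨m2, n2, h3, h4⟩ := H.cart hβ hγ
  have ha := H.npos hα
  have hg := H.npos hγ
  have hc' : ⟪α, β⟫ = - 3 * ⟪α, α⟫ / 2 := by linarith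
  have e1 : ⟪α, γ⟫ = (i - 3 * j / 2) * ⟪α, α⟫ := by
    rw [h, inner_add_right, real_inner_smul_right, real_inner_smul_right, hc']; ring
  have e2 : ⟪β, γ⟫ = (-3 * i / 2 + 3 * j) * ⟪α, α⟫ := by
    rw [h, inner_add_right, real_inner_smul_right, real_inner_smul_right, hb,
      real_inner_comm, hc']; ring
  have e3 : ⟪γ, γ⟫ = (i ^ 2 - 3 * i * j + 3 * j ^ 2) * ⟪α, α⟫ := by
    conv_lhs => rw [h]
    have := inner_rho α β i j i j
    simp only [rho] at this
    rw [this, hb, hc']; ring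
  rw [e1] at h1 h2
  rw [e2] at h3 h4
  rw [hb] at h3
  rw [e3] at h2 h4 hg
  have k1 : (m1 : ℝ) = 2 * i - 3 * j := by
    apply mul_right_cancel₀ ha.ne'; linarith
  have k2 : (m2 : ℝ) = -i + 2 * j := by
    apply mul_right_cancel₀ ha.ne'; linarith
  have k3 : (n1 : ℝ) * (i ^ 2 - 3 * i * j + 3 * j ^ 2) = 2 * i - 3 * j := by
    apply mul_right_cancel₀ ha.ne'; linarith
  have k4 : (n2 : ℝ) * (i ^ 2 - 3 * i * j + 3 * j ^ 2) = 3 * (-i + 2 * j) := by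
    apply mul_right_cancel₀ ha.ne'; linarith
  have k5 : 0 < i ^ 2 - 3 * i * j + 3 * j ^ 2 := pos_of_mul_pos_left hg ha.le
  have k6 : ((m1 : ℝ) ^ 2 + 3 * m1 * m2 + 3 * m2 ^ 2) = i ^ 2 - 3 * i * j + 3 * j ^ 2 := by
    rw [k1, k2]; ring
  have := g2_enum (m1 := m1) (m2 := m2) (n1 := n1) (n2 := n2)
    (by
      have : (0 : ℝ) < ((m1 : ℝ) ^ 2 + 3 * m1 * m2 + 3 * m2 ^ 2) := by rw [k6]; linarith
      exact_mod_cast this)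
    (by
      have : (n1 : ℝ) * ((m1 : ℝ) ^ 2 + 3 * m1 * m2 + 3 * m2 ^ 2) = 1 * m1 := by
        rw [k6, k1]; linarith
      exact_mod_cast this)
    (by
      have : (n2 : ℝ) * ((m1 : ℝ) ^ 2 + 3 * m1 * m2 + 3 * m2 ^ 2) = 3 * m2 := by
        rw [k6, k2]; linarith
      exact_mod_cast this)
  rcases this with t | t | t | t | t | t
  · left
    have : 2 * (m1 : ℝ) + 3 * m2 = 0 := by exact_mod_cast t
    linarith
  · right; left
    have : (m1 : ℝ) + 2 * m2 = 0 := by exact_mod_cast t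
    linarith
  · right; right; left
    have : (m1 : ℝ) + m2 = 0 := by exact_mod_cast t
    linarith
  · right; right; right; left
    have : (m2 : ℝ) = 0 := by exact_mod_cast t
    linarith
  · right; right; right; right; left
    have : (m1 : ℝ) + 3 * m2 = 0 := by exact_mod_cast t
    linarith
  · right; right; right; right; right
    have : (m1 : ℝ) = 0 := by exact_mod_cast t
    linarith

end Sys
end Cases

section Eqns
set_option linter.unusedSectionVars false
open Filter Topology

variable {V : Type*} [NormedAddCommGroup V] [InnerProductSpace ℝ V] [FiniteDimensional ℝ V]

namespace Sys
variable {R : Finset V} {r : ℝ} {f : V → ℂ → ℂ}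

/-- If the coefficient vector is proportional to that of a root, it is that root up to sign. -/
lemma pm_rho (H : Sys R r f) {α β γ : V} {i j p q : ℝ} (c : ℝ) (hρ : rho α β p q ∈ R)
    (hγ : γ ∈ R) (h : γ = i • α + j • β) (hi : i = c * p) (hj : j = c * q) :
    γ = rho α β p q ∨ γ = - rho α β p q := by
  refine H.pm_of_smul hρ hγ c ?_
  rw [rho_smul, h, hi, hj]; rfl

lemma b2_roots (H : Sys R r f) {α β : V} (hα : α ∈ R) (hβ : β ∈ R)
    (hb : ⟪β, β⟫ = 2 * ⟪α, α⟫) (hc : ⟪α, β⟫ = - ⟪α, α⟫) :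
    reflectIn (rho α β 0 1) (rho α β 1 0) = rho α β 1 1 ∧
    reflectIn (rho α β 1 0) (rho α β 0 1) = rho α β 2 1 ∧
    rho α β 1 1 ∈ R ∧ rho α β 2 1 ∈ R ∧ f (rho α β 1 1) = f α ∧ f (rho α β 2 1) = f β := by
  have hα' : rho α β 1 0 ∈ R := by rwa [rho_left]
  have hβ' : rho α β 0 1 ∈ R := by rwa [rho_right]
  have s0 : reflectIn (rho α β 0 1) (rho α β 1 0) = rho α β 1 1 :=
    refl_rho (-1) (H.ne0 hβ') (by rw [hb, hc]; ring) (by norm_num) (by norm_num)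
  have s1 : reflectIn (rho α β 1 0) (rho α β 0 1) = rho α β 2 1 :=
    refl_rho (-2) (H.ne0 hα') (by rw [hb, hc]; ring) (by norm_num) (by norm_num)
  refine ⟨s0, s1, s0 ▸ H.hrefl _ hβ' _ hα', s1 ▸ H.hrefl _ hα' _ hβ', ?_, ?_⟩
  · rw [← s0, H.hinv _ hβ' _ hα', rho_left]
  · rw [← s1, H.hinv _ hα' _ hβ', rho_right]

lemma b2_eqn (H : Sys R r f) {α β : V} (hα : α ∈ R) (hβ : β ∈ R)
    (hb : ⟪β, β⟫ = 2 * ⟪α, α⟫) (hc : ⟪α, β⟫ = - ⟪α, α⟫) :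
    ∃ ε : ℝ, 0 < ε ∧ ∀ x y : ℝ, 0 < x → x < y → y < ε →
      f β (y - x) * (f α y - f α x) + f β (x + y) * (f α x + f α y) = 0 := by
  have ha := H.npos hα
  have hD : ⟪α, α⟫ * ⟪β, β⟫ - ⟪α, β⟫ ^ 2 ≠ 0 := by
    rw [hb, hc]; nlinarith [mul_pos ha ha]
  obtain ⟨s0, s3, hr1, hr2, hf1, hf2⟩ := H.b2_roots hα hβ hb hc
  have hα' : rho α β 1 0 ∈ R := by rwa [rho_left]
  have hβ' : rho α β 0 1 ∈ R := by rwa [rho_right]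
  have s1 : reflectIn (rho α β 1 1) (rho α β 0 1) = rho α β (-2) (-1) :=
    refl_rho 2 (H.ne0 hr1) (by rw [hb, hc]; ring) (by norm_num) (by norm_num)
  have s2 : reflectIn (rho α β 2 1) (rho α β 1 1) = rho α β (-1) 0 :=
    refl_rho 1 (H.ne0 hr2) (by rw [hb, hc]; ring) (by norm_num) (by norm_num)
  have s3 : reflectIn (rho α β 1 0) (rho α β 2 1) = rho α β 0 1 :=
    refl_rho 2 (H.ne0 hα') (by rw [hb, hc]; ring) (by norm_num) (by norm_num)
  obtain ⟨ε, he, hsel⟩ := H.select hD (by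
    intro γ hγ i j h
    rcases H.b2_list hα hβ hb hc hγ h with t | t | t | t
    · rcases le_total 0 j with q | q
      · left; constructor <;> linarith
      · right; constructor <;> linarith
    · rcases le_total 0 i with q | q
      · left; constructor <;> linarith
      · right; constructor <;> linarith
    · rcases le_total 0 j with q | q
      · left; constructor <;> linarith
      · right; constructor <;> linarith
    · rcases le_total 0 j with q | q
      · left; constructor <;> linarith
      · right; constructor <;> linarith)
  refine ⟨ε, he, ?_⟩
  intro u y hu huy hy
  obtain ⟨x, hx1, hx2, hx⟩ := hsel u (y - u) hu (by linarith) (by linarith) (by linarith)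
  have w1 := fun z => chain_pos s0 z
  have w2 := fun z => chain_neg (ε := rho α β 2 1) (by rw [s1, rho_neg]) z
  have w3 := fun z => chain_neg (ε := rho α β 1 0) (by rw [s2, rho_neg]; norm_num) z
  have E := H.plane_eqn hD (m := 4) ![0, 1, 2, 1] ![1, 1, 1, 0] ![1, 0, 1, 2] ![0, 1, 1, 1]
    ![1, -2, -1, 0] ![1, -1, 0, 1]
    (by intro i; fin_cases i <;> simp <;> assumption)
    (by intro i; fin_cases i <;> simp <;> assumption)
    (by intro i; fin_cases i <;> simp <;> assumption)
    ((reflIso (rho α β 1 0)).trans (reflIso (rho α β 0 1)))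
    (by
      intro i z
      change _ = reflectIn (rho α β 0 1) (reflectIn (rho α β 1 0) z)
      fin_cases i
      · rfl
      · exact w1 z
      · exact (w2 z).trans (w1 z)
      · exact (w3 z).trans ((w2 z).trans (w1 z)))
    (by intro i j hij; fin_cases i <;> fin_cases j <;> simp at hij ⊢ <;> norm_num)
    (by
      intro γ hγ δ hδ h
      obtain ⟨i, j, hij⟩ := mem_plane (α := α) (β := β) (rho_indep hD) (H.ne0 hγ)
        (fun z => by
          have := h z
          change _ = reflectIn (rho α β 0 1) (reflectIn (rho α β 1 0) z) at this
          rwa [rho_left, rho_right] at this)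
      rcases H.b2_list hα hβ hb hc hγ hij with t | t | t | t
      · have t' := H.pm_rho j hβ' hγ hij (by linarith) (by linarith)
        exact ⟨0, t'⟩
      · have t' := H.pm_rho i hα' hγ hij (by linarith) (by linarith)
        exact ⟨3, t'⟩
      · have t' := H.pm_rho j hr1 hγ hij (by linarith) (by linarith)
        exact ⟨1, t'⟩
      · have t' := H.pm_rho j hr2 hγ hij (by linarith) (by linarith)
        exact ⟨2, t'⟩)
    hx hx1 hx2
  have o1 := H.odd_reg hα hα' hx
  have o2 := H.odd_reg hβ hr2 hx
  simp only [inner_rho_left, hx1, hx2] at o1 o2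
  simp [Fin.sum_univ_succ, hf1, hf2, rho_left, rho_right] at E o1 o2
  ring_nf at E o1 o2 ⊢
  rw [o2, o1] at E
  linear_combination -E

end Sys
end Eqns

section Eqns2
set_option linter.unusedSectionVars false
open Filter Topology

variable {V : Type*} [NormedAddCommGroup V] [InnerProductSpace ℝ V] [FiniteDimensional ℝ V]

namespace Sys
variable {R : Finset V} {r : ℝ} {f : V → ℂ → ℂ}

/-- The sign condition follows from a nonnegative proportionality. -/
lemma same_sign {i j a b : ℝ} (ha : 0 ≤ a) (hb : 0 ≤ b) (c : ℝ) (hi : i = c * a) (hj : j = c * b) :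
    (0 ≤ i ∧ 0 ≤ j) ∨ (i ≤ 0 ∧ j ≤ 0) := by
  subst hi hj
  rcases le_total 0 c with q | q
  · exact Or.inl ⟨mul_nonneg q ha, mul_nonneg q hb⟩
  · exact Or.inr ⟨mul_nonpos_of_nonpos_of_nonneg q ha, mul_nonpos_of_nonpos_of_nonneg q hb⟩

lemma a2_eqn (H : Sys R r f) {α β : V} (hα : α ∈ R) (hβ : β ∈ R)
    (hb : ⟪β, β⟫ = ⟪α, α⟫) (hc : 2 * ⟪α, β⟫ = - ⟪α, α⟫)
    (h3α : ∀ γ ∈ R, 4 * ⟪α, γ⟫ ^ 2 ≠ 3 * (⟪α, α⟫ * ⟪γ, γ⟫))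
    (h3β : ∀ γ ∈ R, 4 * ⟪β, γ⟫ ^ 2 ≠ 3 * (⟪β, β⟫ * ⟪γ, γ⟫)) :
    ∃ ε : ℝ, 0 < ε ∧ ∀ u v : ℝ, 0 < u → 0 < v → u < ε → v < ε →
      f α v * f α (u + v) + f α (u + v) * f α u - f α u * f α v = 0 := by
  have ha := H.npos hα
  have hc' : ⟪α, β⟫ = - ⟪α, α⟫ / 2 := by linarith
  have hD : ⟪α, α⟫ * ⟪β, β⟫ - ⟪α, β⟫ ^ 2 ≠ 0 := by
    rw [hb, hc']; nlinarith [mul_pos ha ha]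
  have hα' : rho α β 1 0 ∈ R := by rwa [rho_left]
  have hβ' : rho α β 0 1 ∈ R := by rwa [rho_right]
  have s0 : reflectIn (rho α β 0 1) (rho α β 1 0) = rho α β 1 1 :=
    refl_rho (-1) (H.ne0 hβ') (by rw [hb, hc']; ring) (by norm_num) (by norm_num)
  have s0' : reflectIn (rho α β 1 0) (rho α β 0 1) = rho α β 1 1 :=
    refl_rho (-1) (H.ne0 hα') (by rw [hb, hc']; ring) (by norm_num) (by norm_num)
  have hr1 : rho α β 1 1 ∈ R := s0 ▸ H.hrefl _ hβ' _ hα'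
  have s1 : reflectIn (rho α β 1 1) (rho α β 0 1) = rho α β (-1) 0 :=
    refl_rho 1 (H.ne0 hr1) (by rw [hb, hc']; ring) (by norm_num) (by norm_num)
  have s2 : reflectIn (rho α β 1 0) (rho α β 1 1) = rho α β 0 1 :=
    refl_rho 1 (H.ne0 hα') (by rw [hb, hc']; ring) (by norm_num) (by norm_num)
  have hf1 : f (rho α β 1 1) = f α := by rw [← s0, H.hinv _ hβ' _ hα', rho_left]
  have hf2 : f β = f α := by rw [← hf1, ← s0', H.hinv _ hα' _ hβ', rho_right]
  obtain ⟨ε, he, hsel⟩ := H.select hD (by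
    intro γ hγ i j h
    rcases H.a2_list hα hβ hb hc h3α h3β hγ h with t | t | t
    · exact same_sign le_rfl zero_le_one j (by linarith) (by linarith)
    · exact same_sign zero_le_one le_rfl i (by linarith) (by linarith)
    · exact same_sign zero_le_one zero_le_one j (by linarith) (by linarith))
  refine ⟨ε, he, ?_⟩
  intro u v hu hv hue hve
  obtain ⟨x, hx1, hx2, hx⟩ := hsel u v hu hv hue hve
  have w1 := fun z => chain_pos s0 z
  have w2 := fun z => chain_neg (ε := rho α β 1 0) (by rw [s1, rho_neg]; norm_num) z
  have E := H.plane_eqn hD (m := 3) ![0, 1, 1] ![1, 1, 0] ![1, 0, 1] ![0, 1, 1]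
    ![1, -1, 0] ![1, 0, 1]
    (by intro i; fin_cases i <;> simp <;> assumption)
    (by intro i; fin_cases i <;> simp <;> assumption)
    (by intro i; fin_cases i <;> simp <;> assumption)
    ((reflIso (rho α β 1 0)).trans (reflIso (rho α β 0 1)))
    (by
      intro i z
      change _ = reflectIn (rho α β 0 1) (reflectIn (rho α β 1 0) z)
      fin_cases i
      · rfl
      · exact w1 z
      · exact (w2 z).trans (w1 z))
    (by intro i j hij; fin_cases i <;> fin_cases j <;> simp at hij ⊢ <;> norm_num)
    (by
      intro γ hγ δ hδ h
      obtain ⟨i, j, hij⟩ := mem_plane (α := α) (β := β) (rho_indep hD) (H.ne0 hγ)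
        (fun z => by
          have := h z
          change _ = reflectIn (rho α β 0 1) (reflectIn (rho α β 1 0) z) at this
          rwa [rho_left, rho_right] at this)
      rcases H.a2_list hα hβ hb hc h3α h3β hγ hij with t | t | t
      · have t' := H.pm_rho j hβ' hγ hij (by linarith) (by linarith)
        exact ⟨0, t'⟩
      · have t' := H.pm_rho i hα' hγ hij (by linarith) (by linarith)
        exact ⟨2, t'⟩
      · have t' := H.pm_rho j hr1 hγ hij (by linarith) (by linarith)
        exact ⟨1, t'⟩)
    hx hx1 hx2
  have o1 := H.odd_reg hα hα' hx
  simp only [inner_rho_left, hx1, hx2] at o1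
  simp [Fin.sum_univ_succ, hf1, hf2, rho_left, rho_right] at E o1
  rw [o1] at E
  linear_combination -E

lemma g2_eqn (H : Sys R r f) {α β : V} (hα : α ∈ R) (hβ : β ∈ R)
    (hb : ⟪β, β⟫ = 3 * ⟪α, α⟫) (hc : 2 * ⟪α, β⟫ = -3 * ⟪α, α⟫) :
    ∃ ε : ℝ, 0 < ε ∧ ∀ x y : ℝ, 0 < y → y < x → x < ε →
      (f β (x - y) * (f α x - f α y) + f β (2 * x + y) * (f α x + f α (x + y))
        + f β (x + 2 * y) * (f α (x + y) + f α y) = 0) ∧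
      (f α x * f α y - f α (x + y) * (f α x + f α y)
        + 3 * (f β (x - y) * f β (x + 2 * y)
          - f β (2 * x + y) * (f β (x - y) + f β (x + 2 * y))) = 0) := by
  have ha := H.npos hα
  have hc' : ⟪α, β⟫ = - 3 * ⟪α, α⟫ / 2 := by linarith
  have hD : ⟪α, α⟫ * ⟪β, β⟫ - ⟪α, β⟫ ^ 2 ≠ 0 := by
    rw [hb, hc']; nlinarith [mul_pos ha ha]
  have r10 : rho α β 1 0 ∈ R := by rwa [rho_left]
  have r01 : rho α β 0 1 ∈ R := by rwa [rho_right]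
  have a1 : reflectIn (rho α β 0 1) (rho α β 1 0) = rho α β 1 1 :=
    refl_rho (-1) (H.ne0 r01) (by rw [hb, hc']; ring) (by norm_num) (by norm_num)
  have r11 : rho α β 1 1 ∈ R := a1 ▸ H.hrefl _ r01 _ r10
  have a2 : reflectIn (rho α β 1 0) (rho α β 1 1) = rho α β 2 1 :=
    refl_rho (-1) (H.ne0 r10) (by rw [hb, hc']; ring) (by norm_num) (by norm_num)
  have r21 : rho α β 2 1 ∈ R := a2 ▸ H.hrefl _ r10 _ r11
  have a3 : reflectIn (rho α β 1 0) (rho α β 0 1) = rho α β 3 1 :=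
    refl_rho (-3) (H.ne0 r10) (by rw [hb, hc']; ring) (by norm_num) (by norm_num)
  have r31 : rho α β 3 1 ∈ R := a3 ▸ H.hrefl _ r10 _ r01
  have a4 : reflectIn (rho α β 0 1) (rho α β 3 1) = rho α β 3 2 :=
    refl_rho (-1) (H.ne0 r01) (by rw [hb, hc']; ring) (by norm_num) (by norm_num)
  have r32 : rho α β 3 2 ∈ R := a4 ▸ H.hrefl _ r01 _ r31
  have f11 : f (rho α β 1 1) = f α := by rw [← a1, H.hinv _ r01 _ r10, rho_left]
  have f21 : f (rho α β 2 1) = f α := by rw [← a2, H.hinv _ r10 _ r11, f11]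
  have f31 : f (rho α β 3 1) = f β := by rw [← a3, H.hinv _ r10 _ r01, rho_right]
  have f32 : f (rho α β 3 2) = f β := by rw [← a4, H.hinv _ r01 _ r31, f31]
  -- first family of images
  have s1 : reflectIn (rho α β 1 1) (rho α β 0 1) = rho α β (-3) (-2) :=
    refl_rho 3 (H.ne0 r11) (by rw [hb, hc']; ring) (by norm_num) (by norm_num)
  have s2 : reflectIn (rho α β 3 2) (rho α β 1 1) = rho α β (-2) (-1) :=
    refl_rho 1 (H.ne0 r32) (by rw [hb, hc']; ring) (by norm_num) (by norm_num)
  have s3 : reflectIn (rho α β 2 1) (rho α β 3 2) = rho α β (-3) (-1) :=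
    refl_rho 3 (H.ne0 r21) (by rw [hb, hc']; ring) (by norm_num) (by norm_num)
  have s4 : reflectIn (rho α β 3 1) (rho α β 2 1) = rho α β (-1) 0 :=
    refl_rho 1 (H.ne0 r31) (by rw [hb, hc']; ring) (by norm_num) (by norm_num)
  have s5 : reflectIn (rho α β 1 0) (rho α β 3 1) = rho α β 0 1 :=
    refl_rho 3 (H.ne0 r10) (by rw [hb, hc']; ring) (by norm_num) (by norm_num)
  -- second family of images
  have t0 : reflectIn (rho α β 1 1) (rho α β 1 0) = rho α β 2 1 :=
    refl_rho (-1) (H.ne0 r11) (by rw [hb, hc']; ring) (by norm_num) (by norm_num)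
  have t1 : reflectIn (rho α β 3 2) (rho α β 0 1) = rho α β (-3) (-1) :=
    refl_rho 1 (H.ne0 r32) (by rw [hb, hc']; ring) (by norm_num) (by norm_num)
  have t2 : reflectIn (rho α β 2 1) (rho α β 1 1) = rho α β (-1) 0 :=
    refl_rho 1 (H.ne0 r21) (by rw [hb, hc']; ring) (by norm_num) (by norm_num)
  have t3 : reflectIn (rho α β 3 1) (rho α β 3 2) = rho α β 0 1 :=
    refl_rho 1 (H.ne0 r31) (by rw [hb, hc']; ring) (by norm_num) (by norm_num)
  have t4 : reflectIn (rho α β 1 0) (rho α β 2 1) = rho α β 1 1 :=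
    refl_rho 1 (H.ne0 r10) (by rw [hb, hc']; ring) (by norm_num) (by norm_num)
  have t5 : reflectIn (rho α β 0 1) (rho α β 3 1) = rho α β 3 2 := a4
  obtain ⟨ε, he, hsel⟩ := H.select hD (by
    intro γ hγ i j h
    rcases H.g2_list hα hβ hb hc hγ h with t | t | t | t | t | t
    · exact same_sign le_rfl zero_le_one j (by linarith) (by linarith)
    · exact same_sign zero_le_one le_rfl i (by linarith) (by linarith)
    · exact same_sign zero_le_one zero_le_one j (by linarith) (by linarith)
    · exact same_sign (a := 2) (by norm_num) zero_le_one j (by linarith) (by linarith)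
    · exact same_sign (a := 3) (by norm_num) zero_le_one j (by linarith) (by linarith)
    · exact same_sign (a := 3) (b := 2) (by norm_num) (by norm_num) (j / 2)
        (by linarith) (by linarith))
  refine ⟨ε, he, ?_⟩
  intro X y hy hyX hX
  obtain ⟨x, hx1, hx2, hx⟩ := hsel y (X - y) hy (by linarith) (by linarith) (by linarith)
  have w1 := fun z => chain_pos a1 z
  have w2 := fun z => chain_neg (ε := rho α β 3 2) (by rw [s1, rho_neg]) z
  have w3 := fun z => chain_neg (ε := rho α β 2 1) (by rw [s2, rho_neg]) z
  have w4 := fun z => chain_neg (ε := rho α β 3 1) (by rw [s3, rho_neg]) z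
  have w5 := fun z => chain_neg (ε := rho α β 1 0) (by rw [s4, rho_neg]; norm_num) z
  have w6 := fun z => chain_pos s5 z
  -- all six consecutive products agree
  have q1 : ∀ z, reflectIn (rho α β 1 1) (reflectIn (rho α β 0 1) z)
      = reflectIn (rho α β 0 1) (reflectIn (rho α β 1 0) z) := w1
  have q2 : ∀ z, reflectIn (rho α β 3 2) (reflectIn (rho α β 1 1) z)
      = reflectIn (rho α β 0 1) (reflectIn (rho α β 1 0) z) := fun z => (w2 z).trans (q1 z)
  have q3 : ∀ z, reflectIn (rho α β 2 1) (reflectIn (rho α β 3 2) z)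
      = reflectIn (rho α β 0 1) (reflectIn (rho α β 1 0) z) := fun z => (w3 z).trans (q2 z)
  have q4 : ∀ z, reflectIn (rho α β 3 1) (reflectIn (rho α β 2 1) z)
      = reflectIn (rho α β 0 1) (reflectIn (rho α β 1 0) z) := fun z => (w4 z).trans (q3 z)
  have q5 : ∀ z, reflectIn (rho α β 1 0) (reflectIn (rho α β 3 1) z)
      = reflectIn (rho α β 0 1) (reflectIn (rho α β 1 0) z) := fun z => (w5 z).trans (q4 z)
  have comb : ∀ {g d e : V},
      (∀ z, reflectIn g (reflectIn d z) = reflectIn (rho α β 0 1) (reflectIn (rho α β 1 0) z)) →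
      (∀ z, reflectIn d (reflectIn e z) = reflectIn (rho α β 0 1) (reflectIn (rho α β 1 0) z)) →
      ∀ z, reflectIn g (reflectIn e z) = reflectIn (rho α β 0 1) (reflectIn (rho α β 1 0)
        (reflectIn (rho α β 0 1) (reflectIn (rho α β 1 0) z))) := by
    intro g d e h1 h2 z
    rw [← h2 z, ← h1, reflectIn_invol]
  have c0 := comb q1 (fun z => rfl)
  have E1 := H.plane_eqn hD (m := 6) ![0, 1, 3, 2, 3, 1] ![1, 1, 2, 1, 1, 0]
    ![1, 0, 1, 3, 2, 3] ![0, 1, 1, 2, 1, 1]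
    ![1, -3, -2, -3, -1, 0] ![1, -2, -1, -1, 0, 1]
    (by intro i; fin_cases i <;> simp <;> assumption)
    (by intro i; fin_cases i <;> simp <;> assumption)
    (by intro i; fin_cases i <;> simp <;> assumption)
    ((reflIso (rho α β 1 0)).trans (reflIso (rho α β 0 1)))
    (by
      intro i z
      change _ = reflectIn (rho α β 0 1) (reflectIn (rho α β 1 0) z)
      fin_cases i
      · rfl
      · exact q1 z
      · exact q2 z
      · exact q3 z
      · exact q4 z
      · exact q5 z)
    (by intro i j hij; fin_cases i <;> fin_cases j <;> simp at hij ⊢ <;> norm_num)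
    (by
      intro γ hγ δ hδ h
      obtain ⟨i, j, hij⟩ := mem_plane (α := α) (β := β) (rho_indep hD) (H.ne0 hγ)
        (fun z => by
          have := h z
          change _ = reflectIn (rho α β 0 1) (reflectIn (rho α β 1 0) z) at this
          rwa [rho_left, rho_right] at this)
      rcases H.g2_list hα hβ hb hc hγ hij with t | t | t | t | t | t
      · have t' := H.pm_rho j r01 hγ hij (by linarith) (by linarith)
        exact ⟨0, t'⟩
      · have t' := H.pm_rho i r10 hγ hij (by linarith) (by linarith)
        exact ⟨5, t'⟩
      · have t' := H.pm_rho j r11 hγ hij (by linarith) (by linarith)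
        exact ⟨1, t'⟩
      · have t' := H.pm_rho j r21 hγ hij (by linarith) (by linarith)
        exact ⟨3, t'⟩
      · have t' := H.pm_rho j r31 hγ hij (by linarith) (by linarith)
        exact ⟨4, t'⟩
      · have t' := H.pm_rho (j / 2) r32 hγ hij (by linarith) (by linarith)
        exact ⟨2, t'⟩)
    hx hx1 hx2
  have E2 := H.plane_eqn hD (m := 6) ![1, 3, 2, 3, 1, 0] ![1, 2, 1, 1, 0, 1]
    ![1, 0, 1, 3, 2, 3] ![0, 1, 1, 2, 1, 1]
    ![2, -3, -1, 0, 1, 3] ![1, -1, 0, 1, 1, 2]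
    (by intro i; fin_cases i <;> simp <;> assumption)
    (by intro i; fin_cases i <;> simp <;> assumption)
    (by intro i; fin_cases i <;> simp <;> assumption)
    ((reflIso (rho α β 1 0)).trans (reflIso (rho α β 1 1)))
    (by
      intro i z
      change _ = reflectIn (rho α β 1 1) (reflectIn (rho α β 1 0) z)
      rw [c0]
      fin_cases i
      · exact c0 z
      · exact comb q2 q1 z
      · exact comb q3 q2 z
      · exact comb q4 q3 z
      · exact comb q5 q4 z
      · exact comb (fun z => rfl) q5 z)
    (by intro i j hij; fin_cases i <;> fin_cases j <;> simp at hij ⊢ <;> norm_num)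
    (by
      intro γ hγ δ hδ h
      obtain ⟨i', j, hij⟩ := mem_plane (α := α) (β := rho α β 1 1)
        (by
          intro c hcc
          have : rho α β 1 1 = rho α β c 0 := by rw [hcc]; simp [rho]
          have := (rho_inj hD this).2
          norm_num at this) (H.ne0 hγ)
        (fun z => by
          have := h z
          change _ = reflectIn (rho α β 1 1) (reflectIn (rho α β 1 0) z) at this
          rwa [rho_left] at this)
      obtain ⟨i, hi⟩ : ∃ i, i = i' + j := ⟨_, rfl⟩
      have hij : γ = i • α + j • β := by rw [hij, hi]; unfold rho; module
      rcases H.g2_list hα hβ hb hc hγ hij with t | t | t | t | t | t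
      · have t' := H.pm_rho j r01 hγ hij (by linarith) (by linarith)
        exact ⟨5, t'⟩
      · have t' := H.pm_rho i r10 hγ hij (by linarith) (by linarith)
        exact ⟨4, t'⟩
      · have t' := H.pm_rho j r11 hγ hij (by linarith) (by linarith)
        exact ⟨0, t'⟩
      · have t' := H.pm_rho j r21 hγ hij (by linarith) (by linarith)
        exact ⟨2, t'⟩
      · have t' := H.pm_rho j r31 hγ hij (by linarith) (by linarith)
        exact ⟨3, t'⟩
      · have t' := H.pm_rho (j / 2) r32 hγ hij (by linarith) (by linarith)
        exact ⟨1, t'⟩)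
    hx hx1 hx2
  have o1 := H.odd_reg hα r10 hx
  have o2 := H.odd_reg hα r21 hx
  have o3 := H.odd_reg hβ r31 hx
  have o4 := H.odd_reg hβ r32 hx
  simp only [inner_rho_left, hx1, hx2] at o1 o2 o3 o4
  simp [Fin.sum_univ_succ, f11, f21, f31, f32, rho_left, rho_right] at E1 E2 o1 o2 o3 o4
  constructor
  · ring_nf at E1 o1 o2 o3 o4 ⊢
    rw [o1, o2, o3, o4] at E1
    linear_combination -E1
  · ring_nf at E2 o1 o2 o3 o4 ⊢
    rw [o1, o3] at E2
    linear_combination E2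

end Sys
end Eqns2

section Global
set_option linter.unusedSectionVars false
open Filter Topology

variable {V : Type*} [NormedAddCommGroup V] [InnerProductSpace ℝ V] [FiniteDimensional ℝ V]

namespace Sys
variable {R : Finset V} {r : ℝ} {f : V → ℂ → ℂ}

lemma prop_of_cs (H : Sys R r f) {α γ : V} (hα : α ∈ R) (hγ : γ ∈ R)
    (h : ⟪α, γ⟫ ^ 2 = ⟪α, α⟫ * ⟪γ, γ⟫) : γ = α ∨ γ = -α := by
  have ha := H.npos hα
  have h0 : ⟪α, α⟫ • γ - ⟪α, γ⟫ • α = 0 := by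
    rw [← inner_self_eq_zero (𝕜 := ℝ)]
    simp only [inner_sub_left, inner_sub_right, real_inner_smul_left, real_inner_smul_right]
    rw [real_inner_comm α γ]
    linear_combination - ⟪α, α⟫ * h
  refine H.pm_of_smul hα hγ (⟪α, α⟫⁻¹ * ⟪α, γ⟫) ?_
  rw [mul_smul, ← sub_eq_zero.1 h0, smul_smul, inv_mul_cancel₀ ha.ne', one_smul]

lemma neg_cases (H : Sys R r f) {α γ : V} (hα : α ∈ R) (hγ : γ ∈ R) (h : ⟪α, γ⟫ < 0) :
    γ = -α ∨ (⟪γ, γ⟫ = ⟪α, α⟫ ∧ 2 * ⟪α, γ⟫ = - ⟪α, α⟫) ∨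
      (⟪γ, γ⟫ = 2 * ⟪α, α⟫ ∧ ⟪α, γ⟫ = - ⟪α, α⟫) ∨
      (⟪α, α⟫ = 2 * ⟪γ, γ⟫ ∧ ⟪γ, α⟫ = - ⟪γ, γ⟫) ∨
      (⟪γ, γ⟫ = 3 * ⟪α, α⟫ ∧ 2 * ⟪α, γ⟫ = -3 * ⟪α, α⟫) ∨
      (⟪α, α⟫ = 3 * ⟪γ, γ⟫ ∧ 2 * ⟪γ, α⟫ = -3 * ⟪γ, γ⟫) := by
  have ha := H.npos hα
  have hc := H.npos hγ
  have cs : ⟪α, γ⟫ ^ 2 ≤ ⟪α, α⟫ * ⟪γ, γ⟫ := by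
    have := real_inner_mul_inner_self_le α γ
    rwa [← sq] at this
  have hpar := H.prop_of_cs hα hγ
  have hnot : γ ≠ α := by rintro rfl; linarith
  obtain ⟨m, n, hm, hn⟩ := H.cart hα hγ
  rw [real_inner_comm α γ]
  generalize ⟪α, α⟫ = a at *
  generalize ⟪γ, γ⟫ = c at *
  generalize ⟪α, γ⟫ = p at *
  have hm0 : m < 0 := by
    by_contra hh
    have : (0 : ℝ) ≤ m := by exact_mod_cast not_lt.1 hh
    nlinarith [mul_nonneg this ha.le]
  have hn0 : n < 0 := by
    by_contra hh
    have : (0 : ℝ) ≤ n := by exact_mod_cast not_lt.1 hh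
    nlinarith [mul_nonneg this hc.le]
  have hmn : m * n ≤ 4 := by
    have e : (m * n : ℝ) * (a * c) ≤ 4 * (a * c) := by
      have : (m * n : ℝ) * (a * c) = (2 * p) * (2 * p) := by
        conv_rhs => rw [hm]
        rw [← hm, hn]
        nlinarith
      nlinarith
    have := le_of_mul_le_mul_right e (mul_pos ha hc)
    exact_mod_cast this
  have hm4 : -4 ≤ m := by nlinarith
  have hn4 : -4 ≤ n := by nlinarith
  interval_cases m <;> interval_cases n <;> first
    | (exfalso; revert hmn; norm_num; done)
    | (push_cast at hm hn
       first
        | (left; exact (hpar (by nlinarith)).resolve_left hnot)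
        | (right; left; constructor <;> linarith)
        | (right; right; left; constructor <;> linarith)
        | (right; right; right; left; constructor <;> linarith)
        | (right; right; right; right; left; constructor <;> linarith)
        | (right; right; right; right; right; constructor <;> linarith))

lemma good_G (H : Sys R r f) {α β : V} (hα : α ∈ R) (hβ : β ∈ R)
    (hb : ⟪β, β⟫ = 3 * ⟪α, α⟫) (hc : 2 * ⟪α, β⟫ = -3 * ⟪α, α⟫) :
    GoodFn (f α) ∧ GoodFn (f β) :=
  g2_good (H.mer hα) (H.mer hβ) (H.ev_ne hα) (H.ev_ne hβ) (H.ev_odd hα) (H.ev_odd hβ)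
    (H.g2_eqn hα hβ hb hc)

lemma good_B (H : Sys R r f) {α β : V} (hα : α ∈ R) (hβ : β ∈ R)
    (hb : ⟪β, β⟫ = 2 * ⟪α, α⟫) (hc : ⟪α, β⟫ = - ⟪α, α⟫) :
    GoodFn (f α) ↔ GoodFn (f β) :=
  ⟨fun h => b2_long h (H.mer hβ) (H.ev_ne hα) (H.b2_eqn hα hβ hb hc),
   fun h => b2_short (H.mer hα) h (H.ev_ne hβ) (H.b2_eqn hα hβ hb hc)⟩

lemma good_three (H : Sys R r f) {α γ : V} (hα : α ∈ R) (hγ : γ ∈ R)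
    (h : 4 * ⟪α, γ⟫ ^ 2 = 3 * (⟪α, α⟫ * ⟪γ, γ⟫)) : GoodFn (f α) := by
  have ha := H.npos hα
  wlog hlt : ⟪α, γ⟫ < 0 generalizing γ
  · have hne : ⟪α, γ⟫ ≠ 0 := by
      intro h0
      have := mul_pos ha (H.npos hγ)
      rw [h0] at h; linarith
    refine this (γ := -γ) (H.hneg γ hγ) ?_ ?_
    · simp only [inner_neg_left, inner_neg_right]; linarith
    · rw [inner_neg_right]
      have := lt_of_le_of_ne (not_lt.1 hlt) hne.symm
      linarith
  have hc := H.npos hγ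
  have hsq := mul_pos ha ha
  have hsq' := mul_pos hc hc
  rcases H.neg_cases hα hγ hlt with t | ⟨t1, t2⟩ | ⟨t1, t2⟩ | ⟨t1, t2⟩ | ⟨t1, t2⟩ | ⟨t1, t2⟩
  · rw [t] at h
    simp only [inner_neg_left, inner_neg_right] at h
    nlinarith
  · have : ⟪α, γ⟫ = - ⟪α, α⟫ / 2 := by linarith
    rw [t1, this] at h; nlinarith
  · rw [t1, t2] at h; nlinarith
  · rw [real_inner_comm, t2, t1] at h; nlinarith
  · exact (H.good_G hα hγ t1 t2).1
  · exact (H.good_G hγ hα t1 t2).2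

lemma eq_A (H : Sys R r f) {α β : V} (hα : α ∈ R) (hβ : β ∈ R)
    (hb : ⟪β, β⟫ = ⟪α, α⟫) (hc : 2 * ⟪α, β⟫ = - ⟪α, α⟫) : f β = f α := by
  have e1 : reflectIn β α = α - (-1 : ℝ) • β :=
    reflectIn_of (H.ne0 hβ) (by rw [real_inner_comm, hc, hb]; ring)
  have e2 : reflectIn α β = β - (-1 : ℝ) • α :=
    reflectIn_of (H.ne0 hα) (by rw [hc]; ring)
  rw [← H.hinv β hβ α hα, ← H.hinv α hα β hβ, e1, e2]
  congr 1
  module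

lemma good_A (H : Sys R r f) {α β : V} (hα : α ∈ R) (hβ : β ∈ R)
    (hb : ⟪β, β⟫ = ⟪α, α⟫) (hc : 2 * ⟪α, β⟫ = - ⟪α, α⟫) : GoodFn (f α) := by
  by_cases h3α : ∀ γ ∈ R, 4 * ⟪α, γ⟫ ^ 2 ≠ 3 * (⟪α, α⟫ * ⟪γ, γ⟫)
  · by_cases h3β : ∀ γ ∈ R, 4 * ⟪β, γ⟫ ^ 2 ≠ 3 * (⟪β, β⟫ * ⟪γ, γ⟫)
    · exact a2_good (H.mer hα) (H.ev_ne hα) (H.a2_eqn hα hβ hb hc h3α h3β)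
    · push Not at h3β
      obtain ⟨γ, hγ, h⟩ := h3β
      rw [← H.eq_A hα hβ hb hc]
      exact H.good_three hβ hγ h
  · push Not at h3α
    obtain ⟨γ, hγ, h⟩ := h3α
    exact H.good_three hα hγ h

lemma good_trans (H : Sys R r f) {α γ : V} (hα : α ∈ R) (hγ : γ ∈ R) (hne : ⟪α, γ⟫ ≠ 0)
    (hg : GoodFn (f α)) : GoodFn (f γ) := by
  wlog hlt : ⟪α, γ⟫ < 0 generalizing γ
  · rw [← H.f_neg hγ]
    refine this (γ := -γ) (H.hneg γ hγ) ?_ ?_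
    · rw [inner_neg_right]; exact neg_ne_zero.2 hne
    · rw [inner_neg_right]
      have := lt_of_le_of_ne (not_lt.1 hlt) hne.symm
      linarith
  rcases H.neg_cases hα hγ hlt with t | ⟨t1, t2⟩ | ⟨t1, t2⟩ | ⟨t1, t2⟩ | ⟨t1, t2⟩ | ⟨t1, t2⟩
  · rwa [t, H.f_neg hα]
  · rwa [H.eq_A hα hγ t1 t2]
  · exact (H.good_B hα hγ t1 t2).1 hg
  · exact (H.good_B hγ hα t1 t2).2 hg
  · exact (H.good_G hα hγ t1 t2).2
  · exact (H.good_G hγ hα t1 t2).1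

lemma bad_neg (H : Sys R r f) {α γ : V} (hα : α ∈ R) (hγ : γ ∈ R) (hlt : ⟪α, γ⟫ < 0)
    (hbad : ¬ GoodFn (f α)) : γ = -α ∨ (⟪γ, γ⟫ = 2 * ⟪α, α⟫ ∧ ⟪α, γ⟫ = - ⟪α, α⟫) ∨
      (⟪α, α⟫ = 2 * ⟪γ, γ⟫ ∧ ⟪γ, α⟫ = - ⟪γ, γ⟫) := by
  rcases H.neg_cases hα hγ hlt with t | ⟨t1, t2⟩ | t | t | ⟨t1, t2⟩ | ⟨t1, t2⟩
  · exact Or.inl t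
  · exact absurd (H.good_A hα hγ t1 t2) hbad
  · exact Or.inr (Or.inl t)
  · exact Or.inr (Or.inr t)
  · exact absurd (H.good_G hα hγ t1 t2).1 hbad
  · exact absurd (H.good_G hγ hα t1 t2).2 hbad

lemma bad_pair (H : Sys R r f) {α γ : V} (hα : α ∈ R) (hγ : γ ∈ R) (hne : ⟪α, γ⟫ ≠ 0)
    (hbad : ¬ GoodFn (f α)) :
    (γ = α ∨ γ = -α) ∨ ⟪γ, γ⟫ = 2 * ⟪α, α⟫ ∨ ⟪α, α⟫ = 2 * ⟪γ, γ⟫ := by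
  rcases lt_or_gt_of_ne hne with h | h
  · rcases H.bad_neg hα hγ h hbad with t | t | t
    · exact Or.inl (Or.inr t)
    · exact Or.inr (Or.inl t.1)
    · exact Or.inr (Or.inr t.1)
  · rcases H.bad_neg hα (H.hneg γ hγ) (by rw [inner_neg_right]; linarith) hbad with t | t | t
    · exact Or.inl (Or.inl (neg_injective t))
    · have := t.1
      simp only [inner_neg_left, inner_neg_right, neg_neg] at this
      exact Or.inr (Or.inl this)
    · have := t.1
      simp only [inner_neg_left, inner_neg_right, neg_neg] at this
      exact Or.inr (Or.inr this)

/-- In the absence of good roots there is a pair of type `B₂`. -/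
lemma exists_B (H : Sys R r f) (hdim : 2 ≤ Module.finrank ℝ V)
    (hirr : ¬ ∃ R₁ R₂ : Finset V, R₁.Nonempty ∧ R₂.Nonempty ∧ Disjoint R₁ R₂ ∧
      R = R₁ ∪ R₂ ∧ ∀ α ∈ R₁, ∀ β ∈ R₂, ⟪α, β⟫ = 0)
    (hspan : Submodule.span ℝ (R : Set V) = ⊤) (hbad : ∀ α ∈ R, ¬ GoodFn (f α)) :
    ∃ α ∈ R, ∃ β ∈ R, ⟪β, β⟫ = 2 * ⟪α, α⟫ ∧ ⟪α, β⟫ = - ⟪α, α⟫ := by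
  have hR : R.Nonempty := by
    by_contra h
    rw [Finset.not_nonempty_iff_eq_empty] at h
    rw [h, Finset.coe_empty, Submodule.span_empty] at hspan
    have := finrank_top ℝ V
    rw [← hspan, finrank_bot] at this
    omega
  obtain ⟨α, hα⟩ := hR
  have key : ∃ γ ∈ R, ⟪α, γ⟫ ≠ 0 ∧ ¬ (γ = α ∨ γ = -α) := by
    by_contra hcon
    push Not at hcon
    refine hirr ⟨R.filter (fun γ => γ = α ∨ γ = -α), R.filter (fun γ => ¬ (γ = α ∨ γ = -α)),
      ⟨α, by simp [hα]⟩, ?_, Finset.disjoint_filter_filter_not _ _ _,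
      (Finset.filter_union_filter_not_eq _ _).symm, ?_⟩
    · by_contra hem
      rw [Finset.not_nonempty_iff_eq_empty, Finset.filter_eq_empty_iff] at hem
      have hle : Submodule.span ℝ (R : Set V) ≤ Submodule.span ℝ {α} := by
        rw [Submodule.span_le]
        intro γ hγ
        have : γ = α ∨ γ = -α := not_not.1 (hem hγ)
        rcases this with rfl | rfl
        · exact Submodule.mem_span_singleton_self _
        · exact neg_mem (Submodule.mem_span_singleton_self _)
      rw [hspan, top_le_iff] at hle
      have h1 := finrank_span_singleton (K := ℝ) (H.ne0 hα)
      rw [hle, finrank_top] at h1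
      omega
    · intro x hx y hy
      rw [Finset.mem_filter] at hx hy
      have hz : ⟪α, y⟫ = 0 := by
        by_contra h0
        exact hy.2 (hcon y hy.1 h0)
      rcases hx.2 with rfl | rfl
      · exact hz
      · rw [inner_neg_left, hz, neg_zero]
  obtain ⟨γ, hγ, hne, hnot⟩ := key
  wlog hlt : ⟪α, γ⟫ < 0 generalizing γ
  · refine this (-γ) (H.hneg γ hγ) ?_ ?_ ?_
    · rw [inner_neg_right]; exact neg_ne_zero.2 hne
    · rintro (h | h)
      · exact hnot (Or.inr (by rw [← h, neg_neg]))
      · exact hnot (Or.inl (neg_injective h))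
    · rw [inner_neg_right]
      have := lt_of_le_of_ne (not_lt.1 hlt) hne.symm
      linarith
  rcases H.bad_neg hα hγ hlt (hbad α hα) with t | t | t
  · exact absurd (Or.inr t) hnot
  · exact ⟨α, hα, γ, hγ, t⟩
  · exact ⟨γ, hγ, α, hα, t⟩

lemma b2_card (H : Sys R r f) {α β : V} (hα : α ∈ R) (hβ : β ∈ R)
    (hb : ⟪β, β⟫ = 2 * ⟪α, α⟫) (hc : ⟪α, β⟫ = - ⟪α, α⟫)
    (hall : ∀ γ ∈ R, ∃ i j : ℝ, γ = i • α + j • β) : R.card = 8 := by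
  have ha := H.npos hα
  have hD : ⟪α, α⟫ * ⟪β, β⟫ - ⟪α, β⟫ ^ 2 ≠ 0 := by
    rw [hb, hc]; nlinarith [mul_pos ha ha]
  obtain ⟨-, -, r11, r21, -, -⟩ := H.b2_roots hα hβ hb hc
  have r10 : rho α β 1 0 ∈ R := by rwa [rho_left]
  have r01 : rho α β 0 1 ∈ R := by rwa [rho_right]
  have n10 := H.hneg _ r10
  have n01 := H.hneg _ r01
  have n11 := H.hneg _ r11
  have n21 := H.hneg _ r21
  rw [rho_neg] at n10 n01 n11 n21
  let S : Finset (ℤ × ℤ) :=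
    {(1, 0), (0, 1), (1, 1), (2, 1), (-1, 0), (0, -1), (-1, -1), (-2, -1)}
  have hS : S.card = 8 := by decide
  have hRS : R = S.image (fun p => rho α β (p.1 : ℝ) (p.2 : ℝ)) := by
    ext γ
    constructor
    · intro hγ
      obtain ⟨i, j, hij⟩ := hall γ hγ
      have aux : ∀ (a b : ℤ), (a, b) ∈ S → (-a, -b) ∈ S →
          (γ = rho α β (a : ℝ) (b : ℝ) ∨ γ = - rho α β (a : ℝ) (b : ℝ)) →
          γ ∈ S.image (fun p => rho α β (p.1 : ℝ) (p.2 : ℝ)) := by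
        intro a b h1 h2 h
        rw [Finset.mem_image]
        rcases h with h | h
        · exact ⟨(a, b), h1, h.symm⟩
        · refine ⟨(-a, -b), h2, ?_⟩
          rw [h, rho_neg]; push_cast; rfl
      rcases H.b2_list hα hβ hb hc hγ hij with t | t | t | t
      · have t' := H.pm_rho j r01 hγ hij (by linarith) (by linarith)
        exact aux 0 1 (by decide) (by decide) (by simpa using t')
      · have t' := H.pm_rho i r10 hγ hij (by linarith) (by linarith)
        exact aux 1 0 (by decide) (by decide) (by simpa using t')
      · have t' := H.pm_rho j r11 hγ hij (by linarith) (by linarith)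
        exact aux 1 1 (by decide) (by decide) (by simpa using t')
      · have t' := H.pm_rho j r21 hγ hij (by linarith) (by linarith)
        exact aux 2 1 (by decide) (by decide) (by simpa using t')
    · intro hγ
      rw [Finset.mem_image] at hγ
      obtain ⟨p, hp, rfl⟩ := hγ
      simp only [S, Finset.mem_insert, Finset.mem_singleton] at hp
      rcases hp with rfl | rfl | rfl | rfl | rfl | rfl | rfl | rfl <;> simp at * <;> assumption
  rw [hRS, Finset.card_image_of_injOn, hS]
  intro p _ q _ h
  have := rho_inj hD h
  exact Prod.ext (by exact_mod_cast this.1) (by exact_mod_cast this.2)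

lemma not_all_bad (H : Sys R r f) (hdim : 2 ≤ Module.finrank ℝ V)
    (hirr : ¬ ∃ R₁ R₂ : Finset V, R₁.Nonempty ∧ R₂.Nonempty ∧ Disjoint R₁ R₂ ∧
      R = R₁ ∪ R₂ ∧ ∀ α ∈ R₁, ∀ β ∈ R₂, ⟪α, β⟫ = 0)
    (hspan : Submodule.span ℝ (R : Set V) = ⊤)
    (hnotB2 : ¬ (Module.finrank ℝ V = 2 ∧ R.card = 8)) (hbad : ∀ α ∈ R, ¬ GoodFn (f α)) :
    False := by
  obtain ⟨α, hα, β, hβ, hb, hc⟩ := H.exists_B hdim hirr hspan hbad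
  have ha := H.npos hα
  have hD : ⟪α, α⟫ * ⟪β, β⟫ - ⟪α, β⟫ ^ 2 ≠ 0 := by
    rw [hb, hc]; nlinarith [mul_pos ha ha]
  obtain ⟨-, -, r11, r21, -, -⟩ := H.b2_roots hα hβ hb hc
  by_cases hall : ∀ γ ∈ R, ∃ i j : ℝ, γ = i • α + j • β
  · refine hnotB2 ⟨le_antisymm ?_ hdim, H.b2_card hα hβ hb hc hall⟩
    have hle : Submodule.span ℝ (R : Set V) ≤ Submodule.span ℝ (({α, β} : Finset V) : Set V) := by
      rw [Submodule.span_le]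
      intro γ hγ
      obtain ⟨i, j, rfl⟩ := hall γ hγ
      exact add_mem (Submodule.smul_mem _ _ (Submodule.subset_span (by simp)))
        (Submodule.smul_mem _ _ (Submodule.subset_span (by simp)))
    rw [hspan, top_le_iff] at hle
    have h1 := finrank_span_finset_le_card (R := ℝ) ({α, β} : Finset V)
    rw [Set.finrank, hle, finrank_top] at h1
    exact h1.trans Finset.card_le_two
  · push Not at hall
    obtain ⟨γ₀, hγ₀, hout⟩ := hall
    have key : ∃ δ ∈ R, ∃ γ ∈ R, (∃ i j : ℝ, δ = i • α + j • β) ∧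
        (¬ ∃ i j : ℝ, γ = i • α + j • β) ∧ ⟪δ, γ⟫ ≠ 0 := by
      by_contra hcon
      push Not at hcon
      refine hirr ⟨R.filter (fun γ => ∃ i j : ℝ, γ = i • α + j • β),
        R.filter (fun γ => ¬ ∃ i j : ℝ, γ = i • α + j • β),
        ⟨α, ?_⟩, ⟨γ₀, ?_⟩, Finset.disjoint_filter_filter_not _ _ _,
        (Finset.filter_union_filter_not_eq _ _).symm, ?_⟩
      · rw [Finset.mem_filter]
        exact ⟨hα, 1, 0, by simp⟩
      · rw [Finset.mem_filter]
        exact ⟨hγ₀, by push Not; exact hout⟩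
      · intro x hx y hy
        rw [Finset.mem_filter] at hx hy
        exact hcon x hx.1 y hy.1 hx.2 (by have := hy.2; push Not at this; exact this)
    obtain ⟨δ, hδ, γ, hγ, ⟨i, j, hij⟩, hnP, hne⟩ := key
    have hpair : ∀ p q : ℝ, rho α β p q ∈ R → ⟪rho α β p q, γ⟫ ≠ 0 →
        ⟪γ, γ⟫ = 2 * ⟪rho α β p q, rho α β p q⟫ ∨ ⟪rho α β p q, rho α β p q⟫ = 2 * ⟪γ, γ⟫ := by
      intro p q hpq h
      refine (H.bad_pair hpq hγ h (hbad _ hpq)).resolve_left ?_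
      rintro (e | e)
      · exact hnP ⟨p, q, e⟩
      · exact hnP ⟨-p, -q, by rw [e, rho_neg]; rfl⟩
    have r10 : rho α β 1 0 ∈ R := by rwa [rho_left]
    have r01 : rho α β 0 1 ∈ R := by rwa [rho_right]
    have hij' : i * ⟪α, γ⟫ + j * ⟪β, γ⟫ ≠ 0 := by
      rw [hij, inner_add_left, real_inner_smul_left, real_inner_smul_left] at hne
      exact hne
    have p10 := hpair _ _ r10
    have p01 := hpair _ _ r01
    have p11 := hpair _ _ r11
    have p21 := hpair _ _ r21
    simp only [inner_rho] at p10 p01 p11 p21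
    simp only [inner_rho_left, hb, hc] at p10 p01 p11 p21
    have hcp := H.npos hγ
    have short : ⟪γ, γ⟫ = 2 * ⟪α, α⟫ ∨ ⟪α, α⟫ = 2 * ⟪γ, γ⟫ := by
      by_cases h1 : ⟪α, γ⟫ = 0
      · have h2 : ⟪β, γ⟫ ≠ 0 := by
          intro h2; rw [h1, h2] at hij'; simp at hij'
        rcases p11 (by rw [h1]; simpa using h2) with t | t
        · left; linarith
        · right; linarith
      · rcases p10 (by simpa using h1) with t | t
        · left; linarith
        · right; linarith
    have long : ⟪γ, γ⟫ = 4 * ⟪α, α⟫ ∨ ⟪α, α⟫ = ⟪γ, γ⟫ := by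
      by_cases h1 : ⟪β, γ⟫ = 0
      · have h2 : ⟪α, γ⟫ ≠ 0 := by
          intro h2; rw [h1, h2] at hij'; simp at hij'
        rcases p21 (by rw [h1]; simpa using h2) with t | t
        · left; linarith
        · right; linarith
      · rcases p01 (by simpa using h1) with t | t
        · left; linarith
        · right; linarith
    rcases short with t | t <;> rcases long with t' | t' <;> linarith

lemma all_good (H : Sys R r f) (hdim : 2 ≤ Module.finrank ℝ V)
    (hirr : ¬ ∃ R₁ R₂ : Finset V, R₁.Nonempty ∧ R₂.Nonempty ∧ Disjoint R₁ R₂ ∧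
      R = R₁ ∪ R₂ ∧ ∀ α ∈ R₁, ∀ β ∈ R₂, ⟪α, β⟫ = 0)
    (hspan : Submodule.span ℝ (R : Set V) = ⊤)
    (hnotB2 : ¬ (Module.finrank ℝ V = 2 ∧ R.card = 8)) :
    ∀ α ∈ R, GoodFn (f α) := by
  by_contra hcon
  push Not at hcon
  obtain ⟨γ, hγ, hγb⟩ := hcon
  by_cases hex : ∃ α ∈ R, GoodFn (f α)
  · obtain ⟨α, hα, hg⟩ := hex
    refine hirr ⟨R.filter (fun γ => GoodFn (f γ)), R.filter (fun γ => ¬ GoodFn (f γ)),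
      ⟨α, by simp [hα, hg]⟩, ⟨γ, by simp [hγ, hγb]⟩, Finset.disjoint_filter_filter_not _ _ _,
      (Finset.filter_union_filter_not_eq _ _).symm, ?_⟩
    intro x hx y hy
    rw [Finset.mem_filter] at hx hy
    by_contra h0
    exact hy.2 (H.good_trans hx.1 hy.1 h0 hx.2)
  · push Not at hex
    exact H.not_all_bad hdim hirr hspan hnotB2 hex

/-- A good root function agrees with `c / z` wherever it is analytic. -/
lemma good_global (H : Sys R r f) {α : V} (hα : α ∈ R) {c : ℂ}
    (hc : ∀ᶠ z in 𝓝[≠] (0 : ℂ), f α z = c / z) {z : ℂ} (hz : z ∈ ball (0 : ℂ) r) (hz0 : z ≠ 0)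
    (han : AnalyticAt ℂ (f α) z) : f α z = c / z := by
  have hg : MeromorphicOn (fun w => f α w - c / w) (ball (0 : ℂ) r) := by
    intro w hw
    exact (H.hmer α hα w hw).sub ((MeromorphicAt.const c w).div (MeromorphicAt.id w))
  have htop : meromorphicOrderAt (fun w => f α w - c / w) z = ⊤ := by
    by_contra hh
    have := hg.meromorphicOrderAt_ne_top_of_isPreconnected (convex_ball _ _).isPreconnected
      hz (mem_ball_self H.hr) hh
    refine this (meromorphicOrderAt_eq_top_iff.2 ?_)
    filter_upwards [hc] with w hw
    rw [hw, sub_self]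
  rw [meromorphicOrderAt_eq_top_iff] at htop
  have hcont : ContinuousAt (fun w => f α w - c / w) z :=
    han.continuousAt.sub (continuousAt_const.div continuousAt_id hz0)
  have h1 : Tendsto (fun w => f α w - c / w) (𝓝[≠] z) (𝓝 (f α z - c / z)) :=
    hcont.tendsto.mono_left nhdsWithin_le_nhds
  have h2 : Tendsto (fun w => f α w - c / w) (𝓝[≠] z) (𝓝 0) :=
    tendsto_const_nhds.congr' (htop.mono fun w hw => hw.symm)
  exact sub_eq_zero.1 (tendsto_nhds_unique h1 h2)

lemma conclusion (H : Sys R r f) (hall : ∀ α ∈ R, GoodFn (f α)) :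
    ∃ k : V → ℂ, (∀ α ∈ R, ∀ β ∈ R, k (reflectIn α β) = k β) ∧
      ∀ α ∈ R, ∀ z ∈ ball (0 : ℂ) r, z ≠ 0 → AnalyticAt ℂ (f α) z →
        f α z = k α / z := by
  let K : (ℂ → ℂ) → ℂ := fun g =>
    if h : ∃ c : ℂ, ∀ᶠ z in 𝓝[≠] (0 : ℂ), g z = c / z then h.choose else 0
  refine ⟨fun α => K (f α), fun α hα β hβ => congrArg K (H.hinv α hα β hβ), ?_⟩
  intro α hα z hz hz0 han
  have hex : ∃ c : ℂ, ∀ᶠ z in 𝓝[≠] (0 : ℂ), f α z = c / z := hall α hα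
  have hK : K (f α) = hex.choose := dif_pos hex
  change f α z = K (f α) / z
  rw [hK]
  exact H.good_global hα hex.choose_spec hz hz0 han

end Sys
end Global

theorem invariant_solutions_are_dunkl
    {V : Type*} [NormedAddCommGroup V] [InnerProductSpace ℝ V] [FiniteDimensional ℝ V]
    (hdim : 2 ≤ Module.finrank ℝ V)
    (R : Finset V)
    -- `R` is a reduced root system:
    (h0 : (0 : V) ∉ R)
    (hline : ∀ α ∈ R, ∀ c : ℝ, c • α ∈ R → c • α = α ∨ c • α = -α)
    (hneg : ∀ α ∈ R, -α ∈ R)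
    (hrefl : ∀ α ∈ R, ∀ β ∈ R, reflectIn α β ∈ R)
    -- crystallographic:
    (hcrys : ∀ α ∈ R, ∀ β ∈ R, ∃ n : ℤ, 2 * ⟪α, β⟫ / ⟪α, α⟫ = (n : ℝ))
    -- irreducible:
    (hirr : ¬ ∃ R₁ R₂ : Finset V, R₁.Nonempty ∧ R₂.Nonempty ∧ Disjoint R₁ R₂ ∧
      R = R₁ ∪ R₂ ∧ ∀ α ∈ R₁, ∀ β ∈ R₂, ⟪α, β⟫ = 0)
    -- spanning:
    (hspan : Submodule.span ℝ (R : Set V) = ⊤)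
    -- not of type `A₁` or `B₂`:
    (hnotB2 : ¬ (Module.finrank ℝ V = 2 ∧ R.card = 8))
    (r : ℝ) (hr : 0 < r)
    (f : V → ℂ → ℂ)
    (hmer : ∀ α ∈ R, MeromorphicOn (f α) (ball (0 : ℂ) r))
    (hne : ∀ α ∈ R, ∃ z ∈ ball (0 : ℂ) r, AnalyticAt ℂ (f α) z ∧ f α z ≠ 0)
    (hodd : ∀ α ∈ R, ∀ z ∈ ball (0 : ℂ) r,
      AnalyticAt ℂ (f (-α)) z → AnalyticAt ℂ (f α) (-z) → f (-α) z = -(f α (-z)))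
    -- `W`-invariance (invariance under the generating reflections):
    (hinv : ∀ α ∈ R, ∀ β ∈ R, f (reflectIn α β) = f β)
    -- the functional equations:
    (hfe : ∀ w : V ≃ₗᵢ[ℝ] V, ∀ ξ η : V, ∀ x : V,
      (∀ α ∈ R, ((⟪α, x⟫ : ℝ) : ℂ) ∈ ball (0 : ℂ) r ∧
        ∀ β ∈ R, AnalyticAt ℂ (f β) ((⟪α, x⟫ : ℝ) : ℂ)) →
      ∑ p ∈ R ×ˢ R,
        (if (∀ y : V, reflectIn p.1 (reflectIn p.2 y) = w y) then
          (bracket ξ η p.1 p.2 : ℂ) * f p.1 ((⟪p.1, x⟫ : ℝ) : ℂ)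
            * f p.2 ((⟪reflectIn p.1 p.2, x⟫ : ℝ) : ℂ)
        else 0) = 0) :
    ∃ k : V → ℂ, (∀ α ∈ R, ∀ β ∈ R, k (reflectIn α β) = k β) ∧
      ∀ α ∈ R, ∀ z ∈ ball (0 : ℂ) r, z ≠ 0 → AnalyticAt ℂ (f α) z →
        f α z = k α / z := by
  have H : Sys R r f :=
    ⟨h0, hline, hneg, hrefl, hcrys, hr, hmer, hne, hodd, hinv, hfe⟩
  exact H.conclusion (H.all_good hdim hirr hspan hnotB2)
end
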